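/- Let u be a smooth solution of (−Δ)^{3/2}u = 2e^{3u} with finite volume. Then p := u − v is a polynomial of degree 0 or of degree 2 which is bounded from above on ℝ³. Moreover v satisfies: |∇v(x)| → 0 and the second derivatives D²v(x) → 0 as |x| → ∞, and v(x) = −α log|x| + o(log|x|) as |x| → ∞, where α > 0. -/

import Mathlib

open MeasureTheory Real Filter

noncomputable section

abbrev E3 := EuclideanSpace ℝ (Fin 3)

/-- The Laplacian of `f : ℝ³ → ℝ` as the sum of second partial derivatives. -/
def lap (f : E3 → ℝ) (x : E3) : ℝ :=
  ∑ i, fderiv ℝ (fun y => fderiv ℝ f y (EuclideanSpace.single i 1)) x (EuclideanSpace.single i 1)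

/-- The half Laplacian `(-Δ)^{1/2} φ` of a Schwartz function on ℝ³, defined as a
principal value: `(1/π²) lim_{ε→0⁺} ∫_{|x−y|>ε} (φ(x)−φ(y))/|x−y|⁴ dy`. -/
def halfLap (φ : SchwartzMap E3 ℝ) (x : E3) : ℝ :=
  limUnder (nhdsWithin (0:ℝ) (Set.Ioi 0)) fun ε =>
    (1 / π ^ 2) * ∫ y in {y : E3 | ε < ‖x - y‖}, (φ x - φ y) / ‖x - y‖ ^ 4

/-- `w ∈ L_{1/2}(ℝ³)`. -/
def MemL12 (w : E3 → ℝ) : Prop :=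
  LocallyIntegrable w volume ∧ Integrable (fun x => |w x| / (1 + ‖x‖ ^ 4)) volume

/-- `u` is a smooth solution of `(-Δ)^{3/2} u = 2 e^{3u}` in ℝ³ with finite volume. -/
def IsSolution (u : E3 → ℝ) : Prop :=
  ContDiff ℝ (⊤ : ℕ∞) u ∧ MemL12 (lap u) ∧ Integrable (fun x => exp (3 * u x)) volume ∧
    ∀ φ : SchwartzMap E3 ℝ,
      ∫ x, (-(lap u x)) * halfLap φ x = 2 * ∫ x, exp (3 * u x) * φ x

/-- `u` is a spherical solution. -/
def IsSpherical (u : E3 → ℝ) : Prop :=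
  ∃ lam : ℝ, 0 < lam ∧ ∃ x₀ : E3, ∀ x, u x = log (2 * lam / (1 + lam ^ 2 * ‖x - x₀‖ ^ 2))

/-- `α = (1/π²) ∫ e^{3u}`. -/
def solAlpha (u : E3 → ℝ) : ℝ := (1 / π ^ 2) * ∫ y, exp (3 * u y)

/-- `v(x) = (1/π²) ∫ log(|y|/|x−y|) e^{3u(y)} dy`. -/
def solV (u : E3 → ℝ) (x : E3) : ℝ :=
  (1 / π ^ 2) * ∫ y, log (‖y‖ / ‖x - y‖) * exp (3 * u y)

end

open scoped Topology

/-! ### Riesz kernels on `ℝ³` -/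

lemma finrank_E3 : Module.finrank ℝ E3 = 3 := by simp

lemma integrableOn_inv_norm_pow {k : ℕ} (hk : k ≤ 2) (r : ℝ) :
    IntegrableOn (fun z : E3 => (‖z‖ ^ k)⁻¹) (Metric.ball 0 r) := by
  rw [integrableOn_fun_norm_addHaar volume (f := fun t => (t ^ k)⁻¹), finrank_E3]
  have h : IntegrableOn (fun y : ℝ => y ^ (2 - k)) (Set.Ioo 0 r) :=
    (Continuous.integrableOn_Icc (by fun_prop)).mono_set Set.Ioo_subset_Icc_self
  refine h.congr_fun (fun y hy => ?_) measurableSet_Ioo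
  have : y ≠ 0 := hy.1.ne'
  simp only [smul_eq_mul]
  rw [pow_sub₀ _ this hk]

lemma integrableOn_inv_norm_sub_pow {k : ℕ} (hk : k ≤ 2) (x : E3) (r : ℝ) :
    IntegrableOn (fun y : E3 => (‖x - y‖ ^ k)⁻¹) (Metric.ball x r) := by
  have h := (integrableOn_inv_norm_pow hk r).integrable_indicator measurableSet_ball
  have h2 := h.comp_sub_left x
  rw [← integrable_indicator_iff measurableSet_ball]
  refine h2.congr (Eventually.of_forall fun y => ?_)
  simp [Set.indicator, dist_eq_norm, norm_sub_rev]

lemma setIntegral_inv_norm_sub_pow {k : ℕ} (x : E3) (r : ℝ) :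
    ∫ y in Metric.ball x r, (‖x - y‖ ^ k)⁻¹ = ∫ z in Metric.ball (0 : E3) r, (‖z‖ ^ k)⁻¹ := by
  rw [← integral_indicator measurableSet_ball, ← integral_indicator measurableSet_ball,
    ← integral_sub_left_eq_self _ volume x]
  congr 1
  ext y
  simp [Set.indicator, dist_eq_norm]

/-- `|x - y|^{-k} f(y)` is dominated by its singular part near `x` plus `r^{-k} |f|`. -/
lemma riesz_integrand_le {f : E3 → ℝ} {k : ℕ} {x : E3} {r M : ℝ} (hr : 0 < r)
    (hM : ∀ y ∈ Metric.ball x r, |f y| ≤ M) (y : E3) :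
    (‖x - y‖ ^ k)⁻¹ * |f y| ≤
      (Metric.ball x r).indicator (fun y => M * (‖x - y‖ ^ k)⁻¹) y + (r ^ k)⁻¹ * |f y| := by
  by_cases hy : y ∈ Metric.ball x r
  · rw [Set.indicator_of_mem hy, mul_comm]
    have := mul_le_mul_of_nonneg_right (hM y hy) (inv_nonneg.2 (pow_nonneg (norm_nonneg (x - y)) k))
    have : 0 ≤ (r ^ k)⁻¹ * |f y| := by positivity
    linarith
  · rw [Set.indicator_of_notMem hy, zero_add]
    rw [Metric.mem_ball, not_lt, dist_comm, dist_eq_norm] at hy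
    gcongr

lemma riesz_integrable_of_bound {f : E3 → ℝ} (hi : Integrable f) {k : ℕ} (hk : k ≤ 2) {x : E3}
    {r M : ℝ} (hr : 0 < r) (hM : ∀ y ∈ Metric.ball x r, |f y| ≤ M) :
    Integrable (fun y => (‖x - y‖ ^ k)⁻¹ * f y) := by
  have h1 : Integrable (fun y => (Metric.ball x r).indicator (fun y => M * (‖x - y‖ ^ k)⁻¹) y
      + (r ^ k)⁻¹ * |f y|) :=
    (IntegrableOn.integrable_indicator ((integrableOn_inv_norm_sub_pow hk x r).const_mul M)
      measurableSet_ball).add (hi.abs.const_mul _)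
  refine h1.mono' ?_ (Eventually.of_forall fun y => ?_)
  · exact (Measurable.aestronglyMeasurable (by fun_prop)).mul hi.aestronglyMeasurable
  · rw [norm_mul, norm_inv, norm_pow, norm_norm, Real.norm_eq_abs]
    exact riesz_integrand_le hr hM y

lemma riesz_le_of_bound {f : E3 → ℝ} (hi : Integrable f) {k : ℕ} (hk : k ≤ 2) {x : E3}
    {r M : ℝ} (hr : 0 < r) (hM : ∀ y ∈ Metric.ball x r, |f y| ≤ M) :
    ∫ y, (‖x - y‖ ^ k)⁻¹ * |f y| ≤
      M * (∫ z in Metric.ball (0 : E3) r, (‖z‖ ^ k)⁻¹) + (r ^ k)⁻¹ * ∫ y, |f y| := by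
  have h1 : Integrable (fun y => (Metric.ball x r).indicator (fun y => M * (‖x - y‖ ^ k)⁻¹) y) :=
    (IntegrableOn.integrable_indicator ((integrableOn_inv_norm_sub_pow hk x r).const_mul M)
      measurableSet_ball)
  have h2 := hi.abs.const_mul (r ^ k)⁻¹
  calc _ ≤ ∫ y, ((Metric.ball x r).indicator (fun y => M * (‖x - y‖ ^ k)⁻¹) y
      + (r ^ k)⁻¹ * |f y|) := by
        refine integral_mono ?_ (h1.add h2) (riesz_integrand_le hr hM)
        exact riesz_integrable_of_bound hi.abs hk hr (by simpa using hM)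
    _ = _ := by
        rw [integral_add h1 h2, integral_indicator measurableSet_ball, integral_const_mul,
          integral_const_mul, setIntegral_inv_norm_sub_pow]

lemma exists_bound_ball {f : E3 → ℝ} (hc : Continuous f) (x : E3) (r : ℝ) :
    ∃ M, 0 ≤ M ∧ ∀ y ∈ Metric.ball x r, |f y| ≤ M := by
  obtain ⟨M, hM⟩ := (isCompact_closedBall x r).exists_bound_of_continuousOn hc.continuousOn
  exact ⟨max M 0, le_max_right _ _, fun y hy =>
    (hM y (Metric.ball_subset_closedBall hy)).trans (le_max_left _ _)⟩

lemma riesz_integrable {f : E3 → ℝ} (hc : Continuous f) (hi : Integrable f) {k : ℕ} (hk : k ≤ 2)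
    (x : E3) : Integrable (fun y => (‖x - y‖ ^ k)⁻¹ * f y) := by
  obtain ⟨M, -, hM⟩ := exists_bound_ball hc x 1
  exact riesz_integrable_of_bound hi hk one_pos hM

lemma tendsto_setIntegral_inv_norm_pow {k : ℕ} (hk : k ≤ 2) :
    Tendsto (fun r => ∫ z in Metric.ball (0 : E3) r, (‖z‖ ^ k)⁻¹) (𝓝[>] 0) (𝓝 0) := by
  have h := integrableOn_inv_norm_pow hk 1
  have key : Tendsto (fun r => ∫ z in Metric.ball (0 : E3) 1,
      (Metric.ball 0 r).indicator (fun z => (‖z‖ ^ k)⁻¹) z) (𝓝[>] 0) (𝓝 0) := by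
    rw [show 𝓝 (0 : ℝ) = 𝓝 (∫ z in Metric.ball (0 : E3) 1, (0 : ℝ)) by simp]
    refine tendsto_integral_filter_of_dominated_convergence (fun z => (‖z‖ ^ k)⁻¹) ?_ ?_ h ?_
    · refine Eventually.of_forall fun r => ?_
      exact ((by fun_prop : Measurable (fun z : E3 => (‖z‖ ^ k)⁻¹)).indicator
        measurableSet_ball).aestronglyMeasurable
    · refine Eventually.of_forall fun r => Eventually.of_forall fun z => ?_
      refine (norm_indicator_le_norm_self _ _).trans ?_
      simp
    · have : ∀ᵐ z : E3 ∂(volume.restrict (Metric.ball 0 1)), z ≠ 0 :=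
        ae_restrict_of_ae (by simp [ae_iff])
      filter_upwards [this] with z hz
      refine tendsto_const_nhds.congr' ?_
      have : ∀ᶠ r in 𝓝[>] (0 : ℝ), r < ‖z‖ :=
        nhdsWithin_le_nhds (Iio_mem_nhds (norm_pos_iff.2 hz))
      filter_upwards [this] with r hr
      rw [Set.indicator_of_notMem]
      simp [hr.le]
  refine key.congr' ?_
  have : ∀ᶠ r in 𝓝[>] (0 : ℝ), r < 1 := nhdsWithin_le_nhds (Iio_mem_nhds one_pos)
  filter_upwards [this] with r hr
  rw [setIntegral_indicator measurableSet_ball, Set.inter_eq_self_of_subset_right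
    (Metric.ball_subset_ball hr.le)]

lemma isCountablyGenerated_cobounded_E3 : (Bornology.cobounded E3).IsCountablyGenerated := by
  rw [← comap_norm_atTop]
  infer_instance

/-- Riesz potentials of bounded integrable functions vanish at infinity. -/
lemma tendsto_riesz {f : E3 → ℝ} (hc : Continuous f) (hi : Integrable f) {M : ℝ}
    (hM : ∀ y, |f y| ≤ M) {k : ℕ} (hk0 : k ≠ 0) (hk : k ≤ 2) :
    Tendsto (fun x => ∫ y, (‖x - y‖ ^ k)⁻¹ * |f y|) (Bornology.cobounded E3) (𝓝 0) := by
  have hint := fun x => riesz_integrable hc.abs hi.abs hk x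
  rw [Metric.tendsto_nhds]
  intro ε hε
  have hr : ∀ᶠ r in 𝓝[>] (0 : ℝ), M * (∫ z in Metric.ball (0 : E3) r, (‖z‖ ^ k)⁻¹) < ε / 2 := by
    have := (tendsto_setIntegral_inv_norm_pow hk).const_mul M
    rw [mul_zero] at this
    exact this.eventually (Iio_mem_nhds (half_pos hε))
  obtain ⟨r, hr, hr0⟩ := (hr.and self_mem_nhdsWithin).exists
  have hr0 : 0 < r := hr0
  have hfar : Tendsto (fun x => ∫ y, (Metric.ball x r)ᶜ.indicator
      (fun y => (‖x - y‖ ^ k)⁻¹ * |f y|) y) (Bornology.cobounded E3) (𝓝 0) := by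
    rw [show 𝓝 (0 : ℝ) = 𝓝 (∫ y : E3, (0 : ℝ)) by simp]
    have := isCountablyGenerated_cobounded_E3
    refine tendsto_integral_filter_of_dominated_convergence (fun y => (r ^ k)⁻¹ * |f y|) ?_ ?_
      (hi.abs.const_mul _) ?_
    · exact Eventually.of_forall fun x =>
        (hint x).aestronglyMeasurable.indicator measurableSet_ball.compl
    · refine Eventually.of_forall fun x => Eventually.of_forall fun y => ?_
      by_cases hy : y ∈ Metric.ball x r
      · rw [Set.indicator_of_notMem (by simpa using hy), norm_zero]; positivity
      · rw [Set.indicator_of_mem (by simpa using hy), norm_mul, norm_inv, norm_pow, norm_norm,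
          Real.norm_eq_abs, abs_abs]
        rw [Metric.mem_ball, not_lt, dist_comm, dist_eq_norm] at hy
        gcongr
    · refine Eventually.of_forall fun y => ?_
      have h1 : Tendsto (fun x : E3 => ‖x - y‖) (Bornology.cobounded E3) atTop := by
        refine tendsto_atTop_mono (fun x => norm_sub_norm_le x y) ?_
        exact tendsto_atTop_add_const_right _ _ tendsto_norm_cobounded_atTop
      have h2 : Tendsto (fun x : E3 => (‖x - y‖ ^ k)⁻¹ * |f y|) (Bornology.cobounded E3) (𝓝 0) := by
        have := (tendsto_inv_atTop_zero.comp ((tendsto_pow_atTop hk0).comp h1)).mul_const |f y|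
        simpa using this
      refine squeeze_zero (fun x => Set.indicator_nonneg (fun _ _ => by positivity) _)
        (fun x => Set.indicator_le_self' (fun _ _ => by positivity) _) h2
  filter_upwards [hfar.eventually (Iio_mem_nhds (half_pos hε))] with x hx
  have hsplit : ∫ y, (‖x - y‖ ^ k)⁻¹ * |f y| =
      (∫ y in Metric.ball x r, (‖x - y‖ ^ k)⁻¹ * |f y|) +
      ∫ y in (Metric.ball x r)ᶜ, (‖x - y‖ ^ k)⁻¹ * |f y| :=
    (integral_add_compl measurableSet_ball (hint x)).symm
  have hnear : (∫ y in Metric.ball x r, (‖x - y‖ ^ k)⁻¹ * |f y|) ≤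
      M * (∫ z in Metric.ball (0 : E3) r, (‖z‖ ^ k)⁻¹) := by
    rw [← setIntegral_inv_norm_sub_pow x, ← integral_const_mul]
    refine integral_mono (hint x).integrableOn
      ((integrableOn_inv_norm_sub_pow hk x r).const_mul M) fun y => ?_
    simp only
    rw [mul_comm]
    gcongr
    exact hM y
  rw [integral_indicator measurableSet_ball.compl] at hx
  rw [Real.dist_eq, sub_zero, abs_of_nonneg (integral_nonneg fun y => by positivity), hsplit]
  linarith

lemma setIntegral_inv_norm_ball {r : ℝ} (hr : 0 < r) :
    ∫ z in Metric.ball (0 : E3) r, ‖z‖⁻¹ = r ^ 2 * ∫ z in Metric.ball (0 : E3) 1, ‖z‖⁻¹ := by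
  have h := Measure.setIntegral_comp_smul (volume : Measure E3) (fun z : E3 => ‖z‖⁻¹)
    (Metric.ball (0 : E3) 1) hr.ne'
  rw [smul_unitBall_of_pos hr, finrank_E3, abs_of_pos (by positivity), smul_eq_mul] at h
  simp_rw [norm_smul, mul_inv] at h
  rw [integral_const_mul, Real.norm_eq_abs, abs_of_pos hr] at h
  field_simp at h ⊢
  linarith

/-! ### Logarithmic potentials -/

/-- The logarithmic potential of `f`, normalised to vanish at the origin. -/
noncomputable def logPot (f : E3 → ℝ) (x : E3) : ℝ := ∫ y, log (‖y‖ / ‖x - y‖) * f y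

lemma abs_log_div_le {a b : ℝ} (ha : 0 ≤ a) (hb : 0 ≤ b) :
    |log (a / b)| ≤ |a - b| * (a⁻¹ + b⁻¹) := by
  rcases ha.eq_or_lt with rfl | ha
  · simp only [zero_div, log_zero, abs_zero]; positivity
  rcases hb.eq_or_lt with rfl | hb
  · simp only [div_zero, log_zero, abs_zero]; positivity
  have h1 : log (a / b) ≤ a / b - 1 := log_le_sub_one_of_pos (by positivity)
  have h2 : log (b / a) ≤ b / a - 1 := log_le_sub_one_of_pos (by positivity)
  have h3 : log (b / a) = - log (a / b) := by rw [← log_inv, inv_div]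
  have e1 : a / b - 1 = (a - b) * b⁻¹ := by field_simp
  have e2 : b / a - 1 = -(a - b) * a⁻¹ := by field_simp; ring
  have k1 : (a - b) * b⁻¹ ≤ |a - b| * b⁻¹ := by gcongr; exact le_abs_self _
  have k2 : -(a - b) * a⁻¹ ≤ |a - b| * a⁻¹ := by gcongr; exact neg_le_abs _
  have k3 : 0 ≤ |a - b| * b⁻¹ := by positivity
  have k4 : 0 ≤ |a - b| * a⁻¹ := by positivity
  rw [abs_le, mul_add]
  constructor <;> linarith

lemma abs_log_ratio_le (x y : E3) :
    |log (‖y‖ / ‖x - y‖)| ≤ ‖x‖ * (‖y‖⁻¹ + ‖x - y‖⁻¹) := by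
  refine (abs_log_div_le (norm_nonneg _) (norm_nonneg _)).trans ?_
  gcongr
  have := abs_norm_sub_norm_le y (y - x)
  rwa [sub_sub_cancel, norm_sub_rev y x] at this

lemma riesz_one_integrable {f : E3 → ℝ} (hc : Continuous f) (hi : Integrable f) (x : E3) :
    Integrable (fun y => ‖x - y‖⁻¹ * f y) := by
  simpa using riesz_integrable hc hi (k := 1) (by norm_num) x

lemma riesz_zero_integrable {f : E3 → ℝ} (hc : Continuous f) (hi : Integrable f) :
    Integrable (fun y => ‖y‖⁻¹ * f y) := by
  simpa using riesz_one_integrable hc hi 0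

lemma logPot_integrable {f : E3 → ℝ} (hc : Continuous f) (hi : Integrable f) (x : E3) :
    Integrable (fun y => log (‖y‖ / ‖x - y‖) * f y) := by
  have h := (((riesz_zero_integrable hc hi).add (riesz_one_integrable hc hi x)).norm).const_mul ‖x‖
  refine h.mono' ((Measurable.aestronglyMeasurable (by fun_prop)).mul hi.aestronglyMeasurable) ?_
  refine Eventually.of_forall fun y => ?_
  have e : ‖y‖⁻¹ * f y + ‖x - y‖⁻¹ * f y = (‖y‖⁻¹ + ‖x - y‖⁻¹) * f y := by ring
  simp only [Pi.add_apply, e, norm_mul]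
  rw [Real.norm_eq_abs, ← mul_assoc]
  gcongr
  rw [Real.norm_of_nonneg (by positivity)]
  exact abs_log_ratio_le x y

lemma ae_ne (x : E3) : ∀ᵐ y : E3, y ≠ x := by simp [ae_iff]

lemma abs_logPot_sub_le {f : E3 → ℝ} (hc : Continuous f) (hi : Integrable f) (x x' : E3) :
    |logPot f x - logPot f x'| ≤
      ‖x - x'‖ * ((∫ y, ‖x - y‖⁻¹ * |f y|) + ∫ y, ‖x' - y‖⁻¹ * |f y|) := by
  have h1 := riesz_one_integrable hc.abs hi.abs x
  have h2 := riesz_one_integrable hc.abs hi.abs x'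
  rw [logPot, logPot, ← integral_sub (logPot_integrable hc hi x) (logPot_integrable hc hi x'),
    ← integral_add h1 h2, ← integral_const_mul]
  refine (abs_integral_le_integral_abs).trans ?_
  refine integral_mono_ae ((logPot_integrable hc hi x).sub (logPot_integrable hc hi x')).abs
    ((h1.add h2).const_mul _) ?_
  filter_upwards [ae_ne 0, ae_ne x, ae_ne x'] with y h0 hx hx'
  have n0 := norm_pos_iff.2 h0
  have nx := norm_pos_iff.2 (sub_ne_zero.2 hx.symm)
  have nx' := norm_pos_iff.2 (sub_ne_zero.2 hx'.symm)
  have e : log (‖y‖ / ‖x - y‖) * f y - log (‖y‖ / ‖x' - y‖) * f y =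
      log (‖x' - y‖ / ‖x - y‖) * f y := by
    rw [log_div n0.ne' nx.ne', log_div n0.ne' nx'.ne', log_div nx'.ne' nx.ne']; ring
  have k := abs_log_div_le (norm_nonneg (x' - y)) (norm_nonneg (x - y))
  have k2 : |‖x' - y‖ - ‖x - y‖| ≤ ‖x - x'‖ := by
    have := abs_norm_sub_norm_le (x' - y) (x - y)
    rwa [sub_sub_sub_cancel_right, norm_sub_rev x' x] at this
  simp only [e, abs_mul]
  calc _ ≤ ‖x - x'‖ * (‖x' - y‖⁻¹ + ‖x - y‖⁻¹) * |f y| := by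
        gcongr
        exact k.trans (by gcongr)
    _ = _ := by ring

/-- The second difference of `log |·|` is of order `|h|² |z|⁻²`. -/
lemma abs_log_second_diff_le {z h : E3} (hz : z ≠ 0) (h1 : z + h ≠ 0) (h2 : z - h ≠ 0) :
    |2 * log ‖z‖ - log ‖z + h‖ - log ‖z - h‖| ≤
      ‖h‖ ^ 2 * ((‖z‖ ^ 2)⁻¹ + (‖z + h‖ ^ 2)⁻¹ + (‖z - h‖ ^ 2)⁻¹) := by
  have n0 := norm_pos_iff.2 hz
  have n1 := norm_pos_iff.2 h1
  have n2 := norm_pos_iff.2 h2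
  have par : ‖z + h‖ ^ 2 + ‖z - h‖ ^ 2 = 2 * (‖z‖ ^ 2 + ‖h‖ ^ 2) := by
    have := parallelogram_law_with_norm ℝ z h
    nlinarith
  have pol : ‖z + h‖ ^ 2 * ‖z - h‖ ^ 2 = (‖z‖ ^ 2 + ‖h‖ ^ 2) ^ 2 - 4 * (inner ℝ z h) ^ 2 := by
    rw [norm_add_sq_real, norm_sub_sq_real]; ring
  have cs : (inner ℝ z h : ℝ) ^ 2 ≤ ‖z‖ ^ 2 * ‖h‖ ^ 2 := by
    rw [← mul_pow, ← sq_abs (inner ℝ z h)]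
    exact pow_le_pow_left₀ (abs_nonneg _) (abs_real_inner_le_norm z h) 2
  set a := ‖z‖ with ha
  set b := ‖z + h‖ with hb
  set c := ‖z - h‖ with hc
  set t := ‖h‖ with ht
  have ht0 : 0 ≤ t := norm_nonneg _
  have L : 2 * (2 * log a - log b - log c) = log (a ^ 4 / (b ^ 2 * c ^ 2)) := by
    rw [log_div (by positivity) (by positivity), log_mul (by positivity) (by positivity),
      log_pow, log_pow, log_pow]
    push_cast; ring
  have up : log (a ^ 4 / (b ^ 2 * c ^ 2)) ≤ 2 * t ^ 2 * ((b ^ 2)⁻¹ + (c ^ 2)⁻¹) := by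
    have k : log (a ^ 4 / (b ^ 2 * c ^ 2)) ≤ a ^ 4 / (b ^ 2 * c ^ 2) - 1 :=
      log_le_sub_one_of_pos (by positivity)
    refine k.trans ?_
    have e1 : a ^ 4 / (b ^ 2 * c ^ 2) - 1 = (a ^ 4 - b ^ 2 * c ^ 2) / (b ^ 2 * c ^ 2) := by
      field_simp
    have e2 : 2 * t ^ 2 * ((b ^ 2)⁻¹ + (c ^ 2)⁻¹) = 2 * t ^ 2 * (b ^ 2 + c ^ 2) / (b ^ 2 * c ^ 2) := by
      field_simp; ring
    rw [e1, e2]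
    gcongr
    rw [par, pol]
    nlinarith [sq_nonneg t, sq_nonneg (t ^ 2)]
  have lo : -log (a ^ 4 / (b ^ 2 * c ^ 2)) ≤ 2 * (t ^ 2 * (a ^ 2)⁻¹) := by
    rw [← log_inv, inv_div]
    have k1 : b ^ 2 * c ^ 2 / a ^ 4 ≤ (1 + t ^ 2 * (a ^ 2)⁻¹) ^ 2 := by
      have : (1 + t ^ 2 * (a ^ 2)⁻¹) ^ 2 = (a ^ 2 + t ^ 2) ^ 2 / a ^ 4 := by field_simp
      rw [this, pol]
      gcongr
      nlinarith [sq_nonneg (inner ℝ z h : ℝ)]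
    have k2 : log (1 + t ^ 2 * (a ^ 2)⁻¹) ≤ t ^ 2 * (a ^ 2)⁻¹ := by
      have := log_le_sub_one_of_pos (show 0 < 1 + t ^ 2 * (a ^ 2)⁻¹ by positivity)
      linarith
    calc _ ≤ log ((1 + t ^ 2 * (a ^ 2)⁻¹) ^ 2) := log_le_log (by positivity) k1
      _ = 2 * log (1 + t ^ 2 * (a ^ 2)⁻¹) := by rw [log_pow]; norm_num
      _ ≤ _ := by linarith
  have p1 : 0 ≤ t ^ 2 * (a ^ 2)⁻¹ := by positivity
  have p2 : 0 ≤ t ^ 2 * ((b ^ 2)⁻¹ + (c ^ 2)⁻¹) := by positivity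
  rw [abs_le]
  constructor <;> nlinarith

lemma abs_logPot_second_diff_le {f : E3 → ℝ} (hc : Continuous f) (hi : Integrable f) (x h : E3) :
    |logPot f (x + h) + logPot f (x - h) - 2 * logPot f x| ≤
      ‖h‖ ^ 2 * ((∫ y, (‖x - y‖ ^ 2)⁻¹ * |f y|) + (∫ y, (‖x + h - y‖ ^ 2)⁻¹ * |f y|)
        + ∫ y, (‖x - h - y‖ ^ 2)⁻¹ * |f y|) := by
  have g := fun x => riesz_integrable hc.abs hi.abs (k := 2) le_rfl x
  have l := logPot_integrable hc hi
  have l1 : Integrable fun y => log (‖y‖ / ‖x + h - y‖) * f y + log (‖y‖ / ‖x - h - y‖) * f y :=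
    (l (x + h)).add (l (x - h))
  have g12 : Integrable fun y => (‖x - y‖ ^ 2)⁻¹ * |f y| + (‖x + h - y‖ ^ 2)⁻¹ * |f y| :=
    (g x).add (g (x + h))
  have l2 := (l x).const_mul 2
  have e : logPot f (x + h) + logPot f (x - h) - 2 * logPot f x =
      ∫ y, ((log (‖y‖ / ‖x + h - y‖) * f y + log (‖y‖ / ‖x - h - y‖) * f y)
        - 2 * (log (‖y‖ / ‖x - y‖) * f y)) := by
    rw [integral_sub l1 l2, integral_add (l (x + h)) (l (x - h)), integral_const_mul]; rfl
  rw [e, ← integral_add (g x) (g (x + h)), ← integral_add g12 (g (x - h)),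
    ← integral_const_mul]
  refine (abs_integral_le_integral_abs).trans ?_
  refine integral_mono_ae (l1.sub l2).abs ((g12.add (g (x - h))).const_mul _) ?_
  filter_upwards [ae_ne 0, ae_ne x, ae_ne (x + h), ae_ne (x - h)] with y h0 hx hx1 hx2
  have n0 := norm_ne_zero_iff.2 h0
  have nx := norm_ne_zero_iff.2 (sub_ne_zero.2 hx.symm)
  have nx1 := norm_ne_zero_iff.2 (sub_ne_zero.2 hx1.symm)
  have nx2 := norm_ne_zero_iff.2 (sub_ne_zero.2 hx2.symm)
  have a1 : x - y + h = x + h - y := by abel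
  have a2 : x - y - h = x - h - y := by abel
  have k := abs_log_second_diff_le (z := x - y) (h := h) (sub_ne_zero.2 hx.symm)
    (by rw [a1]; exact sub_ne_zero.2 hx1.symm) (by rw [a2]; exact sub_ne_zero.2 hx2.symm)
  rw [a1, a2] at k
  have e : log (‖y‖ / ‖x + h - y‖) * f y + log (‖y‖ / ‖x - h - y‖) * f y
        - 2 * (log (‖y‖ / ‖x - y‖) * f y) =
      (2 * log ‖x - y‖ - log ‖x + h - y‖ - log ‖x - h - y‖) * f y := by
    rw [log_div n0 nx, log_div n0 nx1, log_div n0 nx2]; ring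
  simp only [e, abs_mul]
  calc _ ≤ ‖h‖ ^ 2 * ((‖x - y‖ ^ 2)⁻¹ + (‖x + h - y‖ ^ 2)⁻¹ + (‖x - h - y‖ ^ 2)⁻¹) * |f y| := by
        gcongr
    _ = _ := by ring

lemma log_one_add_inv_integrable {f : E3 → ℝ} (hc : Continuous f) (hi : Integrable f) :
    Integrable (fun y => log (1 + ‖y‖⁻¹) * f y) := by
  refine (riesz_zero_integrable hc hi).norm.mono'
    ((Measurable.aestronglyMeasurable (by fun_prop)).mul hi.aestronglyMeasurable)
    (Eventually.of_forall fun y => ?_)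
  rw [norm_mul, norm_mul]
  gcongr
  have h0 : 0 ≤ ‖y‖⁻¹ := by positivity
  rw [Real.norm_of_nonneg h0, Real.norm_of_nonneg (log_nonneg (by linarith))]
  have := log_le_sub_one_of_pos (show 0 < 1 + ‖y‖⁻¹ by positivity)
  linarith

lemma logPot_ge {f : E3 → ℝ} (hc : Continuous f) (hi : Integrable f) (hpos : ∀ y, 0 ≤ f y)
    (x : E3) :
    -(∫ y, f y) * log (1 + ‖x‖) - (∫ y, log (1 + ‖y‖⁻¹) * f y) ≤ logPot f x := by
  have h1 := log_one_add_inv_integrable hc hi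
  have h2 := hi.const_mul (-log (1 + ‖x‖))
  have e : -(∫ y, f y) * log (1 + ‖x‖) - (∫ y, log (1 + ‖y‖⁻¹) * f y) =
      ∫ y, (-log (1 + ‖x‖) * f y - log (1 + ‖y‖⁻¹) * f y) := by
    rw [integral_sub h2 h1, integral_const_mul]; ring
  rw [e, logPot]
  refine integral_mono_ae (h2.sub h1) (logPot_integrable hc hi x) ?_
  filter_upwards [ae_ne 0, ae_ne x] with y h0 hx
  have n0 := norm_pos_iff.2 h0
  have nx := norm_pos_iff.2 (sub_ne_zero.2 hx.symm)
  have key : ‖x - y‖ / ‖y‖ ≤ (1 + ‖x‖) * (1 + ‖y‖⁻¹) := by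
    rw [div_le_iff₀ n0]
    have : (1 + ‖x‖) * (1 + ‖y‖⁻¹) * ‖y‖ = (1 + ‖x‖) * (‖y‖ + 1) := by field_simp
    rw [this]
    have := norm_sub_le x y
    nlinarith [norm_nonneg x]
  have k2 := log_le_log (by positivity) key
  rw [log_mul (by positivity) (by positivity)] at k2
  have k3 : log (‖x - y‖ / ‖y‖) = -log (‖y‖ / ‖x - y‖) := by rw [← log_inv, inv_div]
  have := mul_le_mul_of_nonneg_right k2 (hpos y)
  rw [k3] at this
  linarith

/-- The singular part of the logarithmic potential. -/
noncomputable def logSing (f : E3 → ℝ) (x : E3) : ℝ :=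
  ∫ y in Metric.ball x 1, -log ‖x - y‖ * f y

lemma abs_neg_log_le {t : ℝ} (h0 : 0 ≤ t) (h1 : t ≤ 1) : |-log t| ≤ t⁻¹ := by
  rcases h0.eq_or_lt with rfl | h0
  · simp
  rw [abs_of_nonneg (by linarith [log_nonpos h0.le h1]), ← log_inv]
  exact (log_le_sub_one_of_pos (by positivity)).trans (by linarith)

lemma logSing_integrable {f : E3 → ℝ} (hc : Continuous f) (hi : Integrable f) (x : E3) :
    IntegrableOn (fun y => -log ‖x - y‖ * f y) (Metric.ball x 1) := by
  refine (riesz_one_integrable hc hi x).norm.integrableOn.mono'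
    ((Measurable.aestronglyMeasurable (by fun_prop)).mul hi.aestronglyMeasurable.restrict) ?_
  refine (ae_restrict_iff' measurableSet_ball).2 (Eventually.of_forall fun y hy => ?_)
  rw [norm_mul, norm_mul]
  gcongr
  rw [norm_inv, norm_norm]
  rw [Metric.mem_ball, dist_comm, dist_eq_norm] at hy
  exact abs_neg_log_le (norm_nonneg _) hy.le

lemma logSing_le {f : E3 → ℝ} (hc : Continuous f) (hi : Integrable f) (hpos : ∀ y, 0 ≤ f y)
    {x : E3} {r M : ℝ} (hr : 0 < r) (hr1 : r ≤ 1) (hM : ∀ y ∈ Metric.ball x r, f y ≤ M) :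
    logSing f x ≤ M * (r ^ 2 * ∫ z in Metric.ball (0 : E3) 1, ‖z‖⁻¹)
      + -log r * ∫ y in Metric.ball x 1, f y := by
  have h1 := integrableOn_inv_norm_sub_pow (k := 1) (by norm_num) x r
  simp only [pow_one] at h1
  have h2 := setIntegral_inv_norm_sub_pow (k := 1) x r
  simp only [pow_one] at h2
  have h3 : Integrable ((Metric.ball x r).indicator (fun y => M * ‖x - y‖⁻¹)) :=
    IntegrableOn.integrable_indicator (h1.const_mul M) measurableSet_ball
  have h4 : Integrable (fun y => -log r * f y) (volume.restrict (Metric.ball x 1)) :=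
    hi.integrableOn.const_mul _
  rw [← setIntegral_inv_norm_ball hr, ← h2, ← integral_const_mul, ← integral_const_mul]
  have h5 : ∫ y in Metric.ball x r, M * ‖x - y‖⁻¹ =
      ∫ y in Metric.ball x 1, (Metric.ball x r).indicator (fun y => M * ‖x - y‖⁻¹) y := by
    rw [setIntegral_indicator measurableSet_ball, Set.inter_eq_self_of_subset_right
      (Metric.ball_subset_ball hr1)]
  rw [h5, ← integral_add h3.integrableOn h4, logSing]
  refine integral_mono_ae (logSing_integrable hc hi x) (h3.integrableOn.add h4) ?_
  refine (ae_restrict_iff' measurableSet_ball).2 (Eventually.of_forall fun y hy => ?_)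
  rw [Metric.mem_ball, dist_comm, dist_eq_norm] at hy
  have hlr : 0 ≤ -log r := by linarith [log_nonpos hr.le hr1]
  have p1 : 0 ≤ -log r * f y := mul_nonneg hlr (hpos y)
  by_cases hyr : y ∈ Metric.ball x r
  · simp only [Set.indicator_of_mem hyr]
    have k := (le_abs_self _).trans (abs_neg_log_le (norm_nonneg (x - y)) hy.le)
    have : -log ‖x - y‖ * f y ≤ ‖x - y‖⁻¹ * M := by
      calc _ ≤ ‖x - y‖⁻¹ * f y := mul_le_mul_of_nonneg_right k (hpos y)
        _ ≤ _ := by gcongr; exact hM y hyr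
    linarith
  · simp only [Set.indicator_of_notMem hyr, zero_add]
    rw [Metric.mem_ball, not_lt, dist_comm, dist_eq_norm] at hyr
    exact mul_le_mul_of_nonneg_right (neg_le_neg (log_le_log hr hyr)) (hpos y)

lemma logPot_le {f : E3 → ℝ} (hc : Continuous f) (hi : Integrable f) (hpos : ∀ y, 0 ≤ f y)
    {R : ℝ} (hR : 1 ≤ R) {x : E3} (hx : 2 * R ≤ ‖x‖) :
    logPot f x + (∫ y, f y) * log ‖x‖ ≤ (∫ y, f y) * log (2 * R)
      + 2 * log (1 + ‖x‖) * (∫ y in (Metric.ball 0 R)ᶜ, f y) + logSing f x := by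
  have x0 : 0 < ‖x‖ := by linarith
  have l := logPot_integrable hc hi x
  have l2 := hi.const_mul (log ‖x‖)
  have g1 := hi.const_mul (log (2 * R))
  have g2 : Integrable ((Metric.ball 0 R)ᶜ.indicator (fun y => 2 * log (1 + ‖x‖) * f y)) :=
    (hi.const_mul _).indicator measurableSet_ball.compl
  have g3 : Integrable ((Metric.ball x 1).indicator (fun y => -log ‖x - y‖ * f y)) :=
    IntegrableOn.integrable_indicator (logSing_integrable hc hi x) measurableSet_ball
  have g12 : Integrable fun y => log (2 * R) * f y
      + (Metric.ball 0 R)ᶜ.indicator (fun y => 2 * log (1 + ‖x‖) * f y) y := g1.add g2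
  have eL : logPot f x + (∫ y, f y) * log ‖x‖ =
      ∫ y, (log (‖y‖ / ‖x - y‖) * f y + log ‖x‖ * f y) := by
    rw [integral_add l l2, integral_const_mul, logPot]; ring
  have eR : (∫ y, f y) * log (2 * R)
      + 2 * log (1 + ‖x‖) * (∫ y in (Metric.ball 0 R)ᶜ, f y) + logSing f x =
      ∫ y, ((log (2 * R) * f y + (Metric.ball 0 R)ᶜ.indicator (fun y => 2 * log (1 + ‖x‖) * f y) y)
        + (Metric.ball x 1).indicator (fun y => -log ‖x - y‖ * f y) y) := by
    rw [integral_add g12 g3, integral_add g1 g2, integral_const_mul,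
      integral_indicator measurableSet_ball.compl, integral_indicator measurableSet_ball,
      integral_const_mul, logSing]
    ring
  rw [eL, eR]
  refine integral_mono_ae (l.add l2) (g12.add g3) ?_
  filter_upwards [ae_ne 0, ae_ne x] with y h0 hxy
  have n0 := norm_pos_iff.2 h0
  have nx := norm_pos_iff.2 (sub_ne_zero.2 hxy.symm)
  have hfy := hpos y
  have hl2R : 0 ≤ log (2 * R) := log_nonneg (by linarith)
  have hlx : 0 ≤ log (1 + ‖x‖) := log_nonneg (by linarith)
  have tri : ‖y‖ ≤ ‖x - y‖ + ‖x‖ := by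
    have := norm_sub_norm_le y x
    rw [norm_sub_rev y x] at this
    linarith
  have tri2 : ‖x‖ ≤ ‖x - y‖ + ‖y‖ := by
    have := norm_sub_norm_le x y
    linarith
  simp only [← add_mul]
  rw [log_div n0.ne' nx.ne']
  by_cases hyR : y ∈ Metric.ball (0 : E3) R
  · have hyR' : ‖y‖ < R := by simpa using hyR
    have hnx : R ≤ ‖x - y‖ := by linarith
    have : y ∉ Metric.ball x 1 := by
      rw [Metric.mem_ball, not_lt, dist_comm, dist_eq_norm]; linarith
    rw [Set.indicator_of_notMem (by simpa using hyR'), Set.indicator_of_notMem this, add_zero,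
      add_zero]
    refine mul_le_mul_of_nonneg_right ?_ hfy
    rw [← log_div n0.ne' nx.ne', ← log_mul (by positivity) (by positivity)]
    refine log_le_log (by positivity) ?_
    rw [div_mul_eq_mul_div, div_le_iff₀ nx]
    nlinarith
  · rw [Set.indicator_of_mem (by simpa using hyR)]
    by_cases hy1 : y ∈ Metric.ball x 1
    · rw [Set.indicator_of_mem hy1, ← add_mul, ← add_mul]
      refine mul_le_mul_of_nonneg_right ?_ hfy
      rw [Metric.mem_ball, dist_comm, dist_eq_norm] at hy1
      have k1 : log ‖y‖ ≤ log (1 + ‖x‖) := log_le_log n0 (by linarith)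
      have k2 : log ‖x‖ ≤ log (1 + ‖x‖) := log_le_log x0 (by linarith)
      linarith
    · rw [Set.indicator_of_notMem hy1, add_zero, ← add_mul]
      refine mul_le_mul_of_nonneg_right ?_ hfy
      rw [Metric.mem_ball, not_lt, dist_comm, dist_eq_norm] at hy1
      have k1 : log ‖y‖ - log ‖x - y‖ ≤ log (1 + ‖x‖) := by
        rw [← log_div n0.ne' nx.ne']
        refine log_le_log (by positivity) ?_
        rw [div_le_iff₀ nx]
        nlinarith
      have k2 : log ‖x‖ ≤ log (1 + ‖x‖) := log_le_log x0 (by linarith)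
      linarith

lemma continuous_logPot {f : E3 → ℝ} (hc : Continuous f) (hi : Integrable f) :
    Continuous (logPot f) := by
  rw [continuous_iff_continuousAt]
  intro x
  obtain ⟨M, hM0, hM⟩ := exists_bound_ball hc x 2
  obtain ⟨C, hC⟩ : ∃ C, ∀ x' ∈ Metric.ball x 1, ∫ y, ‖x' - y‖⁻¹ * |f y| ≤ C := by
    refine ⟨M * (∫ z in Metric.ball (0:E3) 1, (‖z‖ ^ 1)⁻¹) + ((1:ℝ) ^ 1)⁻¹ * ∫ y, |f y|,
      fun x' hx' => ?_⟩
    have := riesz_le_of_bound hi (k := 1) (by norm_num) (x := x') one_pos (M := M) fun y hy =>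
      hM y (by
        have := dist_triangle y x' x
        rw [Metric.mem_ball] at *
        linarith)
    simpa only [pow_one] using this
  refine tendsto_iff_norm_sub_tendsto_zero.2 ?_
  have hlim : Tendsto (fun x' => ‖x' - x‖ * (C + C)) (𝓝 x) (𝓝 0) := by
    have : Continuous fun x' : E3 => ‖x' - x‖ * (C + C) := by fun_prop
    simpa using this.tendsto x
  refine squeeze_zero' (Eventually.of_forall fun _ => norm_nonneg _) ?_ hlim
  filter_upwards [Metric.ball_mem_nhds x one_pos] with x' hx'
  refine (abs_logPot_sub_le hc hi x' x).trans ?_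
  gcongr
  · exact hC x' hx'
  · exact hC x (Metric.mem_ball_self one_pos)

lemma integral_radial (F : ℝ → ℝ) :
    ∫ x : E3, F ‖x‖ = 4 * π * ∫ r in Set.Ioi (0:ℝ), r ^ 2 * F r := by
  rw [integral_fun_norm_addHaar volume F, finrank_E3, Measure.real,
    EuclideanSpace.volume_ball_fin_three, ENNReal.ofReal_one, one_pow, one_mul,
    ENNReal.toReal_ofReal (by positivity)]
  simp only [smul_eq_mul, nsmul_eq_mul, Nat.add_one_sub_one]
  push_cast; ring

lemma integrable_radial {F : ℝ → ℝ} :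
    Integrable (fun x : E3 => F ‖x‖) ↔ IntegrableOn (fun r => r ^ 2 * F r) (Set.Ioi (0:ℝ)) := by
  rw [integrable_fun_norm_addHaar volume, finrank_E3]
  simp

lemma integral_gauss_half : ∫ r in Set.Ioi (0:ℝ), exp (-π * r ^ 2) = 1 / 2 := by
  rw [integral_gaussian_Ioi, div_self pi_ne_zero, sqrt_one]

lemma integral_norm_mul_gauss : ∫ x : E3, ‖x‖ * exp (-π * ‖x‖ ^ 2) = 2 / π := by
  rw [integral_radial (fun r => r * exp (-π * r ^ 2))]
  have h := integral_rpow_mul_exp_neg_mul_rpow (p := 2) (q := 3) (b := π) (by norm_num)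
    (by norm_num) pi_pos
  have e : ∀ r : ℝ, r ^ 2 * (r * exp (-π * r ^ 2)) = r ^ (3:ℝ) * exp (-π * r ^ (2:ℝ)) := by
    intro r
    rw [rpow_two, show (3:ℝ) = ((3:ℕ):ℝ) by norm_num, rpow_natCast]; ring
  simp_rw [e]
  rw [h, show (-((3:ℝ) + 1) / 2) = ((-2 : ℤ) : ℝ) by norm_num, rpow_intCast,
    show ((3:ℝ) + 1) / 2 = 2 by norm_num, Gamma_two]
  field_simp; norm_num

lemma integral_inv_norm_mul_gauss : ∫ x : E3, ‖x‖⁻¹ * exp (-π * ‖x‖ ^ 2) = 2 := by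
  rw [integral_radial (fun r => r⁻¹ * exp (-π * r ^ 2))]
  have h := integral_rpow_mul_exp_neg_mul_rpow (p := 2) (q := 1) (b := π) (by norm_num)
    (by norm_num) pi_pos
  have e : ∀ r ∈ Set.Ioi (0:ℝ), r ^ 2 * (r⁻¹ * exp (-π * r ^ 2)) =
      r ^ (1:ℝ) * exp (-π * r ^ (2:ℝ)) := by
    intro r hr
    have : r ≠ 0 := ne_of_gt hr
    rw [rpow_two, rpow_one]; field_simp
  rw [setIntegral_congr_fun measurableSet_Ioi e]
  rw [h, show (-((1:ℝ) + 1) / 2) = ((-1 : ℤ) : ℝ) by norm_num, rpow_intCast,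
    show ((1:ℝ) + 1) / 2 = 1 by norm_num, Gamma_one]
  field_simp; norm_num

lemma integral_inv_norm_sq_mul_gauss : ∫ x : E3, (‖x‖ ^ 2)⁻¹ * exp (-π * ‖x‖ ^ 2) = 2 * π := by
  rw [integral_radial (fun r => (r ^ 2)⁻¹ * exp (-π * r ^ 2))]
  have e : ∀ r ∈ Set.Ioi (0:ℝ), r ^ 2 * ((r ^ 2)⁻¹ * exp (-π * r ^ 2)) =
      exp (-π * r ^ 2) := by
    intro r hr
    have : r ≠ 0 := ne_of_gt hr
    field_simp
  rw [setIntegral_congr_fun measurableSet_Ioi e, integral_gauss_half]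
  ring

lemma one_sub_gauss_nonneg (r : ℝ) : 0 ≤ 1 - exp (-π * r ^ 2) := by
  have : exp (-π * r ^ 2) ≤ 1 := exp_le_one_iff.2 (by have := pi_pos; nlinarith [sq_nonneg r])
  linarith

lemma one_sub_gauss_le (r : ℝ) : 1 - exp (-π * r ^ 2) ≤ π * r ^ 2 := by
  have := add_one_le_exp (-π * r ^ 2)
  linarith

lemma integrableOn_one_sub_gauss :
    IntegrableOn (fun r : ℝ => (1 - exp (-π * r ^ 2)) / r ^ 2) (Set.Ioi 0) := by
  have m : AEStronglyMeasurable (fun r : ℝ => (1 - exp (-π * r ^ 2)) / r ^ 2) :=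
    (by fun_prop : Measurable (fun r : ℝ => (1 - exp (-π * r ^ 2)) / r ^ 2)).aestronglyMeasurable
  rw [← Set.Ioc_union_Ioi_eq_Ioi (zero_le_one (α := ℝ))]
  refine IntegrableOn.union ?_ ?_
  · refine Integrable.mono' (g := fun _ => π) (by simp) m.restrict ?_
    refine (ae_restrict_iff' measurableSet_Ioc).2 (ae_of_all _ fun r hr => ?_)
    rw [norm_of_nonneg (div_nonneg (one_sub_gauss_nonneg r) (sq_nonneg r))]
    have := hr.1
    rw [div_le_iff₀ (by positivity)]
    exact one_sub_gauss_le r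
  · refine Integrable.mono' (integrableOn_Ioi_rpow_of_lt (a := -2) (by norm_num) one_pos)
      m.restrict ?_
    refine (ae_restrict_iff' measurableSet_Ioi).2 (ae_of_all _ fun r hr => ?_)
    rw [norm_of_nonneg (div_nonneg (one_sub_gauss_nonneg r) (sq_nonneg r))]
    have hr0 : 0 < r := one_pos.trans hr
    rw [rpow_neg hr0.le, rpow_two, div_eq_mul_inv]
    have := exp_pos (-π * r ^ 2)
    refine mul_le_of_le_one_left (by positivity) (by linarith)

lemma integral_one_sub_gauss :
    ∫ r in Set.Ioi (0:ℝ), (1 - exp (-π * r ^ 2)) / r ^ 2 = π := by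
  have hint := integrableOn_one_sub_gauss
  have hg : IntegrableOn (fun r : ℝ => 2 * π * exp (-π * r ^ 2)) (Set.Ioi 0) :=
    ((integrable_exp_neg_mul_sq pi_pos).const_mul _).integrableOn
  have hd : IntegrableOn (fun r : ℝ => (1 - exp (-π * r ^ 2)) / r ^ 2 - 2 * π * exp (-π * r ^ 2))
      (Set.Ioi 0) := hint.sub hg
  have key : ∫ r in Set.Ioi (0:ℝ), ((1 - exp (-π * r ^ 2)) / r ^ 2 - 2 * π * exp (-π * r ^ 2)) =
      0 - (fun r : ℝ => -((1 - exp (-π * r ^ 2)) / r)) 0 := by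
    refine integral_Ioi_of_hasDerivAt_of_tendsto
      (f := fun r : ℝ => -((1 - exp (-π * r ^ 2)) / r)) ?_ ?_ hd ?_
    · refine ContinuousAt.continuousWithinAt ?_
      rw [ContinuousAt]
      refine tendsto_iff_norm_sub_tendsto_zero.2 ?_
      have hl : Tendsto (fun r : ℝ => π * |r|) (𝓝 0) (𝓝 0) := by
        have : Continuous fun r : ℝ => π * |r| := by fun_prop
        simpa using this.tendsto 0
      refine squeeze_zero (fun _ => norm_nonneg _) (fun r => ?_) hl
      simp only [div_zero, neg_zero, sub_zero, norm_neg, norm_div, Real.norm_eq_abs]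
      rw [abs_of_nonneg (one_sub_gauss_nonneg r)]
      by_cases h0 : r = 0
      · simp [h0]
      · rw [div_le_iff₀ (by positivity)]
        have := one_sub_gauss_le r
        rwa [mul_assoc, abs_mul_abs_self, ← sq]
    · intro r hr
      have h0 : r ≠ 0 := ne_of_gt hr
      have h1 : HasDerivAt (fun r : ℝ => exp (-π * r ^ 2)) (exp (-π * r ^ 2) * (-π * (2 * r))) r := by
        have := ((hasDerivAt_pow 2 r).const_mul (-π)).exp
        simpa using this
      have h2 : HasDerivAt (fun r : ℝ => -((1 - exp (-π * r ^ 2)) / r)) _ r :=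
        ((h1.const_sub 1).div (hasDerivAt_id' r) h0).neg
      refine h2.congr_deriv ?_
      field_simp
      ring
    · have : Tendsto (fun r : ℝ => r⁻¹) atTop (𝓝 0) := tendsto_inv_atTop_zero
      refine squeeze_zero_norm' ?_ this
      filter_upwards [eventually_gt_atTop 0] with r hr
      rw [norm_neg, norm_of_nonneg (div_nonneg (one_sub_gauss_nonneg r) hr.le), div_eq_mul_inv]
      have := exp_pos (-π * r ^ 2)
      refine mul_le_of_le_one_left (by positivity) (by linarith)
  rw [integral_sub hint hg, integral_const_mul, integral_gauss_half] at key
  simp only [div_zero, neg_zero, sub_zero] at key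
  linarith

lemma integral_one_sub_gauss_div :
    ∫ z : E3, (1 - exp (-π * ‖z‖ ^ 2)) / ‖z‖ ^ 4 = 4 * π ^ 2 := by
  rw [integral_radial (fun r => (1 - exp (-π * r ^ 2)) / r ^ 4)]
  have e : ∀ r ∈ Set.Ioi (0:ℝ), r ^ 2 * ((1 - exp (-π * r ^ 2)) / r ^ 4) =
      (1 - exp (-π * r ^ 2)) / r ^ 2 := by
    intro r hr
    have : r ≠ 0 := ne_of_gt hr
    field_simp
  rw [setIntegral_congr_fun measurableSet_Ioi e, integral_one_sub_gauss]
  ring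

lemma integrable_gauss : Integrable fun x : E3 => exp (-π * ‖x‖ ^ 2) := by
  have h := (GaussianFourier.integrable_cexp_neg_mul_sq_norm_add (b := (π:ℂ)) (V := E3)
    (by simpa using pi_pos) 0 0).norm
  refine h.congr (ae_of_all _ fun x => ?_)
  simp [Complex.norm_exp, ← Complex.ofReal_pow]

/-- The Gaussian is its own cosine transform. -/
lemma integral_cos_gauss (z : E3) :
    ∫ ξ : E3, cos (2 * π * inner ℝ z ξ) * exp (-π * ‖ξ‖ ^ 2) = exp (-π * ‖z‖ ^ 2) := by
  have hb : 0 < (π:ℂ).re := by simpa using pi_pos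
  have h := GaussianFourier.integral_cexp_neg_mul_sq_norm_add hb (2 * π * Complex.I) z
  have hi := GaussianFourier.integrable_cexp_neg_mul_sq_norm_add hb (2 * π * Complex.I) z
  have h2 := congrArg Complex.re h
  rw [← RCLike.re_eq_complex_re, ← integral_re hi] at h2
  convert h2 using 1
  · refine integral_congr_ae (ae_of_all _ fun ξ => ?_)
    simp only [RCLike.re_eq_complex_re, Complex.exp_re]
    have e : (-(π:ℂ) * (‖ξ‖:ℂ) ^ 2 + 2 * π * Complex.I * ((inner ℝ z ξ : ℝ) : ℂ)) =
        ((-π * ‖ξ‖ ^ 2 : ℝ) : ℂ) + ((2 * π * inner ℝ z ξ : ℝ) : ℂ) * Complex.I := by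
      push_cast; ring
    rw [e]
    simp only [Complex.add_re, Complex.add_im, Complex.ofReal_re, Complex.ofReal_im,
      Complex.re_ofReal_mul, Complex.im_ofReal_mul, Complex.I_re, Complex.I_im, mul_zero, mul_one,
      add_zero, zero_add]
    ring
  · have e : ((2 * (π:ℂ) * Complex.I) ^ 2 * (‖z‖:ℂ) ^ 2 / (4 * π)) = ((-π * ‖z‖ ^ 2 : ℝ) : ℂ) := by
      have : (π:ℂ) ≠ 0 := by exact_mod_cast pi_ne_zero
      field_simp
      rw [Complex.I_sq]
      push_cast; ring
    rw [e, div_self (by exact_mod_cast pi_ne_zero), Complex.one_cpow, one_mul]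
    exact (Complex.exp_ofReal_re _).symm

lemma integrable_inv_one_add_norm_pow :
    Integrable fun z : E3 => ((1 + ‖z‖) ^ 4)⁻¹ := by
  have h := integrable_one_add_norm (E := E3) (μ := volume) (r := 4) (by rw [finrank_E3]; norm_num)
  refine h.congr (ae_of_all _ fun z => ?_)
  have : (0:ℝ) ≤ 1 + ‖z‖ := by positivity
  simp only
  rw [rpow_neg this, show (4:ℝ) = ((4:ℕ):ℝ) by norm_num, rpow_natCast]

/-- An integrable majorant of the symmetrised kernel of the half-Laplacian. -/
noncomputable def kerMajorant (z : E3) : ℝ :=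
  (Metric.ball (0:E3) 1).indicator (fun z => (‖z‖ ^ 2)⁻¹) z + 16 * ((1 + ‖z‖) ^ 4)⁻¹

lemma kerMajorant_integrable : Integrable kerMajorant :=
  (IntegrableOn.integrable_indicator (integrableOn_inv_norm_pow le_rfl 1) measurableSet_ball).add
    (integrable_inv_one_add_norm_pow.const_mul 16)

lemma ker_nonneg (z ξ : E3) : 0 ≤ (1 - cos (2 * π * inner ℝ z ξ)) / ‖z‖ ^ 4 :=
  div_nonneg (by linarith [cos_le_one (2 * π * inner ℝ z ξ)]) (by positivity)

lemma ker_le (z ξ : E3) :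
    (1 - cos (2 * π * inner ℝ z ξ)) / ‖z‖ ^ 4 ≤ kerMajorant z * (2 * π ^ 2 * (1 + ‖ξ‖ ^ 2)) := by
  have hpos : 0 ≤ 16 * ((1 + ‖z‖) ^ 4)⁻¹ := by positivity
  rcases eq_or_ne z 0 with rfl | hz
  · simp [kerMajorant]; positivity
  have n0 := norm_pos_iff.2 hz
  by_cases h : z ∈ Metric.ball (0:E3) 1
  · rw [kerMajorant, Set.indicator_of_mem h]
    have k := one_sub_sq_div_two_le_cos (x := 2 * π * inner ℝ z ξ)
    have cs : (inner ℝ z ξ : ℝ) ^ 2 ≤ ‖z‖ ^ 2 * ‖ξ‖ ^ 2 := by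
      rw [← mul_pow, ← sq_abs (inner ℝ z ξ)]
      exact pow_le_pow_left₀ (abs_nonneg _) (abs_real_inner_le_norm z ξ) 2
    calc _ ≤ (2 * π ^ 2 * (‖z‖ ^ 2 * ‖ξ‖ ^ 2)) / ‖z‖ ^ 4 := by
          gcongr
          have : 2 * π ^ 2 * (inner ℝ z ξ : ℝ) ^ 2 ≤ 2 * π ^ 2 * (‖z‖ ^ 2 * ‖ξ‖ ^ 2) := by gcongr
          nlinarith
      _ = (‖z‖ ^ 2)⁻¹ * (2 * π ^ 2 * ‖ξ‖ ^ 2) := by field_simp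
      _ ≤ _ := by
          gcongr
          · linarith
          · linarith
  · rw [kerMajorant, Set.indicator_of_notMem h, zero_add]
    have hz1 : 1 ≤ ‖z‖ := by simpa using h
    have k : (‖z‖ ^ 4)⁻¹ ≤ 16 * ((1 + ‖z‖) ^ 4)⁻¹ := by
      rw [← div_eq_mul_inv, inv_eq_one_div, div_le_div_iff₀ (by positivity) (by positivity), one_mul]
      calc (1 + ‖z‖) ^ 4 ≤ (2 * ‖z‖) ^ 4 := by gcongr; linarith
        _ = _ := by ring
    rw [div_eq_mul_inv, mul_comm]
    have hc := neg_one_le_cos (2 * π * inner ℝ z ξ)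
    have hpi : 1 ≤ π ^ 2 := by nlinarith [pi_gt_three]
    have hs : 0 ≤ 1 - cos (2 * π * inner ℝ z ξ) := by
      linarith [cos_le_one (2 * π * inner ℝ z ξ)]
    refine mul_le_mul k ?_ hs hpos
    nlinarith [sq_nonneg ‖ξ‖]

lemma measurable_ker : Measurable fun p : E3 × E3 =>
    (1 - cos (2 * π * inner ℝ p.1 p.2)) / ‖p.1‖ ^ 4 := by
  fun_prop

lemma ker_mul_integrable_prod {h : E3 → ℝ} (hm : Continuous h)
    (hi : Integrable fun ξ => (1 + ‖ξ‖ ^ 2) * h ξ) :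
    Integrable (fun p : E3 × E3 => (1 - cos (2 * π * inner ℝ p.1 p.2)) / ‖p.1‖ ^ 4 * h p.2)
      (volume.prod volume) := by
  refine ((kerMajorant_integrable.const_mul (2 * π ^ 2)).mul_prod hi.norm).mono'
    (measurable_ker.mul (hm.measurable.comp measurable_snd)).aestronglyMeasurable
    (ae_of_all _ fun p => ?_)
  rw [norm_mul, norm_of_nonneg (ker_nonneg _ _), norm_mul,
    norm_of_nonneg (by positivity : 0 ≤ 1 + ‖p.2‖ ^ 2)]
  calc _ ≤ kerMajorant p.1 * (2 * π ^ 2 * (1 + ‖p.2‖ ^ 2)) * ‖h p.2‖ := by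
        gcongr; exact ker_le _ _
    _ = _ := by ring

lemma integral_ker_smul {t : ℝ} (ht : 0 < t) (ξ : E3) :
    ∫ z : E3, (1 - cos (2 * π * inner ℝ z (t • ξ))) / ‖z‖ ^ 4 =
      t * ∫ z : E3, (1 - cos (2 * π * inner ℝ z ξ)) / ‖z‖ ^ 4 := by
  have h := Measure.integral_comp_smul (volume : Measure E3)
    (fun z : E3 => (1 - cos (2 * π * inner ℝ z ξ)) / ‖z‖ ^ 4) t
  rw [finrank_E3, abs_of_pos (by positivity), smul_eq_mul] at h
  have e : ∀ z : E3, (1 - cos (2 * π * inner ℝ z (t • ξ))) / ‖z‖ ^ 4 =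
      t ^ 4 * ((1 - cos (2 * π * inner ℝ (t • z) ξ)) / ‖t • z‖ ^ 4) := by
    intro z
    rw [real_inner_smul_right, real_inner_smul_left, norm_smul, Real.norm_of_nonneg ht.le, mul_pow,
      mul_div_assoc', mul_div_mul_left _ _ (by positivity)]
  simp_rw [e]
  rw [integral_const_mul, h]
  field_simp

lemma integral_ker_congr {ξ η : E3} (hn : ‖ξ‖ = ‖η‖) :
    ∫ z : E3, (1 - cos (2 * π * inner ℝ z ξ)) / ‖z‖ ^ 4 =
      ∫ z : E3, (1 - cos (2 * π * inner ℝ z η)) / ‖z‖ ^ 4 := by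
  set S := (Submodule.span ℝ {ξ - η})ᗮ.reflection with hS
  have hr : S ξ = η := Submodule.reflection_sub hn
  have h := (S.measurePreserving).integral_comp' (f := S.toHomeomorph.toMeasurableEquiv)
    (fun z : E3 => (1 - cos (2 * π * inner ℝ z η)) / ‖z‖ ^ 4)
  rw [← h]
  refine integral_congr_ae (ae_of_all _ fun z => ?_)
  have e : S.toHomeomorph.toMeasurableEquiv z = S z := rfl
  simp only [e]
  rw [← hr, S.inner_map_map, S.norm_map]

lemma integrable_one_add_sq_mul_gauss :
    Integrable fun ξ : E3 => (1 + ‖ξ‖ ^ 2) * exp (-π * ‖ξ‖ ^ 2) := by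
  refine (integrable_radial (F := fun r => (1 + r ^ 2) * exp (-π * r ^ 2))).2 ?_
  have h1 := integrableOn_rpow_mul_exp_neg_mul_rpow (p := 2) (s := 2) (b := π) (by norm_num)
    (by norm_num) pi_pos
  have h2 := integrableOn_rpow_mul_exp_neg_mul_rpow (p := 2) (s := 4) (b := π) (by norm_num)
    (by norm_num) pi_pos
  refine (h1.add h2).congr (ae_of_all _ fun r => ?_)
  simp only [Pi.add_apply]
  rw [rpow_two, show (4:ℝ) = ((4:ℕ):ℝ) by norm_num, rpow_natCast]
  ring

/-- The symbol of the half-Laplacian. -/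
lemma integral_ker (ξ : E3) :
    ∫ z : E3, (1 - cos (2 * π * inner ℝ z ξ)) / ‖z‖ ^ 4 = 2 * π ^ 3 * ‖ξ‖ := by
  set e₀ : E3 := EuclideanSpace.single 0 1 with he
  have hn : ‖e₀‖ = 1 := by simp [he]
  set c := ∫ z : E3, (1 - cos (2 * π * inner ℝ z e₀)) / ‖z‖ ^ 4 with hc
  have hC : ∀ ξ : E3, ∫ z : E3, (1 - cos (2 * π * inner ℝ z ξ)) / ‖z‖ ^ 4 = ‖ξ‖ * c := by
    intro ξ
    rcases eq_or_ne ξ 0 with rfl | hξ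
    · simp
    · have n0 := norm_pos_iff.2 hξ
      rw [hc, ← integral_ker_smul n0]
      refine integral_ker_congr ?_
      rw [norm_smul, hn, norm_norm, mul_one]
  have hp := ker_mul_integrable_prod (h := fun ξ => exp (-π * ‖ξ‖ ^ 2)) (by fun_prop)
    integrable_one_add_sq_mul_gauss
  have fub := integral_integral_swap
    (f := fun z ξ : E3 => (1 - cos (2 * π * inner ℝ z ξ)) / ‖z‖ ^ 4 * exp (-π * ‖ξ‖ ^ 2)) hp
  have l : ∀ z : E3, ∫ ξ : E3, (1 - cos (2 * π * inner ℝ z ξ)) / ‖z‖ ^ 4 * exp (-π * ‖ξ‖ ^ 2) =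
      (1 - exp (-π * ‖z‖ ^ 2)) / ‖z‖ ^ 4 := by
    intro z
    have i2 : Integrable fun ξ : E3 => cos (2 * π * inner ℝ z ξ) * exp (-π * ‖ξ‖ ^ 2) := by
      refine integrable_gauss.mono' (by fun_prop) (ae_of_all _ fun ξ => ?_)
      rw [norm_mul, norm_of_nonneg (exp_pos _).le]
      exact mul_le_of_le_one_left (exp_pos _).le (abs_cos_le_one _)
    have g1 : ∫ ξ : E3, exp (-π * ‖ξ‖ ^ 2) = 1 := by
      simpa using integral_cos_gauss (0 : E3)
    have : ∀ ξ : E3, (1 - cos (2 * π * inner ℝ z ξ)) / ‖z‖ ^ 4 * exp (-π * ‖ξ‖ ^ 2) =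
      (exp (-π * ‖ξ‖ ^ 2) - cos (2 * π * inner ℝ z ξ) * exp (-π * ‖ξ‖ ^ 2)) / ‖z‖ ^ 4 := by
      intro ξ; ring
    simp_rw [this]
    rw [integral_div, integral_sub integrable_gauss i2, integral_cos_gauss, g1]
  simp only [l, integral_mul_const, hC] at fub
  rw [integral_one_sub_gauss_div] at fub
  have : ∀ y : E3, ‖y‖ * c * exp (-π * ‖y‖ ^ 2) = c * (‖y‖ * exp (-π * ‖y‖ ^ 2)) := by
    intro y; ring
  simp only [this, integral_const_mul, integral_norm_mul_gauss] at fub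
  rw [hC]
  have hpi := pi_pos
  have : c = 2 * π ^ 3 := by field_simp at fub; linarith
  rw [this]; ring

lemma integrable_of_one_add_sq {g : E3 → ℝ} (hg : Continuous g)
    (hi : Integrable fun ξ => (1 + ‖ξ‖ ^ 2) * g ξ) : Integrable g := by
  refine hi.norm.mono' hg.aestronglyMeasurable (ae_of_all _ fun ξ => ?_)
  rw [norm_mul, norm_of_nonneg (by positivity : 0 ≤ 1 + ‖ξ‖ ^ 2)]
  refine le_mul_of_one_le_left (norm_nonneg _) ?_
  nlinarith [sq_nonneg ‖ξ‖]

lemma integrable_cos_mul {g : E3 → ℝ} (hg : Continuous g) (hi : Integrable g) (x : E3) :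
    Integrable fun ξ => cos (2 * π * inner ℝ x ξ) * g ξ := by
  refine hi.norm.mono' (by fun_prop) (ae_of_all _ fun ξ => ?_)
  rw [norm_mul]
  exact mul_le_of_le_one_left (norm_nonneg _) (abs_cos_le_one _)

lemma integrable_trunc {j : E3 → ℝ} (hj : Measurable j) {B : ℝ} (hB : ∀ z, |j z| ≤ B) {ε : ℝ}
    (hε : 0 < ε) : Integrable ({z : E3 | ε < ‖z‖}.indicator fun z => j z / ‖z‖ ^ 4) := by
  have hB0 : 0 ≤ B := (abs_nonneg _).trans (hB 0)
  have hm : MeasurableSet {z : E3 | ε < ‖z‖} := measurableSet_lt measurable_const measurable_norm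
  refine (integrable_inv_one_add_norm_pow.const_mul (B * (1 + ε⁻¹) ^ 4)).mono'
    ((by fun_prop : Measurable fun z : E3 => j z / ‖z‖ ^ 4).indicator hm).aestronglyMeasurable
    (ae_of_all _ fun z => ?_)
  by_cases hz' : ε < ‖z‖
  swap
  · rw [Set.indicator_of_notMem (by simpa using hz'), norm_zero]
    positivity
  rw [Set.indicator_of_mem (by simpa using hz')]
  have n0 : 0 < ‖z‖ := hε.trans hz'
  rw [norm_div, Real.norm_eq_abs, norm_of_nonneg (by positivity : 0 ≤ ‖z‖ ^ 4), ← div_eq_mul_inv,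
    div_le_div_iff₀ (by positivity) (by positivity), mul_assoc, ← mul_pow]
  refine mul_le_mul (hB z) (pow_le_pow_left₀ (by positivity) ?_ 4) (by positivity) hB0
  have : 1 ≤ ε⁻¹ * ‖z‖ := by
    rw [inv_mul_eq_div, one_le_div hε]; exact hz'.le
  linarith

lemma cos_symm (p q : ℝ) : cos p - (cos (p + q) + cos (p - q)) / 2 = cos p * (1 - cos q) := by
  rw [cos_add, cos_sub]; ring

/-- The half-Laplacian of a cosine transform. -/
lemma halfLap_eq {g : E3 → ℝ} (hg : Continuous g)
    (hi : Integrable fun ξ => (1 + ‖ξ‖ ^ 2) * g ξ) {a : E3} {φ : SchwartzMap E3 ℝ}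
    (hφ : ∀ x, φ x = ∫ ξ, cos (2 * π * inner ℝ (x - a) ξ) * g ξ) (x : E3) :
    halfLap φ x = ∫ ξ, cos (2 * π * inner ℝ (x - a) ξ) * (2 * π * ‖ξ‖ * g ξ) := by
  have hgi := integrable_of_one_add_sq hg hi
  have hprod := ker_mul_integrable_prod (h := fun ξ => cos (2 * π * inner ℝ (x - a) ξ) * g ξ)
    (by fun_prop) (hi.norm.mono' (by fun_prop) (ae_of_all _ fun ξ => by
      rw [mul_left_comm, norm_mul]
      exact mul_le_of_le_one_left (norm_nonneg _) (abs_cos_le_one _)))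
  set H : E3 → ℝ := fun z => ∫ ξ, (1 - cos (2 * π * inner ℝ z ξ)) / ‖z‖ ^ 4 *
    (cos (2 * π * inner ℝ (x - a) ξ) * g ξ) with hH
  have hHi : Integrable H := hprod.integral_prod_left
  have hHval : ∫ z, H z = π ^ 2 * ∫ ξ, cos (2 * π * inner ℝ (x - a) ξ) * (2 * π * ‖ξ‖ * g ξ) := by
    rw [hH, integral_integral_swap (f := fun z ξ : E3 => (1 - cos (2 * π * inner ℝ z ξ)) / ‖z‖ ^ 4 *
      (cos (2 * π * inner ℝ (x - a) ξ) * g ξ)) hprod, ← integral_const_mul]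
    refine integral_congr_ae (ae_of_all _ fun ξ => ?_)
    simp only
    rw [integral_mul_const, integral_ker]
    ring
  have hsymm : ∀ z, (φ x - (φ (x + z) + φ (x - z)) / 2) / ‖z‖ ^ 4 = H z := by
    intro z
    have i1 := integrable_cos_mul hg hgi (x - a)
    have i2 := integrable_cos_mul hg hgi (x + z - a)
    have i3 := integrable_cos_mul hg hgi (x - z - a)
    have i23 : Integrable fun ξ => cos (2 * π * inner ℝ (x + z - a) ξ) * g ξ +
      cos (2 * π * inner ℝ (x - z - a) ξ) * g ξ := i2.add i3
    rw [hφ, hφ, hφ, ← integral_add i2 i3, ← integral_div, ← integral_sub i1 (i23.div_const 2),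
      ← integral_div, hH]
    refine integral_congr_ae (ae_of_all _ fun ξ => ?_)
    simp only
    have e1 : x + z - a = (x - a) + z := by abel
    have e2 : x - z - a = (x - a) - z := by abel
    have k := cos_symm (2 * π * inner ℝ (x - a) ξ) (2 * π * inner ℝ z ξ)
    rw [← mul_add, ← mul_sub] at k
    rw [e1, e2, inner_add_left (x - a) z, inner_sub_left (x - a) z]
    calc _ = (cos (2 * π * inner ℝ (x - a) ξ) - (cos (2 * π * (inner ℝ (x - a) ξ + inner ℝ z ξ)) +
        cos (2 * π * (inner ℝ (x - a) ξ - inner ℝ z ξ))) / 2) * g ξ / ‖z‖ ^ 4 := by ring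
      _ = _ := by rw [k]; ring
  obtain ⟨B, hB⟩ : ∃ B, ∀ y, |φ y| ≤ B := by
    refine ⟨∫ ξ, ‖g ξ‖, fun y => ?_⟩
    rw [hφ]
    refine abs_integral_le_integral_abs.trans (integral_mono
      (integrable_cos_mul hg hgi (y - a)).abs hgi.norm fun ξ => ?_)
    simp only [abs_mul, Real.norm_eq_abs]
    exact mul_le_of_le_one_left (abs_nonneg _) (abs_cos_le_one _)
  have hm : ∀ ε : ℝ, MeasurableSet {z : E3 | ε < ‖z‖} := fun ε =>
    measurableSet_lt measurable_const measurable_norm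
  have htrunc : ∀ ε : ℝ, 0 < ε → ∫ y in {y : E3 | ε < ‖x - y‖}, (φ x - φ y) / ‖x - y‖ ^ 4 =
      ∫ z, {z : E3 | ε < ‖z‖}.indicator H z := by
    intro ε hε
    set j : E3 → ℝ := {z : E3 | ε < ‖z‖}.indicator fun z => (φ x - φ (x - z)) / ‖z‖ ^ 4 with hj
    have hφm : Measurable fun z => φ x - φ (x - z) := by
      have := φ.continuous; fun_prop
    have hji : Integrable j := integrable_trunc hφm (B := B + B) (fun z =>
      (abs_sub _ _).trans (add_le_add (hB _) (hB _))) hε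
    have hm' : MeasurableSet {y : E3 | ε < ‖x - y‖} :=
      measurableSet_lt measurable_const (by fun_prop)
    have e1 : ∫ y in {y : E3 | ε < ‖x - y‖}, (φ x - φ y) / ‖x - y‖ ^ 4 = ∫ z, j z := by
      rw [← integral_indicator hm', ← integral_sub_left_eq_self j volume x]
      refine integral_congr_ae (ae_of_all _ fun y => ?_)
      simp only [hj, Set.indicator_apply, Set.mem_ofPred_eq, sub_sub_cancel]
    have e2 : ∫ z, j z = ∫ z, j (-z) := (integral_neg_eq_self j volume).symm
    have hji' : Integrable fun z => j (-z) := hji.comp_neg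
    have e3 : ∫ z, j z = ∫ z, (j z + j (-z)) / 2 := by
      rw [integral_div, integral_add hji hji', ← e2]; ring
    rw [e1, e3]
    refine integral_congr_ae (ae_of_all _ fun z => ?_)
    simp only [hj, Set.indicator_apply, Set.mem_ofPred_eq, norm_neg, sub_neg_eq_add]
    split_ifs
    · rw [← hsymm]; ring
    · ring
  refine Tendsto.limUnder_eq ?_
  have hlim : Tendsto (fun ε : ℝ => ∫ z, {z : E3 | ε < ‖z‖}.indicator H z) (𝓝[>] 0)
      (𝓝 (∫ z, H z)) := by
    refine tendsto_integral_filter_of_dominated_convergence (fun z => ‖H z‖) ?_ ?_ hHi.norm ?_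
    · exact Eventually.of_forall fun ε => hHi.aestronglyMeasurable.indicator (hm ε)
    · exact Eventually.of_forall fun ε => ae_of_all _ fun z => norm_indicator_le_norm_self _ _
    · filter_upwards [ae_ne 0] with z hz
      refine tendsto_const_nhds.congr' ?_
      filter_upwards [Ioo_mem_nhdsGT (norm_pos_iff.2 hz)] with ε hε
      rw [Set.indicator_of_mem]
      exact hε.2
  have := hlim.const_mul (1 / π ^ 2)
  rw [hHval, ← mul_assoc, one_div, inv_mul_cancel₀ (by positivity), one_mul, ← one_div] at this
  refine this.congr' ?_
  filter_upwards [self_mem_nhdsWithin] with ε hε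
  rw [htrunc ε hε]

/-- The cosine transform. -/
noncomputable def cosT (g : E3 → ℝ) (x : E3) : ℝ := ∫ ξ, cos (2 * π * inner ℝ x ξ) * g ξ

lemma re_fourier_ofReal {g : E3 → ℝ} (hg : Continuous g) (hi : Integrable g) (x : E3) :
    (FourierTransform.fourier (fun ξ => (g ξ : ℂ)) x).re = cosT g x := by
  have hint : Integrable fun v => Complex.exp (↑(-2 * π * inner ℝ v x) * Complex.I) • (g v : ℂ) := by
    refine hi.norm.mono' (by fun_prop) (ae_of_all _ fun ξ => ?_)
    rw [norm_smul, Complex.norm_exp_ofReal_mul_I, one_mul, Complex.norm_real]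
  rw [Real.fourier_eq', ← RCLike.re_eq_complex_re, ← integral_re hint, cosT]
  refine integral_congr_ae (ae_of_all _ fun ξ => ?_)
  simp only [RCLike.re_eq_complex_re, smul_eq_mul, Complex.re_mul_ofReal,
    Complex.exp_ofReal_mul_I_re]
  rw [neg_mul, neg_mul, cos_neg, real_inner_comm]

lemma ofReal_smooth {g : E3 → ℝ} (hg : ContDiff ℝ (⊤ : ℕ∞) g) :
    ContDiff ℝ (⊤ : ℕ∞) fun ξ => (g ξ : ℂ) := Complex.ofRealCLM.contDiff.comp hg

lemma ofReal_compact {g : E3 → ℝ} (hs : HasCompactSupport g) :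
    HasCompactSupport fun ξ => (g ξ : ℂ) := hs.comp_left Complex.ofReal_zero

/-- Cosine transforms of test functions are Schwartz functions. -/
lemma exists_schwartz {g : E3 → ℝ} (hg : ContDiff ℝ (⊤ : ℕ∞) g) (hs : HasCompactSupport g)
    (a : E3) : ∃ φ : SchwartzMap E3 ℝ, ∀ x, φ x = cosT g (x - a) := by
  refine ⟨SchwartzMap.compSubConstCLM ℝ a (SchwartzMap.postcompCLM (𝕜 := ℝ) Complex.reCLM
    (FourierTransform.fourier ((ofReal_compact hs).toSchwartzMap (ofReal_smooth hg)))), fun x => ?_⟩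
  rw [SchwartzMap.compSubConstCLM_apply, SchwartzMap.postcompCLM_apply, SchwartzMap.fourier_coe,
    ← re_fourier_ofReal hg.continuous (hg.continuous.integrable_of_hasCompactSupport hs)]
  rfl

lemma integral_cosT {g : E3 → ℝ} (hg : ContDiff ℝ (⊤ : ℕ∞) g) (hs : HasCompactSupport g) :
    ∫ x, cosT g x = g 0 := by
  set G := (ofReal_compact hs).toSchwartzMap (ofReal_smooth hg) with hG
  have hGc : ⇑G = fun ξ => (g ξ : ℂ) := rfl
  have hi : Integrable g := hg.continuous.integrable_of_hasCompactSupport hs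
  have hF : Integrable (FourierTransform.fourier ⇑G) := by
    rw [← SchwartzMap.fourier_coe]; exact SchwartzMap.integrable _
  have h := congrArg Complex.re (congrFun
    (Continuous.fourierInv_fourier_eq G.continuous G.integrable hF) 0)
  rw [Real.fourierInv_eq'] at h
  simp only [inner_zero_right, mul_zero, Complex.ofReal_zero, zero_mul, Complex.exp_zero,
    one_smul] at h
  rw [← RCLike.re_eq_complex_re, ← integral_re hF] at h
  simp only [hGc, RCLike.re_eq_complex_re, re_fourier_ofReal hg.continuous hi] at h
  simpa using h

lemma cosT_decay {g : E3 → ℝ} (hg : ContDiff ℝ (⊤ : ℕ∞) g) (hs : HasCompactSupport g) (k : ℕ) :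
    ∃ C, 0 ≤ C ∧ ∀ x, (1 + ‖x‖) ^ k * |cosT g x| ≤ C := by
  obtain ⟨φ, hφ⟩ := exists_schwartz hg hs 0
  obtain ⟨K, h⟩ : ∃ K, ∀ x, (1 + ‖x‖) ^ k * ‖iteratedFDeriv ℝ 0 φ x‖ ≤ K :=
    ⟨_, SchwartzMap.one_add_le_sup_seminorm_apply (𝕜 := ℝ) (m := (k, 0)) le_rfl le_rfl φ⟩
  refine ⟨K, le_trans (by positivity) (h 0), fun x => ?_⟩
  have := h x
  rw [norm_iteratedFDeriv_zero, Real.norm_eq_abs, hφ, sub_zero] at this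
  exact this

lemma cosT_smooth {g : E3 → ℝ} (hg : ContDiff ℝ (⊤ : ℕ∞) g) (hs : HasCompactSupport g) :
    ContDiff ℝ (⊤ : ℕ∞) (cosT g) := by
  obtain ⟨φ, hφ⟩ := exists_schwartz hg hs 0
  have : cosT g = φ := by ext x; rw [hφ, sub_zero]
  rw [this]
  exact φ.smooth _

lemma cosT_integrable {g : E3 → ℝ} (hg : ContDiff ℝ (⊤ : ℕ∞) g) (hs : HasCompactSupport g) :
    Integrable (cosT g) := by
  obtain ⟨φ, hφ⟩ := exists_schwartz hg hs 0
  have : cosT g = φ := by ext x; rw [hφ, sub_zero]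
  rw [this]
  exact φ.integrable

lemma cosT_fderiv_decay {g : E3 → ℝ} (hg : ContDiff ℝ (⊤ : ℕ∞) g) (hs : HasCompactSupport g)
    (k : ℕ) : ∃ C, 0 ≤ C ∧ ∀ x, (1 + ‖x‖) ^ k * ‖fderiv ℝ (cosT g) x‖ ≤ C := by
  obtain ⟨φ, hφ⟩ := exists_schwartz hg hs 0
  have e : cosT g = φ := by ext x; rw [hφ, sub_zero]
  obtain ⟨K, h⟩ : ∃ K, ∀ x, (1 + ‖x‖) ^ k * ‖iteratedFDeriv ℝ 1 φ x‖ ≤ K :=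
    ⟨_, SchwartzMap.one_add_le_sup_seminorm_apply (𝕜 := ℝ) (m := (k, 1)) le_rfl le_rfl φ⟩
  rw [e]
  refine ⟨K, le_trans (by positivity) (h 0), fun x => ?_⟩
  have := h x
  rw [← norm_iteratedFDeriv_fderiv, norm_iteratedFDeriv_zero] at this
  exact this

lemma cosT_congr_norm {g : E3 → ℝ} (hrad : ∀ ξ η, ‖ξ‖ = ‖η‖ → g ξ = g η) {x y : E3}
    (hn : ‖x‖ = ‖y‖) : cosT g x = cosT g y := by
  set S := (Submodule.span ℝ {x - y})ᗮ.reflection with hS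
  have hr : S x = y := Submodule.reflection_sub hn
  have h := (S.measurePreserving).integral_comp' (f := S.toHomeomorph.toMeasurableEquiv)
    (fun ξ : E3 => cos (2 * π * inner ℝ y ξ) * g ξ)
  rw [cosT, cosT, ← h]
  refine integral_congr_ae (ae_of_all _ fun ξ => ?_)
  have e : S.toHomeomorph.toMeasurableEquiv ξ = S ξ := rfl
  simp only [e]
  rw [← hr, S.inner_map_map, hrad (S ξ) ξ (S.norm_map ξ)]

lemma cosT_dilate (g : E3 → ℝ) {t : ℝ} (ht : 0 < t) (x : E3) :
    cosT (fun ξ => g (t • ξ)) x = (t ^ 3)⁻¹ * cosT g (t⁻¹ • x) := by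
  have h := Measure.integral_comp_smul (volume : Measure E3)
    (fun ξ : E3 => cos (2 * π * inner ℝ (t⁻¹ • x) ξ) * g ξ) t
  rw [finrank_E3, abs_of_pos (by positivity), smul_eq_mul] at h
  rw [cosT, cosT, ← h]
  refine integral_congr_ae (ae_of_all _ fun ξ => ?_)
  simp only
  rw [real_inner_smul_left, real_inner_smul_right, inv_mul_cancel_left₀ ht.ne']

/-- A smooth radial function equal to one near the origin. -/
noncomputable def bump (ξ : E3) : ℝ := smoothTransition (2 - ‖ξ‖ ^ 2)

lemma contDiff_bump : ContDiff ℝ (⊤ : ℕ∞) bump :=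
  smoothTransition.contDiff.comp (contDiff_const.sub (contDiff_norm_sq ℝ))

lemma bump_eq_one {ξ : E3} (h : ‖ξ‖ ≤ 1) : bump ξ = 1 :=
  smoothTransition.one_of_one_le (by nlinarith [norm_nonneg ξ])

lemma bump_eq_zero {ξ : E3} (h : 2 ≤ ‖ξ‖) : bump ξ = 0 :=
  smoothTransition.zero_of_nonpos (by nlinarith [norm_nonneg ξ])

lemma bump_nonneg (ξ : E3) : 0 ≤ bump ξ := smoothTransition.nonneg _

lemma bump_le_one (ξ : E3) : bump ξ ≤ 1 := smoothTransition.le_one _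

lemma hasCompactSupport_of_eq_zero {g : E3 → ℝ} {r : ℝ} (h : ∀ ξ, r < ‖ξ‖ → g ξ = 0) :
    HasCompactSupport g :=
  HasCompactSupport.intro (isCompact_closedBall (0:E3) r) fun ξ hξ => h ξ (by simpa using hξ)

lemma hasCompactSupport_bump : HasCompactSupport bump :=
  hasCompactSupport_of_eq_zero (r := 2) fun _ h => bump_eq_zero h.le

lemma contDiff_mul_of_eq_zero {k c : E3 → ℝ} {δ : ℝ} (hδ : 0 < δ) (hk : ContDiff ℝ (⊤ : ℕ∞) k)
    (hk0 : ∀ ξ, ‖ξ‖ < δ → k ξ = 0) (hc : ∀ ξ, ξ ≠ 0 → ContDiffAt ℝ (⊤ : ℕ∞) c ξ) :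
    ContDiff ℝ (⊤ : ℕ∞) fun ξ => k ξ * c ξ := by
  refine contDiff_iff_contDiffAt.2 fun ξ => ?_
  rcases eq_or_ne ξ 0 with rfl | h
  · refine (contDiffAt_const (c := (0:ℝ))).congr_of_eventuallyEq ?_
    filter_upwards [Metric.ball_mem_nhds (0:E3) hδ] with ξ hξ
    rw [hk0 ξ (by simpa using hξ), zero_mul]
  · exact hk.contDiffAt.mul (hc ξ h)

/-- The profile `g` with `b(ξ/R) - b(Rξ) = 2π|ξ| ∫_{1/R}^R g(tξ) dt` for the bump `b`. -/
noncomputable def profile (ξ : E3) : ℝ := deriv smoothTransition (2 - ‖ξ‖ ^ 2) * (‖ξ‖ / π)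

lemma contDiff_deriv_smoothTransition : ContDiff ℝ (⊤ : ℕ∞) (deriv smoothTransition) :=
  (contDiff_infty_iff_deriv.1 smoothTransition.contDiff).2

lemma profile_eq_zero {ξ : E3} (h : 2 < ‖ξ‖) : profile ξ = 0 := by
  have : deriv smoothTransition (2 - ‖ξ‖ ^ 2) = 0 := by
    have : smoothTransition =ᶠ[𝓝 (2 - ‖ξ‖ ^ 2)] fun _ => 0 := by
      filter_upwards [Iio_mem_nhds (show 2 - ‖ξ‖ ^ 2 < 0 by nlinarith)] with x hx
      exact smoothTransition.zero_of_nonpos (le_of_lt hx)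
    rw [this.deriv_eq]; simp
  rw [profile, this, zero_mul]

lemma hasCompactSupport_profile : HasCompactSupport profile :=
  hasCompactSupport_of_eq_zero (r := 2) fun _ h => profile_eq_zero h

lemma contDiff_profile : ContDiff ℝ (⊤ : ℕ∞) profile := by
  refine contDiff_mul_of_eq_zero one_pos (contDiff_deriv_smoothTransition.comp
    (contDiff_const.sub (contDiff_norm_sq ℝ))) (fun ξ h => ?_) fun ξ h =>
      (contDiffAt_norm ℝ h).div_const _
  have : smoothTransition =ᶠ[𝓝 (2 - ‖ξ‖ ^ 2)] fun _ => 1 := by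
    filter_upwards [Ioi_mem_nhds (show 1 < 2 - ‖ξ‖ ^ 2 by nlinarith [norm_nonneg ξ])] with x hx
    exact smoothTransition.one_of_one_le (le_of_lt hx)
  simp only [this.deriv_eq]
  simp

lemma hasDerivAt_bump_smul (ξ : E3) {t : ℝ} (ht : 0 < t) :
    HasDerivAt (fun t : ℝ => bump (t • ξ)) (-(2 * π * ‖ξ‖ * profile (t • ξ))) t := by
  have e : ∀ s : ℝ, 2 - ‖s • ξ‖ ^ 2 = 2 - s ^ 2 * ‖ξ‖ ^ 2 := by
    intro s
    rw [norm_smul, mul_pow, Real.norm_eq_abs, sq_abs]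
  have h1 : HasDerivAt smoothTransition (deriv smoothTransition (2 - t ^ 2 * ‖ξ‖ ^ 2))
      (2 - t ^ 2 * ‖ξ‖ ^ 2) :=
    ((smoothTransition.contDiff (n := 1)).differentiable (by norm_num) _).hasDerivAt
  have h2 : HasDerivAt (fun t : ℝ => 2 - t ^ 2 * ‖ξ‖ ^ 2) (-(2 * t * ‖ξ‖ ^ 2)) t := by
    simpa using ((hasDerivAt_pow 2 t).mul_const (‖ξ‖ ^ 2)).const_sub 2
  have h3 := h1.comp t h2
  simp only [bump, profile, e]
  refine h3.congr_deriv ?_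
  rw [norm_smul, Real.norm_of_nonneg ht.le]
  field_simp

lemma integral_profile (ξ : E3) {s t : ℝ} (hs : 0 < s) (hst : s ≤ t) :
    2 * π * ‖ξ‖ * ∫ r in s..t, profile (r • ξ) = bump (s • ξ) - bump (t • ξ) := by
  have h := intervalIntegral.integral_eq_sub_of_hasDerivAt (a := s) (b := t)
    (f := fun t : ℝ => bump (t • ξ)) (f' := fun t => -(2 * π * ‖ξ‖ * profile (t • ξ)))
    (fun r hr => hasDerivAt_bump_smul ξ (by
      rw [Set.uIcc_of_le hst] at hr
      exact hs.trans_le hr.1)) (by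
      have := contDiff_profile.continuous
      exact Continuous.intervalIntegrable (by fun_prop) _ _)
  rw [intervalIntegral.integral_neg, intervalIntegral.integral_const_mul] at h
  linarith

/-- Frequency side of the test function whose half-Laplacian is a difference of two mollifiers. -/
noncomputable def testFreq (R : ℝ) (ξ : E3) : ℝ :=
  (bump (R⁻¹ • ξ) - bump (R • ξ)) * (2 * π * ‖ξ‖)⁻¹

lemma two_pi_norm_mul_testFreq (R : ℝ) (ξ : E3) :
    2 * π * ‖ξ‖ * testFreq R ξ = bump (R⁻¹ • ξ) - bump (R • ξ) := by
  rcases eq_or_ne ξ 0 with rfl | h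
  · simp
  · have := norm_pos_iff.2 h
    rw [testFreq]
    field_simp

lemma contDiff_testFreq {R : ℝ} (hR : 1 ≤ R) : ContDiff ℝ (⊤ : ℕ∞) (testFreq R) := by
  have hR0 : 0 < R := by linarith
  refine contDiff_mul_of_eq_zero (δ := R⁻¹) (by positivity) ?_ (fun ξ h => ?_) fun ξ h => ?_
  · exact (contDiff_bump.comp (contDiff_const_smul _)).sub (contDiff_bump.comp (contDiff_const_smul _))
  · rw [bump_eq_one, bump_eq_one, sub_self]
    · rw [norm_smul, norm_of_nonneg hR0.le]
      calc R * ‖ξ‖ ≤ R * R⁻¹ := by gcongr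
        _ = 1 := mul_inv_cancel₀ hR0.ne'
    · rw [norm_smul, norm_of_nonneg (by positivity)]
      have : R⁻¹ ≤ 1 := inv_le_one_of_one_le₀ hR
      calc R⁻¹ * ‖ξ‖ ≤ 1 * 1 := by gcongr; linarith
        _ = 1 := one_mul 1
  · have := norm_pos_iff.2 h
    exact (contDiffAt_const.mul (contDiffAt_norm ℝ h)).inv (by positivity)

lemma testFreq_eq_zero {R : ℝ} (hR : 1 ≤ R) {ξ : E3} (h : 2 * R < ‖ξ‖) : testFreq R ξ = 0 := by
  have hR0 : 0 < R := by linarith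
  rw [testFreq, bump_eq_zero, bump_eq_zero, sub_self, zero_mul]
  · rw [norm_smul, norm_of_nonneg hR0.le]; nlinarith
  · rw [norm_smul, norm_of_nonneg (by positivity), inv_mul_eq_div, le_div_iff₀ hR0]; exact h.le

lemma hasCompactSupport_testFreq {R : ℝ} (hR : 1 ≤ R) : HasCompactSupport (testFreq R) :=
  hasCompactSupport_of_eq_zero (r := 2 * R) fun _ h => testFreq_eq_zero hR h

lemma abs_testFreq_le (R : ℝ) (ξ : E3) : |testFreq R ξ| ≤ (2 * π)⁻¹ * ‖ξ‖⁻¹ := by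
  rw [testFreq, abs_mul, abs_of_nonneg (by positivity : 0 ≤ (2 * π * ‖ξ‖)⁻¹), ← mul_inv]
  refine mul_le_of_le_one_left (by positivity) ?_
  rw [abs_le]
  constructor <;> linarith [bump_nonneg (R⁻¹ • ξ), bump_nonneg (R • ξ), bump_le_one (R⁻¹ • ξ),
    bump_le_one (R • ξ)]

lemma tendsto_testFreq {ξ : E3} (h : ξ ≠ 0) :
    Tendsto (fun R => testFreq R ξ) atTop (𝓝 ((2 * π)⁻¹ * ‖ξ‖⁻¹)) := by
  have n0 := norm_pos_iff.2 h
  refine tendsto_const_nhds.congr' ?_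
  filter_upwards [eventually_ge_atTop (2 * ‖ξ‖⁻¹), eventually_ge_atTop ‖ξ‖,
    eventually_gt_atTop 0] with R h1 h2 h3
  rw [testFreq, bump_eq_one, bump_eq_zero, sub_zero, one_mul, mul_inv (2 * π) ‖ξ‖]
  · rw [norm_smul, norm_of_nonneg h3.le]
    calc 2 = 2 * ‖ξ‖⁻¹ * ‖ξ‖ := by field_simp
      _ ≤ _ := by gcongr
  · rw [norm_smul, norm_of_nonneg (by positivity), inv_mul_eq_div, div_le_one h3]; exact h2

lemma testFreq_eq_integral {R : ℝ} (hR : 1 ≤ R) {ξ : E3} (h : ξ ≠ 0) :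
    testFreq R ξ = ∫ r in R⁻¹..R, profile (r • ξ) := by
  have n0 := norm_pos_iff.2 h
  have := integral_profile ξ (s := R⁻¹) (t := R) (by positivity)
    ((inv_le_one_of_one_le₀ hR).trans hR)
  rw [testFreq, ← this]
  field_simp

lemma cosT_testFreq {R : ℝ} (hR : 1 ≤ R) (x : E3) :
    cosT (testFreq R) x = ∫ t in R⁻¹..R, (t ^ 3)⁻¹ * cosT profile (t⁻¹ • x) := by
  have hR0 : 0 < R := by linarith
  have hle : R⁻¹ ≤ R := (inv_le_one_of_one_le₀ hR).trans hR
  obtain ⟨M, hM⟩ := contDiff_profile.continuous.bounded_above_of_compact_support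
    hasCompactSupport_profile
  have hprod : Integrable (Function.uncurry fun (ξ : E3) (t : ℝ) =>
      cos (2 * π * inner ℝ x ξ) * profile (t • ξ))
      ((volume : Measure E3).prod ((volume : Measure ℝ).restrict (Set.Ioc R⁻¹ R))) := by
    have hb : Integrable ((Metric.closedBall (0:E3) (2 * R)).indicator fun _ => M) :=
      (integrable_indicator_iff measurableSet_closedBall).2
        (integrableOn_const (measure_closedBall_lt_top.ne))
    have hone : Integrable (fun _ : ℝ => (1:ℝ)) ((volume : Measure ℝ).restrict (Set.Ioc R⁻¹ R)) := by
      simp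
    have hcont : Continuous (Function.uncurry fun (ξ : E3) (t : ℝ) =>
      cos (2 * π * inner ℝ x ξ) * profile (t • ξ)) := by
      have := contDiff_profile.continuous
      simp only [Function.uncurry_def]
      fun_prop
    refine (hb.mul_prod hone).mono' hcont.aestronglyMeasurable ?_
    have hmem : ∀ᵐ p : E3 × ℝ ∂((volume : Measure E3).prod
        ((volume : Measure ℝ).restrict (Set.Ioc R⁻¹ R))), p.2 ∈ Set.Ioc R⁻¹ R :=
      Measure.quasiMeasurePreserving_snd.ae (ae_restrict_mem measurableSet_Ioc)
    filter_upwards [hmem] with p hp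
    simp only [Function.uncurry_def, mul_one]
    have ht : 0 < p.2 := lt_trans (by positivity) hp.1
    by_cases hξ : p.1 ∈ Metric.closedBall (0:E3) (2 * R)
    · rw [Set.indicator_of_mem hξ, norm_mul]
      exact (mul_le_of_le_one_left (norm_nonneg _) (abs_cos_le_one _)).trans (hM _)
    · rw [Set.indicator_of_notMem hξ, profile_eq_zero, mul_zero, norm_zero]
      have hξ' : 2 * R < ‖p.1‖ := by simpa using hξ
      rw [norm_smul, norm_of_nonneg ht.le]
      calc 2 = R⁻¹ * (2 * R) := by field_simp
        _ < p.2 * ‖p.1‖ := by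
          apply mul_lt_mul hp.1 hξ'.le (by positivity) ht.le
  have e1 : cosT (testFreq R) x = ∫ ξ : E3, ∫ t in Set.Ioc R⁻¹ R,
      cos (2 * π * inner ℝ x ξ) * profile (t • ξ) := by
    rw [cosT]
    refine integral_congr_ae ?_
    filter_upwards [ae_ne 0] with ξ hξ
    rw [testFreq_eq_integral hR hξ, intervalIntegral.integral_of_le hle, integral_const_mul]
  rw [e1, integral_integral_swap hprod, intervalIntegral.integral_of_le hle]
  refine setIntegral_congr_fun measurableSet_Ioc fun t ht => ?_
  exact cosT_dilate profile (lt_trans (by positivity) ht.1) x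

lemma integrableOn_inv_add_cube {ρ : ℝ} (hρ : 0 < ρ) :
    IntegrableOn (fun t : ℝ => ((t + ρ) ^ 3)⁻¹) (Set.Ioi 0) ∧
      ∫ t in Set.Ioi (0:ℝ), ((t + ρ) ^ 3)⁻¹ = (ρ ^ 2)⁻¹ / 2 := by
  have hd : ∀ t ∈ Set.Ici (0:ℝ), HasDerivAt (fun t : ℝ => -((t + ρ) ^ 2)⁻¹ / 2) (((t + ρ) ^ 3)⁻¹) t := by
    intro t ht
    have ht0 : 0 < t + ρ := by have : 0 ≤ t := ht; linarith
    have h1 : HasDerivAt (fun t : ℝ => (t + ρ) ^ 2) (2 * (t + ρ)) t := by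
      simpa using ((hasDerivAt_id' t).add_const ρ).fun_pow 2
    refine ((h1.inv (by positivity)).neg.div_const 2).congr_deriv ?_
    field_simp
  have hl : Tendsto (fun t : ℝ => -((t + ρ) ^ 2)⁻¹ / 2) atTop (𝓝 0) := by
    have : Tendsto (fun t : ℝ => (t + ρ) ^ 2) atTop atTop :=
      (tendsto_pow_atTop (by norm_num)).comp (tendsto_atTop_add_const_right _ ρ tendsto_id)
    simpa using (this.inv_tendsto_atTop).neg.div_const 2
  have hpos : ∀ t ∈ Set.Ioi (0:ℝ), 0 ≤ ((t + ρ) ^ 3)⁻¹ := fun t ht => by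
    have : (0:ℝ) < t := ht
    positivity
  have hi := integrableOn_Ioi_deriv_of_nonneg' hd hpos hl
  refine ⟨hi, ?_⟩
  rw [integral_Ioi_of_hasDerivAt_of_tendsto' hd hi hl]
  simp; ring

lemma profile_radial {ξ η : E3} (h : ‖ξ‖ = ‖η‖) : profile ξ = profile η := by
  rw [profile, profile, h]

lemma exists_dilate_bound : ∃ C, 0 ≤ C ∧ ∀ (x : E3) (t : ℝ), 0 < t →
    |(t ^ 3)⁻¹ * cosT profile (t⁻¹ • x)| ≤ C * ((t + ‖x‖) ^ 3)⁻¹ := by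
  obtain ⟨C, hC0, hC⟩ := cosT_decay contDiff_profile hasCompactSupport_profile 3
  refine ⟨C, hC0, fun x t ht => ?_⟩
  have h := hC (t⁻¹ • x)
  rw [norm_smul, norm_of_nonneg (by positivity : 0 ≤ t⁻¹)] at h
  rw [abs_mul, abs_of_nonneg (by positivity : 0 ≤ (t ^ 3)⁻¹), ← div_eq_mul_inv,
    le_div_iff₀ (by positivity)]
  calc _ = (1 + t⁻¹ * ‖x‖) ^ 3 * |cosT profile (t⁻¹ • x)| := by field_simp
    _ ≤ C := h

/-- The test functions converge to the kernel of `(-Δ)^{-1/2}` and are dominated by it. -/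
lemma cosT_testFreq_limit : (∃ C, 0 ≤ C ∧ ∀ R, 1 ≤ R → ∀ x : E3, x ≠ 0 →
      |cosT (testFreq R) x| ≤ C * (‖x‖ ^ 2)⁻¹) ∧
    ∀ x : E3, x ≠ 0 → Tendsto (fun R => cosT (testFreq R) x) atTop
      (𝓝 ((2 * π ^ 2)⁻¹ * (‖x‖ ^ 2)⁻¹)) := by
  obtain ⟨C, hC0, hC⟩ := exists_dilate_bound
  set F : E3 → ℝ → ℝ := fun x t => (t ^ 3)⁻¹ * cosT profile (t⁻¹ • x) with hF
  have hn := (cosT_smooth contDiff_profile hasCompactSupport_profile).continuous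
  have hFm : ∀ x, Measurable (F x) := fun x => by
    simp only [hF]
    exact (by fun_prop : Measurable fun t : ℝ => (t ^ 3)⁻¹).mul
      (hn.measurable.comp (by fun_prop))
  have hFi : ∀ x, x ≠ 0 → IntegrableOn (F x) (Set.Ioi 0) := fun x hx => by
    refine ((integrableOn_inv_add_cube (norm_pos_iff.2 hx)).1.const_mul C).mono'
      (hFm x).aestronglyMeasurable ?_
    exact (ae_restrict_iff' measurableSet_Ioi).2 (ae_of_all _ fun t ht => hC x t ht)
  have bound : ∀ R, 1 ≤ R → ∀ x : E3, x ≠ 0 → |cosT (testFreq R) x| ≤ C / 2 * (‖x‖ ^ 2)⁻¹ := by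
    intro R hR x hx
    have hle : R⁻¹ ≤ R := (inv_le_one_of_one_le₀ hR).trans hR
    have hsub : Set.Ioc R⁻¹ R ⊆ Set.Ioi 0 := fun t ht => lt_trans (by positivity) ht.1
    obtain ⟨i1, i2⟩ := integrableOn_inv_add_cube (norm_pos_iff.2 hx)
    rw [cosT_testFreq hR, intervalIntegral.integral_of_le hle]
    refine abs_integral_le_integral_abs.trans ?_
    calc _ ≤ ∫ t in Set.Ioi (0:ℝ), |F x t| :=
          setIntegral_mono_set (hFi x hx).abs (ae_of_all _ fun _ => abs_nonneg _)
            (LE.le.eventuallyLE hsub)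
      _ ≤ ∫ t in Set.Ioi (0:ℝ), C * ((t + ‖x‖) ^ 3)⁻¹ :=
          setIntegral_mono_on (hFi x hx).abs (i1.const_mul C) measurableSet_Ioi
            fun t ht => hC x t ht
      _ = _ := by rw [integral_const_mul, i2]; ring
  have lim : ∀ x : E3, x ≠ 0 → Tendsto (fun R => cosT (testFreq R) x) atTop
      (𝓝 (∫ t in Set.Ioi (0:ℝ), F x t)) := by
    intro x hx
    have h : Tendsto (fun R : ℝ => ∫ t in Set.Ioi (0:ℝ), (Set.Ioc R⁻¹ R).indicator (F x) t) atTop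
        (𝓝 (∫ t in Set.Ioi (0:ℝ), F x t)) := by
      refine tendsto_integral_filter_of_dominated_convergence (fun t => ‖F x t‖) ?_ ?_
        (hFi x hx).norm ?_
      · exact Eventually.of_forall fun R =>
          ((hFm x).indicator measurableSet_Ioc).aestronglyMeasurable
      · exact Eventually.of_forall fun ε => ae_of_all _ fun z => norm_indicator_le_norm_self _ _
      · refine (ae_restrict_iff' measurableSet_Ioi).2 (ae_of_all _ fun t ht => ?_)
        refine tendsto_const_nhds.congr' ?_
        filter_upwards [eventually_ge_atTop t, eventually_gt_atTop t⁻¹] with R h1 h2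
        rw [Set.indicator_of_mem]
        refine ⟨?_, h1⟩
        have ht' : (0:ℝ) < t := ht
        exact inv_lt_of_inv_lt₀ ht' h2
    refine h.congr' ?_
    filter_upwards [eventually_ge_atTop 1] with R hR
    have hle : R⁻¹ ≤ R := (inv_le_one_of_one_le₀ hR).trans hR
    have hsub : Set.Ioc R⁻¹ R ⊆ Set.Ioi 0 := fun t ht => lt_trans (by positivity) ht.1
    rw [cosT_testFreq hR, intervalIntegral.integral_of_le hle,
      setIntegral_indicator measurableSet_Ioc, Set.inter_eq_right.2 hsub]
  set e₀ : E3 := EuclideanSpace.single 0 1 with he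
  have hne : ‖e₀‖ = 1 := by simp [he]
  set κ := ∫ t in Set.Ioi (0:ℝ), F e₀ t with hκ
  have hN : ∀ x : E3, x ≠ 0 → ∫ t in Set.Ioi (0:ℝ), F x t = κ * (‖x‖ ^ 2)⁻¹ := by
    intro x hx
    have n0 := norm_pos_iff.2 hx
    have h := integral_comp_mul_left_Ioi (F x) 0 n0
    rw [mul_zero, smul_eq_mul] at h
    have e : ∀ t ∈ Set.Ioi (0:ℝ), F x (‖x‖ * t) = (‖x‖ ^ 3)⁻¹ * F e₀ t := by
      intro t ht
      have ht' : (0:ℝ) < t := ht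
      simp only [hF]
      rw [cosT_congr_norm (x := (‖x‖ * t)⁻¹ • x) (y := t⁻¹ • e₀) (fun _ _ => profile_radial)]
      · rw [mul_pow, mul_inv]; ring
      · rw [norm_smul, norm_smul, hne, norm_of_nonneg (by positivity), norm_of_nonneg (by positivity)]
        field_simp
    rw [setIntegral_congr_fun measurableSet_Ioi e, integral_const_mul, ← hκ] at h
    field_simp at h ⊢
    linarith
  have hκv : κ = (2 * π ^ 2)⁻¹ := by
    have hpair : ∀ R, 1 ≤ R → ∫ x, cosT (testFreq R) x * exp (-π * ‖x‖ ^ 2) =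
        ∫ ξ, testFreq R ξ * exp (-π * ‖ξ‖ ^ 2) := by
      intro R hR
      have hc := (contDiff_testFreq hR).continuous
      have hi : Integrable (testFreq R) :=
        hc.integrable_of_hasCompactSupport (hasCompactSupport_testFreq hR)
      have hprod : Integrable (Function.uncurry fun (x ξ : E3) =>
          cos (2 * π * inner ℝ x ξ) * testFreq R ξ * exp (-π * ‖x‖ ^ 2))
          ((volume : Measure E3).prod volume) := by
        refine (integrable_gauss.mul_prod hi.norm).mono' ?_ (ae_of_all _ fun p => ?_)
        · have : Continuous (Function.uncurry fun (x ξ : E3) =>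
            cos (2 * π * inner ℝ x ξ) * testFreq R ξ * exp (-π * ‖x‖ ^ 2)) := by
            simp only [Function.uncurry_def]; fun_prop
          exact this.aestronglyMeasurable
        · simp only [Function.uncurry_def]
          rw [norm_mul, norm_mul, norm_of_nonneg (exp_pos _).le, mul_comm]
          gcongr
          exact mul_le_of_le_one_left (norm_nonneg _) (abs_cos_le_one _)
      have := integral_integral_swap hprod
      simp only [integral_mul_const] at this
      rw [show ∫ x, cosT (testFreq R) x * exp (-π * ‖x‖ ^ 2) = _ from this]
      refine integral_congr_ae (ae_of_all _ fun ξ => ?_)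
      simp only
      rw [← integral_cos_gauss ξ, ← integral_const_mul]
      refine integral_congr_ae (ae_of_all _ fun x => ?_)
      simp only
      rw [real_inner_comm]; ring
    have ig2 : Integrable fun x : E3 => (‖x‖ ^ 2)⁻¹ * exp (-π * ‖x‖ ^ 2) := by
      by_contra h
      have := integral_undef h
      rw [integral_inv_norm_sq_mul_gauss] at this
      have := pi_pos
      linarith
    have ig1 : Integrable fun x : E3 => ‖x‖⁻¹ * exp (-π * ‖x‖ ^ 2) := by
      by_contra h
      have := integral_undef h
      rw [integral_inv_norm_mul_gauss] at this
      linarith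
    have l1 : Tendsto (fun R => ∫ x, cosT (testFreq R) x * exp (-π * ‖x‖ ^ 2)) atTop
        (𝓝 (∫ x : E3, κ * (‖x‖ ^ 2)⁻¹ * exp (-π * ‖x‖ ^ 2))) := by
      refine tendsto_integral_filter_of_dominated_convergence
        (fun x => C / 2 * ((‖x‖ ^ 2)⁻¹ * exp (-π * ‖x‖ ^ 2))) ?_ ?_ (ig2.const_mul _) ?_
      · filter_upwards [eventually_ge_atTop 1] with R hR
        have := (cosT_smooth (contDiff_testFreq hR) (hasCompactSupport_testFreq hR)).continuous
        exact (by fun_prop : Continuous fun x : E3 => cosT (testFreq R) x * exp (-π * ‖x‖ ^ 2)).aestronglyMeasurable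
      · filter_upwards [eventually_ge_atTop 1] with R hR
        filter_upwards [ae_ne 0] with x hx
        rw [norm_mul, norm_of_nonneg (exp_pos _).le, ← mul_assoc]
        gcongr
        exact bound R hR x hx
      · filter_upwards [ae_ne 0] with x hx
        rw [← hN x hx]
        exact (lim x hx).mul_const _
    have l2 : Tendsto (fun R => ∫ x : E3, testFreq R x * exp (-π * ‖x‖ ^ 2)) atTop
        (𝓝 (∫ x : E3, (2 * π)⁻¹ * ‖x‖⁻¹ * exp (-π * ‖x‖ ^ 2))) := by
      refine tendsto_integral_filter_of_dominated_convergence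
        (fun x => (2 * π)⁻¹ * (‖x‖⁻¹ * exp (-π * ‖x‖ ^ 2))) ?_ ?_ (ig1.const_mul _) ?_
      · filter_upwards [eventually_ge_atTop 1] with R hR
        have := (contDiff_testFreq hR).continuous
        exact (by fun_prop : Continuous fun x : E3 => testFreq R x * exp (-π * ‖x‖ ^ 2)).aestronglyMeasurable
      · refine Eventually.of_forall fun R => ae_of_all _ fun x => ?_
        rw [norm_mul, norm_of_nonneg (exp_pos _).le, ← mul_assoc]
        gcongr
        exact abs_testFreq_le R x
      · filter_upwards [ae_ne 0] with x hx
        exact (tendsto_testFreq hx).mul_const _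
    have l1' := l1.congr' (by
      filter_upwards [eventually_ge_atTop 1] with R hR using hpair R hR)
    have heq := tendsto_nhds_unique l1' l2
    simp only [mul_assoc κ, mul_assoc (2 * π)⁻¹, integral_const_mul] at heq
    rw [integral_inv_norm_mul_gauss, integral_inv_norm_sq_mul_gauss] at heq
    have := pi_pos
    field_simp at heq ⊢
    linarith
  refine ⟨⟨C / 2, by positivity, bound⟩, fun x hx => ?_⟩
  have := lim x hx
  rwa [hN x hx, hκv] at this

lemma integrable_mul_of_decay {w φ : E3 → ℝ} (hwc : Continuous w)
    (hw : Integrable fun x => |w x| / (1 + ‖x‖ ^ 4)) (hφ : Continuous φ) {C : ℝ}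
    (hC : ∀ x, (1 + ‖x‖) ^ 4 * |φ x| ≤ C) : Integrable fun x => w x * φ x := by
  refine (hw.const_mul C).mono' (hwc.mul hφ).aestronglyMeasurable (ae_of_all _ fun x => ?_)
  have h1 : 1 + ‖x‖ ^ 4 ≤ (1 + ‖x‖) ^ 4 := by
    have := norm_nonneg x
    nlinarith [pow_nonneg this 2, pow_nonneg this 3]
  rw [norm_mul, norm_eq_abs, norm_eq_abs, mul_div_assoc', le_div_iff₀ (by positivity)]
  calc |w x| * |φ x| * (1 + ‖x‖ ^ 4) = |w x| * ((1 + ‖x‖ ^ 4) * |φ x|) := by ring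
    _ ≤ |w x| * C := by
      gcongr
      exact (mul_le_mul_of_nonneg_right h1 (abs_nonneg _)).trans (hC x)
    _ = _ := mul_comm _ _

/-- The Schwartz mollifier with integral one. -/
noncomputable def moll (x : E3) : ℝ := cosT bump x

lemma continuous_moll : Continuous moll := (cosT_smooth contDiff_bump hasCompactSupport_bump).continuous

lemma integrable_moll : Integrable moll := cosT_integrable contDiff_bump hasCompactSupport_bump

lemma integral_moll : ∫ x, moll x = 1 := by
  have := integral_cosT contDiff_bump hasCompactSupport_bump
  rwa [bump_eq_one (by simp)] at this

lemma moll_decay : ∃ C, 0 ≤ C ∧ ∀ x, (1 + ‖x‖) ^ 4 * |moll x| ≤ C :=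
  cosT_decay contDiff_bump hasCompactSupport_bump 4

lemma integrable_mul_moll {w : E3 → ℝ} (hwc : Continuous w)
    (hw : Integrable fun x => |w x| / (1 + ‖x‖ ^ 4)) {R : ℝ} (hR : 0 < R) (a : E3) :
    Integrable fun x => w x * (R ^ 3 * moll (R • (x - a))) := by
  obtain ⟨C, hC0, hC⟩ := moll_decay
  refine integrable_mul_of_decay (C := (1 + ‖a‖ + R⁻¹) ^ 4 * (R ^ 3 * C)) hwc hw
    (continuous_const.mul (continuous_moll.comp (by fun_prop))) fun x => ?_
  have h1 : 1 + ‖x‖ ≤ (1 + ‖a‖ + R⁻¹) * (1 + ‖R • (x - a)‖) := by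
    rw [norm_smul, norm_of_nonneg hR.le]
    have h2 : ‖x‖ ≤ ‖a‖ + ‖x - a‖ := by
      simpa using norm_add_le a (x - a)
    have h3 : R⁻¹ * (R * ‖x - a‖) = ‖x - a‖ := by field_simp
    have h4 : 0 ≤ (1 + ‖a‖) * (R * ‖x - a‖) := by positivity
    have h5 : 0 ≤ R⁻¹ := by positivity
    nlinarith
  rw [abs_mul, abs_of_nonneg (by positivity : 0 ≤ R ^ 3)]
  calc _ ≤ ((1 + ‖a‖ + R⁻¹) * (1 + ‖R • (x - a)‖)) ^ 4 * (R ^ 3 * |moll (R • (x - a))|) := by gcongr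
    _ = (1 + ‖a‖ + R⁻¹) ^ 4 * (R ^ 3 * ((1 + ‖R • (x - a)‖) ^ 4 * |moll (R • (x - a))|)) := by ring
    _ ≤ _ := by gcongr; exact hC _

lemma tendsto_integral_moll {w : E3 → ℝ} (hwc : Continuous w)
    (hw : Integrable fun x => |w x| / (1 + ‖x‖ ^ 4)) (a : E3) :
    Tendsto (fun R : ℝ => ∫ x, w x * (R ^ 3 * moll (R • (x - a)))) atTop (𝓝 (w a)) := by
  obtain ⟨C, hC0, hC⟩ := moll_decay
  obtain ⟨B, hB0, hB⟩ := exists_bound_ball hwc a 1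
  set S : Set E3 := Metric.ball a 1 with hS
  have near : Tendsto (fun R : ℝ => ∫ x in S, w x * (R ^ 3 * moll (R • (x - a)))) atTop
      (𝓝 (w a)) := by
    have h : Tendsto (fun R : ℝ => ∫ z, S.indicator w (a + R⁻¹ • z) * moll z) atTop
        (𝓝 (∫ z, w a * moll z)) := by
      refine tendsto_integral_filter_of_dominated_convergence (fun z => B * |moll z|) ?_ ?_
        (integrable_moll.abs.const_mul B) ?_
      · refine Eventually.of_forall fun R => ?_
        refine Measurable.aestronglyMeasurable ?_
        exact ((hwc.measurable.indicator Metric.isOpen_ball.measurableSet).comp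
          (by fun_prop)).mul continuous_moll.measurable
      · refine Eventually.of_forall fun R => ae_of_all _ fun z => ?_
        rw [norm_mul]
        refine mul_le_mul_of_nonneg_right ?_ (norm_nonneg _)
        by_cases hz : a + R⁻¹ • z ∈ S
        · rw [Set.indicator_of_mem hz]; exact hB _ hz
        · rw [Set.indicator_of_notMem hz]; simpa using hB0
      · refine ae_of_all _ fun z => ?_
        refine Tendsto.mul_const _ ?_
        have h1 : Tendsto (fun R : ℝ => a + R⁻¹ • z) atTop (𝓝 a) := by
          simpa using tendsto_const_nhds.add ((tendsto_inv_atTop_zero (𝕜 := ℝ)).smul_const z)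
        refine ((hwc.tendsto a).comp h1).congr' ?_
        filter_upwards [h1.eventually (Metric.ball_mem_nhds a one_pos)] with R hR
        exact (Set.indicator_of_mem (s := S) hR w).symm
    rw [integral_const_mul, integral_moll, mul_one] at h
    refine h.congr' ?_
    filter_upwards [eventually_gt_atTop 0] with R hR
    rw [← integral_indicator Metric.isOpen_ball.measurableSet]
    have e1 := integral_add_left_eq_self (μ := volume)
      (S.indicator fun x => w x * (R ^ 3 * moll (R • (x - a)))) a
    rw [← e1]
    have e2 := Measure.integral_comp_smul (volume : Measure E3)
      (fun x => S.indicator (fun x => w x * (R ^ 3 * moll (R • (x - a)))) (a + x)) R⁻¹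
    rw [finrank_E3, inv_pow, inv_inv, abs_of_pos (by positivity), smul_eq_mul] at e2
    have hR3 : R ^ 3 ≠ 0 := by positivity
    refine mul_left_cancel₀ hR3 ?_
    rw [← e2, ← integral_const_mul]
    refine integral_congr_ae (ae_of_all _ fun z => ?_)
    simp only
    by_cases hz : a + R⁻¹ • z ∈ S
    · rw [Set.indicator_of_mem hz, Set.indicator_of_mem hz, add_sub_cancel_left,
        smul_inv_smul₀ hR.ne']
      ring
    · rw [Set.indicator_of_notMem hz, Set.indicator_of_notMem hz]; simp
  have far : Tendsto (fun R : ℝ => ∫ x in Sᶜ, w x * (R ^ 3 * moll (R • (x - a)))) atTop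
      (𝓝 0) := by
    have hb : Tendsto (fun R : ℝ => R⁻¹ * (C * (2 + ‖a‖) ^ 4 * ∫ x : E3, |w x| / (1 + ‖x‖ ^ 4)))
        atTop (𝓝 0) := by
      have := (tendsto_inv_atTop_zero (𝕜 := ℝ)).mul_const
        (C * (2 + ‖a‖) ^ 4 * ∫ x : E3, |w x| / (1 + ‖x‖ ^ 4))
      rwa [zero_mul] at this
    refine squeeze_zero_norm' ?_ hb
    filter_upwards [eventually_gt_atTop 0] with R hR
    rw [← integral_const_mul, ← integral_const_mul]
    refine (norm_integral_le_integral_norm _).trans ?_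
    have hint := hw.const_mul (C * (2 + ‖a‖) ^ 4)
    have hint2 : Integrable fun x => R⁻¹ * (C * (2 + ‖a‖) ^ 4 * (|w x| / (1 + ‖x‖ ^ 4))) :=
      hint.const_mul R⁻¹
    refine le_trans (setIntegral_mono_on (integrable_mul_moll hwc hw hR a).norm.integrableOn
      hint2.integrableOn Metric.isOpen_ball.measurableSet.compl fun x hx => ?_)
      (setIntegral_le_integral hint2 (ae_of_all _ fun x => ?_))
    · have hx1 : 1 ≤ ‖x - a‖ := by
        have : ¬ dist x a < 1 := hx
        rw [dist_eq_norm] at this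
        exact not_lt.1 this
      have h2 : ‖x‖ ≤ ‖a‖ + ‖x - a‖ := by
        simpa using norm_add_le a (x - a)
      have h3 : 1 + ‖x‖ ≤ (2 + ‖a‖) * ‖x - a‖ := by nlinarith [norm_nonneg a]
      have h4 : 1 + ‖x‖ ^ 4 ≤ (1 + ‖x‖) ^ 4 := by
        have := norm_nonneg x
        nlinarith [pow_nonneg this 2, pow_nonneg this 3]
      have h5 : 1 + ‖x‖ ^ 4 ≤ (2 + ‖a‖) ^ 4 * ‖x - a‖ ^ 4 := by
        rw [← mul_pow]; exact h4.trans (by gcongr)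
      have h6 : R ^ 4 * ‖x - a‖ ^ 4 * |moll (R • (x - a))| ≤ C := by
        refine le_trans ?_ (hC (R • (x - a)))
        gcongr
        rw [← mul_pow]
        gcongr
        rw [norm_smul, norm_of_nonneg hR.le]
        linarith
      rw [norm_mul, norm_eq_abs, norm_eq_abs, abs_mul, abs_of_nonneg (by positivity : 0 ≤ R ^ 3)]
      have h7 : R ^ 3 * |moll (R • (x - a))| ≤ R⁻¹ * (C * (2 + ‖a‖) ^ 4 / (1 + ‖x‖ ^ 4)) := by
        rw [mul_div_assoc', le_div_iff₀ (by positivity), inv_mul_eq_div, le_div_iff₀ hR]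
        calc R ^ 3 * |moll (R • (x - a))| * (1 + ‖x‖ ^ 4) * R
            ≤ R ^ 3 * |moll (R • (x - a))| * ((2 + ‖a‖) ^ 4 * ‖x - a‖ ^ 4) * R := by gcongr
          _ = (2 + ‖a‖) ^ 4 * (R ^ 4 * ‖x - a‖ ^ 4 * |moll (R • (x - a))|) := by ring
          _ ≤ (2 + ‖a‖) ^ 4 * C := by gcongr
          _ = _ := mul_comm _ _
      calc _ ≤ |w x| * (R⁻¹ * (C * (2 + ‖a‖) ^ 4 / (1 + ‖x‖ ^ 4))) := by gcongr
        _ = _ := by ring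
    · show 0 ≤ R⁻¹ * (C * (2 + ‖a‖) ^ 4 * (|w x| / (1 + ‖x‖ ^ 4)))
      positivity
  have := near.add far
  rw [add_zero] at this
  refine this.congr' ?_
  filter_upwards [eventually_gt_atTop 0] with R hR
  exact integral_add_compl Metric.isOpen_ball.measurableSet (integrable_mul_moll hwc hw hR a)

lemma tendsto_integral_moll_wide {w : E3 → ℝ} (hwc : Continuous w)
    (hw : Integrable fun x => |w x| / (1 + ‖x‖ ^ 4)) (a b : E3) :
    Tendsto (fun R : ℝ => (∫ x, w x * (R⁻¹ ^ 3 * moll (R⁻¹ • (x - a)))) -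
      ∫ x, w x * (R⁻¹ ^ 3 * moll (R⁻¹ • (x - b)))) atTop (𝓝 0) := by
  obtain ⟨C, hC0, hC⟩ := cosT_fderiv_decay contDiff_bump hasCompactSupport_bump 4
  obtain ⟨D, hD0, hD⟩ := moll_decay
  have hdiff : Differentiable ℝ moll :=
    (cosT_smooth contDiff_bump hasCompactSupport_bump).differentiable (by simp)
  have key : ∀ R : ℝ, 1 + ‖a‖ + ‖b‖ ≤ R → ∀ x : E3,
      |moll (R⁻¹ • (x - a)) - moll (R⁻¹ • (x - b))| ≤
        R ^ 3 * (C * ‖a - b‖ / (1 + ‖x‖) ^ 4) := by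
    intro R hR x
    have ha := norm_nonneg a
    have hb := norm_nonneg b
    have hR0 : 0 < R := by linarith
    have hmv := (convex_segment (𝕜 := ℝ) (R⁻¹ • (x - b)) (R⁻¹ • (x - a))).norm_image_sub_le_of_norm_fderiv_le
      (f := moll) (C := C * R ^ 4 / (1 + ‖x‖) ^ 4) (fun z _ => hdiff z) (fun z hz => ?_)
      (left_mem_segment ℝ _ _) (right_mem_segment ℝ _ _)
    · rw [← norm_eq_abs]
      refine hmv.trans (le_of_eq ?_)
      rw [← smul_sub, norm_smul, norm_of_nonneg (by positivity), sub_sub_sub_cancel_left,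
        norm_sub_rev b a]
      field_simp
    · have hz' : 1 + ‖x‖ ≤ R * (1 + ‖z‖) := by
        obtain ⟨s, t, hs, ht, hst, rfl⟩ := hz
        have e : x = R • (s • R⁻¹ • (x - b) + t • R⁻¹ • (x - a)) + (s • b + t • a) := by
          have : t = 1 - s := by linarith
          subst this
          simp only [smul_add, smul_smul]
          have h1 : R * (s * R⁻¹) = s := by field_simp
          have h2 : R * ((1 - s) * R⁻¹) = 1 - s := by field_simp
          rw [h1, h2]
          module
        have h1 : ‖x‖ ≤ R * ‖s • R⁻¹ • (x - b) + t • R⁻¹ • (x - a)‖ + (s * ‖b‖ + t * ‖a‖) := by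
          conv_lhs => rw [e]
          refine (norm_add_le _ _).trans (add_le_add ?_ ?_)
          · rw [norm_smul, norm_of_nonneg hR0.le]
          · refine (norm_add_le _ _).trans ?_
            rw [norm_smul, norm_smul, norm_of_nonneg hs, norm_of_nonneg ht]
        have h2 : s * ‖b‖ ≤ ‖b‖ := mul_le_of_le_one_left hb (by linarith)
        have h3 : t * ‖a‖ ≤ ‖a‖ := mul_le_of_le_one_left ha (by linarith)
        nlinarith
      have := hC z
      rw [le_div_iff₀ (by positivity)]
      calc ‖fderiv ℝ moll z‖ * (1 + ‖x‖) ^ 4 ≤ ‖fderiv ℝ moll z‖ * (R * (1 + ‖z‖)) ^ 4 := by gcongr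
        _ = R ^ 4 * ((1 + ‖z‖) ^ 4 * ‖fderiv ℝ moll z‖) := by ring
        _ ≤ R ^ 4 * C := by gcongr; exact this
        _ = _ := mul_comm _ _
  have h : Tendsto (fun R : ℝ => ∫ x, w x * (R⁻¹ ^ 3 * (moll (R⁻¹ • (x - a)) - moll (R⁻¹ • (x - b)))))
      atTop (𝓝 (∫ _ : E3, (0:ℝ))) := by
    refine tendsto_integral_filter_of_dominated_convergence
      (fun x => C * ‖a - b‖ * (|w x| / (1 + ‖x‖ ^ 4))) ?_ ?_ (hw.const_mul _) ?_
    · refine Eventually.of_forall fun R => Continuous.aestronglyMeasurable ?_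
      have := continuous_moll
      fun_prop
    · filter_upwards [eventually_ge_atTop (1 + ‖a‖ + ‖b‖)] with R hR
      refine ae_of_all _ fun x => ?_
      have hR0 : 0 < R := by linarith [norm_nonneg a, norm_nonneg b]
      have h4 : 1 + ‖x‖ ^ 4 ≤ (1 + ‖x‖) ^ 4 := by
        have := norm_nonneg x
        nlinarith [pow_nonneg this 2, pow_nonneg this 3]
      rw [norm_mul, norm_mul, norm_of_nonneg (by positivity : 0 ≤ R⁻¹ ^ 3), norm_eq_abs, norm_eq_abs]
      calc _ ≤ |w x| * (R⁻¹ ^ 3 * (R ^ 3 * (C * ‖a - b‖ / (1 + ‖x‖) ^ 4))) := by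
            gcongr; exact key R hR x
        _ = |w x| * (C * ‖a - b‖ / (1 + ‖x‖) ^ 4) := by
            rw [← mul_assoc (R⁻¹ ^ 3), ← mul_pow, inv_mul_cancel₀ hR0.ne', one_pow, one_mul]
        _ ≤ |w x| * (C * ‖a - b‖ / (1 + ‖x‖ ^ 4)) := by gcongr
        _ = _ := by ring
    · refine ae_of_all _ fun x => ?_
      have hb : ∀ z, |moll z| ≤ D := fun z => by
        refine le_trans ?_ (hD z)
        refine le_mul_of_one_le_left (abs_nonneg _) (one_le_pow₀ (by linarith [norm_nonneg z]))
      have h0 : Tendsto (fun R : ℝ => |w x| * (R⁻¹ ^ 3 * (D + D))) atTop (𝓝 0) := by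
        simpa using (((tendsto_inv_atTop_zero (𝕜 := ℝ)).pow 3).mul_const (D + D)).const_mul |w x|
      refine squeeze_zero_norm' ?_ h0
      filter_upwards [eventually_gt_atTop 0] with R hR
      rw [norm_mul, norm_mul, norm_of_nonneg (by positivity : 0 ≤ R⁻¹ ^ 3), norm_eq_abs, norm_eq_abs]
      gcongr
      exact (abs_sub _ _).trans (add_le_add (hb _) (hb _))
  rw [integral_zero] at h
  refine h.congr' ?_
  filter_upwards [eventually_gt_atTop 0] with R hR
  rw [← integral_sub (integrable_mul_moll hwc hw (by positivity) a)
    (integrable_mul_moll hwc hw (by positivity) b)]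
  refine integral_congr_ae (ae_of_all _ fun x => ?_)
  simp only
  ring

/-- A distributional solution of `(-Δ)^{1/2} w = 2 f` in `L_{1/2}` is the Riesz potential of `f`
up to a constant. -/
lemma eq_riesz_add_const {w f : E3 → ℝ} (hwc : Continuous w)
    (hw : Integrable fun x => |w x| / (1 + ‖x‖ ^ 4)) (hfc : Continuous f) (hf : Integrable f)
    (h : ∀ φ : SchwartzMap E3 ℝ, ∫ x, w x * halfLap φ x = 2 * ∫ x, f x * φ x) :
    ∃ c, ∀ x, w x = (1 / π ^ 2) * (∫ y, (‖x - y‖ ^ 2)⁻¹ * f y) + c := by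
  obtain ⟨⟨C, hC0, hC⟩, hlim⟩ := cosT_testFreq_limit
  have test : ∀ R : ℝ, 1 ≤ R → ∀ a : E3, (∫ x, w x * (R ^ 3 * moll (R • (x - a)))) -
      (∫ x, w x * (R⁻¹ ^ 3 * moll (R⁻¹ • (x - a)))) = 2 * ∫ x, f x * cosT (testFreq R) (x - a) := by
    intro R hR a
    have hR0 : 0 < R := by linarith
    obtain ⟨φ, hφ⟩ := exists_schwartz (contDiff_testFreq hR) (hasCompactSupport_testFreq hR) a
    have hc := (contDiff_testFreq hR).continuous
    have hi : Integrable fun ξ : E3 => (1 + ‖ξ‖ ^ 2) * testFreq R ξ :=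
      (by fun_prop : Continuous fun ξ : E3 => (1 + ‖ξ‖ ^ 2) * testFreq R ξ).integrable_of_hasCompactSupport
        ((hasCompactSupport_testFreq hR).mul_left)
    have hb1 : ∀ s : ℝ, s ≠ 0 → Integrable fun ξ : E3 => bump (s • ξ) := fun s hs =>
      (integrable_comp_smul_iff volume _ hs).2
        (contDiff_bump.continuous.integrable_of_hasCompactSupport hasCompactSupport_bump)
    have hcb := contDiff_bump.continuous
    have hh : ∀ x, halfLap φ x = R ^ 3 * moll (R • (x - a)) - R⁻¹ ^ 3 * moll (R⁻¹ • (x - a)) := by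
      intro x
      rw [halfLap_eq hc hi (a := a) (fun x => hφ x) x]
      simp only [two_pi_norm_mul_testFreq, mul_sub]
      rw [integral_sub (integrable_cos_mul (by fun_prop) (hb1 _ (by positivity)) _)
        (integrable_cos_mul (by fun_prop) (hb1 _ (by positivity)) _)]
      have d1 := cosT_dilate bump (t := R⁻¹) (by positivity) (x - a)
      have d2 := cosT_dilate bump hR0 (x - a)
      rw [inv_inv, inv_pow, inv_inv] at d1
      rw [cosT] at d1 d2
      rw [d1, d2, moll, moll, inv_pow]
    have := h φ
    simp only [hh, hφ] at this
    rw [← this, ← integral_sub (integrable_mul_moll hwc hw hR0 a)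
      (integrable_mul_moll hwc hw (by positivity) a)]
    simp only [mul_sub]
  have rhs : ∀ a : E3, Tendsto (fun R => ∫ x, f x * cosT (testFreq R) (x - a)) atTop
      (𝓝 ((2 * π ^ 2)⁻¹ * ∫ x, (‖a - x‖ ^ 2)⁻¹ * f x)) := by
    intro a
    rw [← integral_const_mul]
    refine tendsto_integral_filter_of_dominated_convergence
      (fun x => C * ‖(‖a - x‖ ^ 2)⁻¹ * f x‖) ?_ ?_
      ((riesz_integrable hfc hf le_rfl a).norm.const_mul C) ?_
    · filter_upwards [eventually_ge_atTop 1] with R hR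
      have := (cosT_smooth (contDiff_testFreq hR) (hasCompactSupport_testFreq hR)).continuous
      exact (by fun_prop : Continuous fun x => f x * cosT (testFreq R) (x - a)).aestronglyMeasurable
    · filter_upwards [eventually_ge_atTop 1] with R hR
      filter_upwards [ae_ne a] with x hx
      rw [norm_mul, norm_mul, norm_of_nonneg (by positivity : 0 ≤ (‖a - x‖ ^ 2)⁻¹), norm_sub_rev a x,
        ← mul_assoc, mul_comm]
      gcongr
      exact hC R hR _ (sub_ne_zero.2 hx)
    · filter_upwards [ae_ne a] with x hx
      have := (hlim _ (sub_ne_zero.2 hx)).const_mul (f x)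
      rw [norm_sub_rev a x]
      rwa [mul_comm (f x), mul_assoc] at this
  have diff : ∀ a b : E3, w a - w b = 2 * ((2 * π ^ 2)⁻¹ * ∫ x, (‖a - x‖ ^ 2)⁻¹ * f x) -
      2 * ((2 * π ^ 2)⁻¹ * ∫ x, (‖b - x‖ ^ 2)⁻¹ * f x) := by
    intro a b
    have l1 := ((tendsto_integral_moll hwc hw a).sub (tendsto_integral_moll hwc hw b)).sub
      (tendsto_integral_moll_wide hwc hw a b)
    have l2 := ((rhs a).const_mul 2).sub ((rhs b).const_mul 2)
    rw [sub_zero] at l1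
    refine tendsto_nhds_unique_of_eventuallyEq l1 l2 ?_
    filter_upwards [eventually_ge_atTop 1] with R hR
    rw [← test R hR a, ← test R hR b]
    ring
  refine ⟨w 0 - 2 * ((2 * π ^ 2)⁻¹ * ∫ x, (‖0 - x‖ ^ 2)⁻¹ * f x), fun x => ?_⟩
  have := diff x 0
  have e : 2 * ((2 * π ^ 2)⁻¹ * ∫ y, (‖x - y‖ ^ 2)⁻¹ * f y) = 1 / π ^ 2 * ∫ y, (‖x - y‖ ^ 2)⁻¹ * f y := by
    have := pi_pos
    field_simp
  linarith

lemma fderiv_radial {G : ℝ → ℝ} {g : ℝ} {a x : E3} (hG : HasDerivAt G g (‖x - a‖ ^ 2)) :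
    HasFDerivAt (fun y : E3 => G (‖y - a‖ ^ 2)) (g • (2 • innerSL ℝ (x - a))) x := by
  have h : HasFDerivAt (fun y : E3 => ‖y - a‖ ^ 2) (2 • innerSL ℝ (x - a)) x := by
    have := ((hasFDerivAt_id (𝕜 := ℝ) x).sub_const a).norm_sq
    simpa using this
  exact hG.comp_hasFDerivAt x h

/-- The Laplacian of a radial function. -/
lemma lap_radial {G G1 G2 : ℝ → ℝ} (h1 : ∀ s, 0 ≤ s → HasDerivAt G (G1 s) s)
    (h2 : ∀ s, 0 ≤ s → HasDerivAt G1 (G2 s) s) (a x : E3) :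
    lap (fun y => G (‖y - a‖ ^ 2)) x =
      6 * G1 (‖x - a‖ ^ 2) + 4 * ‖x - a‖ ^ 2 * G2 (‖x - a‖ ^ 2) := by
  have hin : ∀ (z : E3) (i : Fin 3), innerSL ℝ z (EuclideanSpace.single i (1:ℝ)) = z i := by
    intro z i
    simp [innerSL_apply_apply, EuclideanSpace.inner_single_right]
  have e1 : ∀ (i : Fin 3) (y : E3),
      fderiv ℝ (fun y => G (‖y - a‖ ^ 2)) y (EuclideanSpace.single i 1) =
        G1 (‖y - a‖ ^ 2) * (2 * innerSL ℝ (EuclideanSpace.single i (1:ℝ)) (y - a)) := by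
    intro i y
    rw [(fderiv_radial (h1 _ (by positivity))).fderiv]
    simp only [_root_.smul_apply, hin, smul_eq_mul, nsmul_eq_mul]
    simp [innerSL_apply_apply, EuclideanSpace.inner_single_left]
  have e2 : ∀ i : Fin 3, fderiv ℝ (fun y => fderiv ℝ (fun y => G (‖y - a‖ ^ 2)) y
      (EuclideanSpace.single i 1)) x (EuclideanSpace.single i 1) =
        2 * G1 (‖x - a‖ ^ 2) + 4 * G2 (‖x - a‖ ^ 2) * ((x - a) i) ^ 2 := by
    intro i
    simp only [e1]
    have d1 := fderiv_radial (a := a) (x := x) (h2 _ (by positivity))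
    have d2 : HasFDerivAt (fun y : E3 => 2 * innerSL ℝ (EuclideanSpace.single i (1:ℝ)) (y - a))
        ((2:ℝ) • innerSL ℝ (EuclideanSpace.single i (1:ℝ))) x :=
      (((innerSL ℝ (EuclideanSpace.single i (1:ℝ))).hasFDerivAt.comp x
        ((hasFDerivAt_id x).sub_const a)).const_mul 2)
    rw [(d1.fun_mul d2).fderiv]
    simp only [_root_.add_apply, _root_.smul_apply, hin, smul_eq_mul,
      nsmul_eq_mul]
    simp [innerSL_apply_apply, EuclideanSpace.inner_single_left]
    ring
  rw [lap, Finset.sum_congr rfl fun i _ => e2 i, Finset.sum_add_distrib, ← Finset.mul_sum,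
    ← Finset.mul_sum, ← EuclideanSpace.real_norm_sq_eq]
  simp
  ring

lemma contDiff_fderiv_apply {g : E3 → ℝ} (hg : ContDiff ℝ (⊤ : ℕ∞) g) (h : E3) :
    ContDiff ℝ (⊤ : ℕ∞) fun x => fderiv ℝ g x h :=
  (hg.fderiv_right (by simp)).clm_apply contDiff_const

lemma continuous_lap {g : E3 → ℝ} (hg : ContDiff ℝ (⊤ : ℕ∞) g) : Continuous (lap g) := by
  unfold lap
  refine continuous_finsetSum _ fun i _ => ?_
  exact (contDiff_fderiv_apply (contDiff_fderiv_apply hg _) _).continuous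

lemma hasCompactSupport_lap {g : E3 → ℝ} (hg : HasCompactSupport g) : HasCompactSupport (lap g) := by
  have h : ∀ i : Fin 3, HasCompactSupport fun x => fderiv ℝ (fun y => fderiv ℝ g y
      (EuclideanSpace.single i 1)) x (EuclideanSpace.single i 1) := fun i =>
    (hg.fderiv_apply ℝ _).fderiv_apply ℝ _
  have e : lap g = fun x => _ := funext fun x => Fin.sum_univ_three _
  rw [e]
  exact ((h 0).add (h 1)).add (h 2)

/-- Green's identity for a test function. -/
lemma integral_mul_lap {g χ : E3 → ℝ} (hg : ContDiff ℝ (⊤ : ℕ∞) g) (hχ : ContDiff ℝ (⊤ : ℕ∞) χ)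
    (hs : HasCompactSupport χ) : ∫ x, g x * lap χ x = ∫ x, lap g x * χ x := by
  have key : ∀ {p q : E3 → ℝ} (e : E3), ContDiff ℝ (⊤ : ℕ∞) p → ContDiff ℝ (⊤ : ℕ∞) q →
      HasCompactSupport q → ∫ x, p x * fderiv ℝ q x e = -∫ x, fderiv ℝ p x e * q x := by
    intro p q e hp hq hs
    refine integral_mul_fderiv_eq_neg_fderiv_mul_of_integrable ?_ ?_ ?_
      (fun x _ => hp.differentiable (by simp) x) (fun x _ => hq.differentiable (by simp) x)
    · exact ((contDiff_fderiv_apply hp e).continuous.mul hq.continuous).integrable_of_hasCompactSupport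
        hs.mul_left
    · exact (hp.continuous.mul (contDiff_fderiv_apply hq e).continuous).integrable_of_hasCompactSupport
        (hs.fderiv_apply ℝ e).mul_left
    · exact (hp.continuous.mul hq.continuous).integrable_of_hasCompactSupport hs.mul_left
  simp only [lap, Finset.mul_sum, Finset.sum_mul]
  rw [integral_finsetSum, integral_finsetSum]
  · refine Finset.sum_congr rfl fun i _ => ?_
    rw [key _ hg (contDiff_fderiv_apply hχ _) (hs.fderiv_apply ℝ _),
      key _ (contDiff_fderiv_apply hg _) hχ hs, neg_neg]
  · intro i _
    exact ((contDiff_fderiv_apply (contDiff_fderiv_apply hg _) _).continuous.mul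
      hχ.continuous).integrable_of_hasCompactSupport hs.mul_left
  · intro i _
    exact (hg.continuous.mul (contDiff_fderiv_apply (contDiff_fderiv_apply hχ _)
      _).continuous).integrable_of_hasCompactSupport ((hs.fderiv_apply ℝ _).fderiv_apply ℝ _).mul_left

lemma riesz_prod_integrable {h f : E3 → ℝ} (hh : Continuous h) (hs : HasCompactSupport h)
    (hf : Integrable f) (hfc : Continuous f) {k : ℕ} (hk : k ≤ 2) :
    Integrable (Function.uncurry fun x y : E3 => (‖x - y‖ ^ k)⁻¹ * h x * f y)
      ((volume : Measure E3).prod volume) := by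
  obtain ⟨M, hM⟩ := hh.bounded_above_of_compact_support hs
  have hhi := hh.integrable_of_hasCompactSupport hs (μ := volume)
  have hm : Measurable (Function.uncurry fun x y : E3 => (‖x - y‖ ^ k)⁻¹ * h x * f y) := by
    have := hh.measurable
    have := hfc.measurable
    simp only [Function.uncurry_def]
    fun_prop
  rw [integrable_prod_iff' hm.aestronglyMeasurable]
  have e : ∀ y : E3, ∫ x, ‖(Function.uncurry fun x y : E3 => (‖x - y‖ ^ k)⁻¹ * h x * f y) (x, y)‖ =
      (∫ x, (‖y - x‖ ^ k)⁻¹ * |h x|) * |f y| := by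
    intro y
    rw [← integral_mul_const]
    refine integral_congr_ae (ae_of_all _ fun x => ?_)
    simp only [Function.uncurry_apply_pair]
    rw [norm_mul, norm_mul, norm_of_nonneg (by positivity), norm_sub_rev, norm_eq_abs, norm_eq_abs]
  refine ⟨ae_of_all _ fun y => ?_, ?_⟩
  · have := (riesz_integrable hh hhi hk y).mul_const (f y)
    refine this.congr (ae_of_all _ fun x => ?_)
    simp only [Function.uncurry_apply_pair, norm_sub_rev y]
  · refine (hf.abs.const_mul (M * (∫ z in Metric.ball (0 : E3) 1, (‖z‖ ^ k)⁻¹)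
      + ((1:ℝ) ^ k)⁻¹ * ∫ y, |h y|)).mono' ?_ (ae_of_all _ fun y => ?_)
    · exact hm.aestronglyMeasurable.prod_swap.norm.integral_prod_right'
    · rw [e, norm_mul, norm_of_nonneg (integral_nonneg fun x => by positivity), norm_of_nonneg (abs_nonneg _)]
      gcongr
      exact riesz_le_of_bound hhi hk one_pos fun z _ => hM z

lemma hasDerivAt_neg_half_log {δ : ℝ} (hδ : 0 < δ) (s : ℝ) (hs : 0 ≤ s) :
    HasDerivAt (fun s => -(1 / 2) * log (s + δ)) (-(1 / 2) * (s + δ)⁻¹) s := by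
  have : s + δ ≠ 0 := by positivity
  have h := (((hasDerivAt_id' s).add_const δ).log this).const_mul (-(1 / 2))
  refine h.congr_deriv ?_
  simp

lemma hasDerivAt_neg_half_inv {δ : ℝ} (hδ : 0 < δ) (s : ℝ) (hs : 0 ≤ s) :
    HasDerivAt (fun s => -(1 / 2) * (s + δ)⁻¹) (1 / 2 * ((s + δ) ^ 2)⁻¹) s := by
  have : s + δ ≠ 0 := by positivity
  have h := (((hasDerivAt_id' s).add_const δ).inv this).const_mul (-(1 / 2))
  refine h.congr_deriv ?_
  field_simp

/-- `-log |·|` has distributional Laplacian `-|·|⁻²`. -/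
lemma integral_log_mul_lap {χ : E3 → ℝ} (hχ : ContDiff ℝ (⊤ : ℕ∞) χ) (hs : HasCompactSupport χ)
    (y : E3) : ∫ x, -log ‖x - y‖ * lap χ x = -∫ x, (‖y - x‖ ^ 2)⁻¹ * χ x := by
  have hlc := continuous_lap hχ
  have hls := hasCompactSupport_lap hs
  have hli : Integrable (lap χ) := hlc.integrable_of_hasCompactSupport hls
  have hχi : Integrable χ := hχ.continuous.integrable_of_hasCompactSupport hs
  have green : ∀ δ : ℝ, 0 < δ → ∫ x, -(1 / 2) * log (‖x - y‖ ^ 2 + δ) * lap χ x =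
      ∫ x, -((‖x - y‖ ^ 2 + 3 * δ) * ((‖x - y‖ ^ 2 + δ) ^ 2)⁻¹) * χ x := by
    intro δ hδ
    have hsm : ContDiff ℝ (⊤ : ℕ∞) fun x : E3 => -(1 / 2) * log (‖x - y‖ ^ 2 + δ) := by
      refine contDiff_const.mul (ContDiff.log ?_ fun x => by positivity)
      exact ((contDiff_id.sub contDiff_const).norm_sq ℝ).add contDiff_const
    rw [integral_mul_lap hsm hχ hs]
    refine integral_congr_ae (ae_of_all _ fun x => ?_)
    simp only
    rw [lap_radial (G := fun s => -(1 / 2) * log (s + δ)) (hasDerivAt_neg_half_log hδ)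
      (hasDerivAt_neg_half_inv hδ)]
    have : ‖x - y‖ ^ 2 + δ ≠ 0 := by positivity
    field_simp
    ring
  have l1 : Tendsto (fun δ : ℝ => ∫ x, -(1 / 2) * log (‖x - y‖ ^ 2 + δ) * lap χ x) (𝓝[>] 0)
      (𝓝 (∫ x, -log ‖x - y‖ * lap χ x)) := by
    refine tendsto_integral_filter_of_dominated_convergence
      (fun x => (‖x - y‖ ^ 2 + 1) * |lap χ x| + (‖y - x‖ ^ 2)⁻¹ * |lap χ x|) ?_ ?_ ?_ ?_
    · exact Eventually.of_forall fun δ => (Measurable.aestronglyMeasurable (by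
        have := hlc.measurable
        fun_prop))
    · filter_upwards [Ioo_mem_nhdsGT one_pos] with δ hδ
      filter_upwards [ae_ne y] with x hx
      have n0 := norm_pos_iff.2 (sub_ne_zero.2 hx)
      rw [norm_mul, ← add_mul, norm_eq_abs, norm_eq_abs, norm_sub_rev y x]
      gcongr
      rw [abs_mul, show |-(1 / 2 : ℝ)| = 1 / 2 by norm_num [abs_of_neg]]
      have hp : 0 < ‖x - y‖ ^ 2 + δ := by have := hδ.1; positivity
      have h1 := log_le_self hp.le
      have h2 := one_sub_inv_le_log_of_pos hp
      have h3 : (‖x - y‖ ^ 2 + δ)⁻¹ ≤ (‖x - y‖ ^ 2)⁻¹ := by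
        gcongr; linarith [hδ.1]
      have h4 : 0 < (‖x - y‖ ^ 2)⁻¹ := by positivity
      have h5 : |log (‖x - y‖ ^ 2 + δ)| ≤ ‖x - y‖ ^ 2 + 1 + (‖x - y‖ ^ 2)⁻¹ := by
        rw [abs_le]
        constructor <;> nlinarith [hδ.1, hδ.2, sq_nonneg ‖x - y‖]
      have := abs_nonneg (log (‖x - y‖ ^ 2 + δ))
      linarith
    · have i1 : Integrable fun x => (‖x - y‖ ^ 2 + 1) * |lap χ x| :=
        (by fun_prop : Continuous fun x => (‖x - y‖ ^ 2 + 1) * |lap χ x|).integrable_of_hasCompactSupport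
          (hls.abs.mul_left)
      exact i1.add (riesz_integrable hlc.abs hli.abs le_rfl y)
    · filter_upwards [ae_ne y] with x hx
      have n0 := norm_pos_iff.2 (sub_ne_zero.2 hx)
      have h1 : Tendsto (fun δ : ℝ => ‖x - y‖ ^ 2 + δ) (𝓝[>] 0) (𝓝 (‖x - y‖ ^ 2)) := by
        have : Tendsto (fun δ : ℝ => ‖x - y‖ ^ 2 + δ) (𝓝 0) (𝓝 (‖x - y‖ ^ 2 + 0)) :=
          tendsto_const_nhds.add tendsto_id
        rw [add_zero] at this
        exact this.mono_left nhdsWithin_le_nhds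
      have h2 := ((h1.log (by positivity)).const_mul (-(1 / 2))).mul_const (lap χ x)
      rw [log_pow] at h2
      refine h2.trans (le_of_eq ?_)
      congr 1
      push_cast
      ring
  have l2 : Tendsto (fun δ : ℝ => ∫ x, -((‖x - y‖ ^ 2 + 3 * δ) * ((‖x - y‖ ^ 2 + δ) ^ 2)⁻¹) * χ x)
      (𝓝[>] 0) (𝓝 (∫ x, -((‖y - x‖ ^ 2)⁻¹ * χ x))) := by
    refine tendsto_integral_filter_of_dominated_convergence
      (fun x => 3 * ((‖y - x‖ ^ 2)⁻¹ * |χ x|)) ?_ ?_ ?_ ?_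
    · exact Eventually.of_forall fun δ => (Measurable.aestronglyMeasurable (by
        have := hχ.continuous.measurable
        fun_prop))
    · filter_upwards [self_mem_nhdsWithin] with δ hδ
      have hδ' : 0 < δ := hδ
      filter_upwards [ae_ne y] with x hx
      have n0 := norm_pos_iff.2 (sub_ne_zero.2 hx)
      rw [norm_mul, norm_neg, norm_of_nonneg (by positivity), ← mul_assoc, norm_eq_abs, norm_sub_rev y x]
      refine mul_le_mul_of_nonneg_right ?_ (abs_nonneg _)
      rw [← div_eq_mul_inv, ← div_eq_mul_inv, div_le_div_iff₀ (by positivity) (by positivity)]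
      nlinarith [sq_nonneg ‖x - y‖, mul_pos hδ' (pow_pos n0 2)]
    · exact (riesz_integrable hχ.continuous.abs hχi.abs le_rfl y).const_mul 3
    · filter_upwards [ae_ne y] with x hx
      have n0 := norm_pos_iff.2 (sub_ne_zero.2 hx)
      have hc : ContinuousAt (fun δ : ℝ => -((‖x - y‖ ^ 2 + 3 * δ) * ((‖x - y‖ ^ 2 + δ) ^ 2)⁻¹) * χ x) 0 := by
        have : (‖x - y‖ ^ 2 + 0) ^ 2 ≠ 0 := by positivity
        fun_prop (disch := assumption)
      have := hc.tendsto.mono_left (nhdsWithin_le_nhds (s := Set.Ioi 0))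
      refine this.trans (le_of_eq ?_)
      congr 1
      rw [norm_sub_rev y x]
      field_simp
      ring
  rw [integral_neg] at l2
  refine tendsto_nhds_unique_of_eventuallyEq l1 l2 ?_
  filter_upwards [self_mem_nhdsWithin] with δ hδ using green δ hδ

lemma integral_lap_eq_zero {χ : E3 → ℝ} (hχ : ContDiff ℝ (⊤ : ℕ∞) χ) (hs : HasCompactSupport χ) :
    ∫ x, lap χ x = 0 := by
  have h := integral_mul_lap (g := fun _ => 1) contDiff_const hχ hs
  have e : ∀ x : E3, lap (fun _ : E3 => (1:ℝ)) x = 0 := fun x => by simp [lap]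
  simpa [e] using h

/-- The logarithmic potential is the potential of the Riesz potential of order one. -/
lemma integral_logPot_mul_lap {f χ : E3 → ℝ} (hc : Continuous f) (hi : Integrable f)
    (hχ : ContDiff ℝ (⊤ : ℕ∞) χ) (hs : HasCompactSupport χ) :
    ∫ x, logPot f x * lap χ x = -∫ x, (∫ y, (‖x - y‖ ^ 2)⁻¹ * f y) * χ x := by
  have hlc := continuous_lap hχ
  have hls := hasCompactSupport_lap hs
  have hli : Integrable (lap χ) := hlc.integrable_of_hasCompactSupport hls
  have hχc := hχ.continuous
  have hn : Continuous fun x : E3 => ‖x‖ * lap χ x := by fun_prop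
  have hnl : HasCompactSupport fun x : E3 => ‖x‖ * lap χ x := hls.mul_left
  have hprod : Integrable (Function.uncurry fun x y : E3 => log (‖y‖ / ‖x - y‖) * f y * lap χ x)
      ((volume : Measure E3).prod volume) := by
    have m1 := ((hn.integrable_of_hasCompactSupport hnl (μ := volume)).mul_prod
      (riesz_zero_integrable hc hi)).norm
    have m2 := (riesz_prod_integrable hn hnl hi hc (k := 1) (by norm_num)).norm
    refine (m1.add m2).mono' ?_ (ae_of_all _ fun q => ?_)
    · refine Measurable.aestronglyMeasurable ?_
      have := hc.measurable
      have := hlc.measurable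
      simp only [Function.uncurry_def]
      fun_prop
    · simp only [Function.uncurry_def, Pi.add_apply, norm_mul, pow_one, norm_inv, norm_norm]
      have := abs_log_ratio_le q.1 q.2
      calc _ ≤ ‖q.1‖ * (‖q.2‖⁻¹ + ‖q.1 - q.2‖⁻¹) * ‖f q.2‖ * ‖lap χ q.1‖ := by
            gcongr; exact this
        _ = _ := by ring
  have hprod2 := riesz_prod_integrable hχc hs hi hc (k := 2) le_rfl
  have e1 : ∫ x, logPot f x * lap χ x = ∫ x, ∫ y, log (‖y‖ / ‖x - y‖) * f y * lap χ x := by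
    simp only [integral_mul_const]; rfl
  have e2 : ∫ x, (∫ y, (‖x - y‖ ^ 2)⁻¹ * f y) * χ x = ∫ x, ∫ y, (‖x - y‖ ^ 2)⁻¹ * χ x * f y := by
    refine integral_congr_ae (ae_of_all _ fun x => ?_)
    simp only
    rw [← integral_mul_const]
    refine integral_congr_ae (ae_of_all _ fun y => ?_)
    simp only
    ring
  rw [e1, e2, integral_integral_swap hprod, integral_integral_swap hprod2, ← integral_neg]
  refine integral_congr_ae ?_
  filter_upwards [ae_ne 0] with y hy
  have n0 := norm_pos_iff.2 hy
  rw [integral_mul_const, ← neg_mul]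
  have key := integral_log_mul_lap hχ hs y
  simp only [norm_sub_rev y] at key
  rw [← key, ← integral_mul_const]
  have i1 : Integrable fun x => log ‖y‖ * f y * lap χ x := hli.const_mul _
  have z1 : ∫ x, log ‖y‖ * f y * lap χ x = 0 := by
    rw [integral_const_mul, integral_lap_eq_zero hχ hs, mul_zero]
  have i2 : Integrable fun x => -log ‖x - y‖ * lap χ x * f y := by
    by_cases hk : f y = 0
    · simp [hk]
    refine Integrable.mul_const ?_ _
    have r1 := riesz_integrable hlc hli (k := 1) (by norm_num) y
    have r2 : Integrable fun x => ‖x - y‖ * lap χ x :=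
      (by fun_prop : Continuous fun x => ‖x - y‖ * lap χ x).integrable_of_hasCompactSupport hls.mul_left
    refine (r1.norm.add r2.norm).mono' (Measurable.aestronglyMeasurable (by
      have := hlc.measurable
      fun_prop)) ?_
    filter_upwards [ae_ne y] with x hx
    have n1 := norm_pos_iff.2 (sub_ne_zero.2 hx)
    simp only [Pi.add_apply, norm_mul, norm_neg, pow_one, norm_inv, norm_norm]
    rw [← add_mul, norm_sub_rev y x]
    gcongr
    rw [norm_eq_abs, abs_le]
    have h1 := log_le_self n1.le
    have h2 := one_sub_inv_le_log_of_pos n1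
    have : 0 < ‖x - y‖⁻¹ := by positivity
    constructor <;> linarith
  have hsum := integral_add i1 i2
  rw [z1, zero_add] at hsum
  rw [← hsum]
  refine integral_congr_ae ?_
  filter_upwards [ae_ne y] with x hx
  have n1 := norm_pos_iff.2 (sub_ne_zero.2 hx)
  rw [log_div n0.ne' n1.ne']
  ring

/-- The difference of a solution and its logarithmic potential has constant Laplacian. -/
lemma integral_sub_logPot_mul_lap {u f χ : E3 → ℝ} (hu : ContDiff ℝ (⊤ : ℕ∞) u) (hc : Continuous f)
    (hi : Integrable f) {c : ℝ}
    (h : ∀ x, -lap u x = (1 / π ^ 2) * (∫ y, (‖x - y‖ ^ 2)⁻¹ * f y) + c)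
    (hχ : ContDiff ℝ (⊤ : ℕ∞) χ) (hs : HasCompactSupport χ) :
    ∫ x, (u x - (1 / π ^ 2) * logPot f x) * lap χ x = -c * ∫ x, χ x := by
  have hlc := continuous_lap hχ
  have hls := hasCompactSupport_lap hs
  have hχc := hχ.continuous
  have hχi : Integrable χ := hχc.integrable_of_hasCompactSupport hs
  have huc := hu.continuous
  have hL := continuous_logPot hc hi
  have hlu := continuous_lap hu
  have i1 : Integrable fun x => u x * lap χ x :=
    (by fun_prop : Continuous fun x => u x * lap χ x).integrable_of_hasCompactSupport hls.mul_left
  have i2 : Integrable fun x => logPot f x * lap χ x :=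
    (by fun_prop : Continuous fun x => logPot f x * lap χ x).integrable_of_hasCompactSupport hls.mul_left
  have i3 : Integrable fun x => lap u x * χ x :=
    (by fun_prop : Continuous fun x => lap u x * χ x).integrable_of_hasCompactSupport hs.mul_left
  have i3' : Integrable fun x => -(lap u x * χ x) := i3.neg
  have e : (fun x => (u x - (1 / π ^ 2) * logPot f x) * lap χ x) =
      fun x => u x * lap χ x - (1 / π ^ 2) * (logPot f x * lap χ x) := by
    funext x; ring
  have e2 : (fun x => (1 / π ^ 2) * ((∫ y, (‖x - y‖ ^ 2)⁻¹ * f y) * χ x)) =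
      fun x => -(lap u x * χ x) - c * χ x := by
    funext x
    linear_combination (-(χ x)) * h x
  rw [e, integral_sub i1 (i2.const_mul _), integral_const_mul, integral_logPot_mul_lap hc hi hχ hs,
    integral_mul_lap hu hχ hs, mul_neg, ← integral_const_mul (1 / π ^ 2), e2,
    integral_sub i3' (hχi.const_mul c), integral_neg, integral_const_mul]
  ring

lemma deriv_smoothTransition_eq_zero {r : ℝ} (h : r < 0) : deriv smoothTransition r = 0 := by
  have : smoothTransition =ᶠ[𝓝 r] fun _ => 0 := by
    filter_upwards [Iio_mem_nhds h] with x hx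
    exact smoothTransition.zero_of_nonpos (le_of_lt hx)
  rw [this.deriv_eq]; simp

lemma hasDerivAt_smoothTransition_two_sub (s : ℝ) :
    HasDerivAt (fun s => smoothTransition (2 - s)) (-deriv smoothTransition (2 - s)) s := by
  have h := (smoothTransition.contDiff (n := 1)).differentiable one_ne_zero (2 - s)
  exact (h.hasDerivAt.comp s ((hasDerivAt_id' s).const_sub 2)).congr_deriv (by simp)

/-- A compactly supported primitive of `bump` as a function of the squared radius. -/
noncomputable def bumpPrim (s : ℝ) : ℝ := ∫ r in (2:ℝ)..s, smoothTransition (2 - r) / 2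

lemma hasDerivAt_bumpPrim (s : ℝ) : HasDerivAt bumpPrim (smoothTransition (2 - s) / 2) s := by
  have hc : Continuous fun r : ℝ => smoothTransition (2 - r) / 2 :=
    (smoothTransition.continuous.comp (by fun_prop)).div_const 2
  exact intervalIntegral.integral_hasDerivAt_right (hc.intervalIntegrable _ _)
    (hc.stronglyMeasurableAtFilter _ _) hc.continuousAt

lemma contDiff_bumpPrim : ContDiff ℝ (⊤ : ℕ∞) bumpPrim := by
  rw [contDiff_infty_iff_deriv]
  refine ⟨fun s => (hasDerivAt_bumpPrim s).differentiableAt, ?_⟩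
  rw [show deriv bumpPrim = fun s => smoothTransition (2 - s) / 2 from
    funext fun s => (hasDerivAt_bumpPrim s).deriv]
  exact (smoothTransition.contDiff.comp (contDiff_const.sub contDiff_id)).div_const 2

lemma bumpPrim_eq_zero {s : ℝ} (hs : 2 ≤ s) : bumpPrim s = 0 := by
  rw [bumpPrim, intervalIntegral.integral_of_le hs]
  rw [setIntegral_congr_fun (g := fun _ => 0) measurableSet_Ioc fun r hr => by
    simp [smoothTransition.zero_of_nonpos (show 2 - r ≤ 0 by linarith [hr.1])]]
  simp

/-- The Laplacian of `bumpPrim (|z|²)`. -/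
noncomputable def bumpLap (z : E3) : ℝ :=
  3 * smoothTransition (2 - ‖z‖ ^ 2) - 2 * ‖z‖ ^ 2 * deriv smoothTransition (2 - ‖z‖ ^ 2)

lemma continuous_bumpLap : Continuous bumpLap := by
  have h1 := smoothTransition.continuous
  have h2 := contDiff_deriv_smoothTransition.continuous
  unfold bumpLap
  fun_prop

lemma bumpLap_eq_zero {z : E3} (h : 2 < ‖z‖) : bumpLap z = 0 := by
  rw [bumpLap, smoothTransition.zero_of_nonpos (by nlinarith),
    deriv_smoothTransition_eq_zero (by nlinarith)]
  simp

lemma hasCompactSupport_bumpLap : HasCompactSupport bumpLap :=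
  hasCompactSupport_of_eq_zero (r := 2) fun _ h => bumpLap_eq_zero h

lemma lap_bumpPrim {t : ℝ} (ht : 0 < t) (a x : E3) :
    lap (fun y => bumpPrim ((t ^ 2)⁻¹ * ‖y - a‖ ^ 2)) x = (t ^ 2)⁻¹ * bumpLap (t⁻¹ • (x - a)) := by
  have h1 : ∀ s, 0 ≤ s → HasDerivAt (fun s => bumpPrim ((t ^ 2)⁻¹ * s))
      ((t ^ 2)⁻¹ * (smoothTransition (2 - (t ^ 2)⁻¹ * s) / 2)) s := fun s _ => by
    refine ((hasDerivAt_bumpPrim _).comp s ((hasDerivAt_id' s).const_mul _)).congr_deriv ?_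
    ring
  have h2 : ∀ s, 0 ≤ s → HasDerivAt (fun s => (t ^ 2)⁻¹ * (smoothTransition (2 - (t ^ 2)⁻¹ * s) / 2))
      (-((t ^ 2)⁻¹ ^ 2 * (deriv smoothTransition (2 - (t ^ 2)⁻¹ * s) / 2))) s := fun s _ => by
    refine ((((hasDerivAt_smoothTransition_two_sub _).comp s
      ((hasDerivAt_id' s).const_mul _)).div_const 2).const_mul _).congr_deriv ?_
    ring
  rw [lap_radial (G := fun s => bumpPrim ((t ^ 2)⁻¹ * s)) h1 h2, bumpLap, norm_smul, mul_pow,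
    norm_of_nonneg (by positivity : 0 ≤ t⁻¹), inv_pow]
  ring_nf

lemma hasDerivAt_bump_dilate (z : E3) {t : ℝ} (ht : 0 < t) :
    HasDerivAt (fun t : ℝ => (t ^ 3)⁻¹ * bump (t⁻¹ • z)) (-((t ^ 4)⁻¹ * bumpLap (t⁻¹ • z))) t := by
  have h1 : HasDerivAt (fun t : ℝ => (t⁻¹) ^ 2 * ‖z‖ ^ 2) (-(2 * (t ^ 3)⁻¹ * ‖z‖ ^ 2)) t := by
    refine (((hasDerivAt_inv ht.ne').fun_pow 2).mul_const (‖z‖ ^ 2)).congr_deriv ?_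
    rw [show (2 - 1 : ℕ) = 1 from rfl, pow_one]
    push_cast
    field_simp
  have h2 : HasDerivAt (fun t : ℝ => (t ^ 3)⁻¹) (-(3 * (t ^ 4)⁻¹)) t := by
    refine ((hasDerivAt_pow 3 t).fun_inv (by positivity)).congr_deriv ?_
    rw [show (3 - 1 : ℕ) = 2 from rfl]
    push_cast
    field_simp
  have h3 := h2.fun_mul ((hasDerivAt_smoothTransition_two_sub _).comp t h1)
  refine (h3.congr_of_eventuallyEq ?_).congr_deriv ?_
  · filter_upwards [eventually_gt_nhds ht] with s hs
    simp only [Function.comp_apply]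
    rw [bump, norm_smul, mul_pow, norm_of_nonneg (by positivity : 0 ≤ s⁻¹)]
  · simp only [Function.comp_apply]
    rw [bumpLap, norm_smul, mul_pow, norm_of_nonneg (by positivity : 0 ≤ t⁻¹)]
    field_simp
    ring

lemma integral_dilate (g : E3 → ℝ) {t : ℝ} (ht : 0 < t) (a : E3) :
    ∫ y, g (t⁻¹ • (y - a)) = t ^ 3 * ∫ z, g z := by
  rw [integral_sub_right_eq_self (fun y => g (t⁻¹ • y)) a,
    Measure.integral_comp_smul, finrank_E3, inv_pow, inv_inv, abs_of_pos (by positivity), smul_eq_mul]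

lemma integral_bump_pos : 0 < ∫ z, bump z := by
  rw [integral_pos_iff_support_of_nonneg bump_nonneg
    (contDiff_bump.continuous.integrable_of_hasCompactSupport hasCompactSupport_bump)]
  refine lt_of_lt_of_le (Metric.measure_ball_pos volume (0:E3) one_pos) (measure_mono fun z hz => ?_)
  have : ‖z‖ < 1 := by simpa using hz
  rw [Function.mem_support, bump_eq_one this.le]
  exact one_ne_zero

/-- Mean value formula for continuous functions whose distributional Laplacian is constant. -/
lemma mean_value {p : E3 → ℝ} (hp : Continuous p) {c : ℝ}
    (h : ∀ χ : E3 → ℝ, ContDiff ℝ (⊤ : ℕ∞) χ → HasCompactSupport χ →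
      ∫ x, p x * lap χ x = -c * ∫ x, χ x) :
    ∃ c₁ : ℝ, ∀ (a : E3) (t : ℝ), 0 < t → ∫ y, p y * bump (t⁻¹ • (y - a)) =
      t ^ 3 * ((∫ z, bump z) * p a + c₁ * t ^ 2) := by
  set κ := ∫ z : E3, bumpPrim (‖z‖ ^ 2) with hκ
  obtain ⟨B, hB⟩ := continuous_bumpLap.bounded_above_of_compact_support hasCompactSupport_bumpLap
  have hB0 : 0 ≤ B := (norm_nonneg _).trans (hB 0)
  refine ⟨c * κ / 2, fun a => ?_⟩
  have hbc := contDiff_bump.continuous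
  have pair : ∀ t : ℝ, 0 < t → ∫ y, p y * ((t ^ 4)⁻¹ * bumpLap (t⁻¹ • (y - a))) = -(c * κ * t) := by
    intro t ht
    have hsm : ContDiff ℝ (⊤ : ℕ∞) fun y : E3 => bumpPrim ((t ^ 2)⁻¹ * ‖y - a‖ ^ 2) :=
      contDiff_bumpPrim.comp (contDiff_const.mul ((contDiff_id.sub contDiff_const).norm_sq ℝ))
    have hs : HasCompactSupport fun y : E3 => bumpPrim ((t ^ 2)⁻¹ * ‖y - a‖ ^ 2) := by
      refine hasCompactSupport_of_eq_zero (r := ‖a‖ + 2 * t) fun y hy => bumpPrim_eq_zero ?_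
      have h1 : 2 * t < ‖y - a‖ := by linarith [norm_sub_norm_le y a]
      rw [inv_mul_eq_div, le_div_iff₀ (by positivity)]
      nlinarith
    have key := h _ hsm hs
    simp only [lap_bumpPrim ht] at key
    have e := integral_dilate (fun z => bumpPrim (‖z‖ ^ 2)) ht a
    simp only [norm_smul, mul_pow, norm_of_nonneg (by positivity : 0 ≤ t⁻¹), inv_pow] at e
    rw [e, ← hκ] at key
    calc _ = ∫ y, (t ^ 2)⁻¹ * (p y * ((t ^ 2)⁻¹ * bumpLap (t⁻¹ • (y - a)))) := by
          refine integral_congr_ae (ae_of_all _ fun y => ?_)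
          simp only
          field_simp
      _ = _ := by
          rw [integral_const_mul, key]
          field_simp
  have deriv : ∀ t : ℝ, 0 < t →
      HasDerivAt (fun t : ℝ => ∫ y, p y * ((t ^ 3)⁻¹ * bump (t⁻¹ • (y - a)))) (c * κ * t) t := by
    intro t ht
    obtain ⟨M, hM0, hM⟩ := exists_bound_ball hp a (4 * t)
    have hd := hasDerivAt_integral_of_dominated_loc_of_deriv_le (μ := volume) (x₀ := t)
      (F := fun (t : ℝ) y => p y * ((t ^ 3)⁻¹ * bump (t⁻¹ • (y - a))))
      (F' := fun (t : ℝ) y => p y * -((t ^ 4)⁻¹ * bumpLap (t⁻¹ • (y - a))))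
      (bound := (Metric.ball a (4 * t)).indicator fun _ => M * (((t / 2) ^ 4)⁻¹ * B))
      (s := Set.Ioo (t / 2) (2 * t)) (Ioo_mem_nhds (by linarith) (by linarith)) ?_ ?_ ?_ ?_ ?_ ?_
    · refine hd.2.congr_deriv ?_
      simp only [mul_neg, integral_neg]
      rw [pair t ht, neg_neg]
    · exact Eventually.of_forall fun s => Continuous.aestronglyMeasurable (by fun_prop)
    · refine (by fun_prop : Continuous fun y => p y * ((t ^ 3)⁻¹ * bump (t⁻¹ • (y - a))))
        |>.integrable_of_hasCompactSupport ?_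
      refine hasCompactSupport_of_eq_zero (r := ‖a‖ + 2 * t) fun y hy => ?_
      have h1 : 2 * t < ‖y - a‖ := by linarith [norm_sub_norm_le y a]
      rw [bump_eq_zero, mul_zero, mul_zero]
      rw [norm_smul, norm_of_nonneg (by positivity), inv_mul_eq_div, le_div_iff₀ ht]
      exact h1.le
    · have := continuous_bumpLap
      exact Continuous.aestronglyMeasurable (by fun_prop)
    · refine ae_of_all _ fun y s hs => ?_
      have hs0 : 0 < s := by linarith [hs.1]
      by_cases hy : y ∈ Metric.ball a (4 * t)
      · rw [Set.indicator_of_mem hy, norm_mul, norm_neg, norm_mul,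
          norm_of_nonneg (by positivity : 0 ≤ (s ^ 4)⁻¹)]
        gcongr
        · exact hM y hy
        · exact hs.1.le
        · exact hB _
      · rw [Set.indicator_of_notMem hy, bumpLap_eq_zero, mul_zero, neg_zero, mul_zero, norm_zero]
        have hy' : 4 * t ≤ ‖y - a‖ := by
          rw [← dist_eq_norm]; exact not_lt.1 hy
        rw [norm_smul, norm_of_nonneg (by positivity), inv_mul_eq_div, lt_div_iff₀ hs0]
        linarith [hs.2]
    · exact (integrable_indicator_iff measurableSet_ball).2
        (integrableOn_const (measure_ball_lt_top.ne))
    · refine ae_of_all _ fun y s hs => ?_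
      have hs0 : 0 < s := by linarith [hs.1]
      exact (hasDerivAt_bump_dilate (y - a) hs0).const_mul (p y)
  have lim0 : Tendsto (fun t : ℝ => ∫ y, p y * ((t ^ 3)⁻¹ * bump (t⁻¹ • (y - a)))) (𝓝[>] 0)
      (𝓝 ((∫ z, bump z) * p a)) := by
    obtain ⟨M, hM0, hM⟩ := exists_bound_ball hp a 3
    have hl : Tendsto (fun t : ℝ => ∫ z, p (a + t • z) * bump z) (𝓝[>] 0)
        (𝓝 (∫ z, p a * bump z)) := by
      refine tendsto_integral_filter_of_dominated_convergence (fun z => M * bump z) ?_ ?_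
        ((hbc.integrable_of_hasCompactSupport hasCompactSupport_bump).const_mul M) ?_
      · exact Eventually.of_forall fun s => Continuous.aestronglyMeasurable (by fun_prop)
      · filter_upwards [Ioo_mem_nhdsGT one_pos] with t ht
        refine ae_of_all _ fun z => ?_
        rw [norm_mul, norm_of_nonneg (bump_nonneg z)]
        rcases le_or_gt 2 ‖z‖ with hz | hz
        · simp [bump_eq_zero hz]
        · refine mul_le_mul_of_nonneg_right (hM _ ?_) (bump_nonneg z)
          rw [Metric.mem_ball, dist_eq_norm, add_sub_cancel_left, norm_smul, norm_of_nonneg ht.1.le]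
          nlinarith [ht.1, ht.2, norm_nonneg z]
      · refine ae_of_all _ fun z => ?_
        have hcont : Continuous fun t : ℝ => p (a + t • z) * bump z := by fun_prop
        have := (hcont.tendsto 0).mono_left (nhdsWithin_le_nhds (s := Set.Ioi 0))
        simpa using this
    rw [integral_const_mul, mul_comm] at hl
    refine hl.congr' ?_
    filter_upwards [self_mem_nhdsWithin] with t ht
    have ht0 : 0 < t := ht
    have e := integral_dilate (fun z => p (a + t • z) * bump z) ht0 a
    have e2 : ∀ y, p (a + t • t⁻¹ • (y - a)) = p y := fun y => by
      rw [smul_inv_smul₀ ht0.ne', add_sub_cancel]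
    simp only [e2] at e
    calc _ = (t ^ 3)⁻¹ * (t ^ 3 * ∫ z, p (a + t • z) * bump z) := by field_simp
      _ = _ := by
        rw [← e, ← integral_const_mul]
        refine integral_congr_ae (ae_of_all _ fun y => ?_)
        simp only
        ring
  intro t ht
  set A : ℝ → ℝ := fun t => (∫ y, p y * ((t ^ 3)⁻¹ * bump (t⁻¹ • (y - a)))) - c * κ / 2 * t ^ 2 with hA
  have hAd : ∀ s ∈ Set.Ioi (0:ℝ), HasDerivAt A 0 s := by
    intro s hs
    refine ((deriv s hs).sub ((hasDerivAt_pow 2 s).const_mul (c * κ / 2))).congr_deriv ?_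
    norm_num
    ring
  have hconst : ∀ s ∈ Set.Ioi (0:ℝ), A s = A t := fun s hs =>
    isOpen_Ioi.is_const_of_deriv_eq_zero isPreconnected_Ioi
      (fun r hr => (hAd r hr).differentiableAt.differentiableWithinAt) (fun r hr => (hAd r hr).deriv) hs ht
  have hAl : Tendsto A (𝓝[>] 0) (𝓝 ((∫ z, bump z) * p a)) := by
    have h2 : Tendsto (fun t : ℝ => c * κ / 2 * t ^ 2) (𝓝[>] 0) (𝓝 0) := by
      have : Continuous fun t : ℝ => c * κ / 2 * t ^ 2 := by fun_prop
      simpa using (this.tendsto 0).mono_left (nhdsWithin_le_nhds (s := Set.Ioi 0))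
    simpa using lim0.sub h2
  have hAt : A t = (∫ z, bump z) * p a := by
    refine tendsto_nhds_unique (tendsto_const_nhds.congr' ?_) hAl
    filter_upwards [self_mem_nhdsWithin] with s hs using (hconst s hs).symm
  have e : ∫ y, p y * ((t ^ 3)⁻¹ * bump (t⁻¹ • (y - a))) =
      (t ^ 3)⁻¹ * ∫ y, p y * bump (t⁻¹ • (y - a)) := by
    rw [← integral_const_mul]
    refine integral_congr_ae (ae_of_all _ fun y => ?_)
    simp only
    ring
  simp only [hA, e] at hAt
  rw [sub_eq_iff_eq_add] at hAt
  rw [← hAt]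
  field_simp

lemma exists_diff_bound {F : Type} [NormedAddCommGroup F] [NormedSpace ℝ F] {g : E3 → F}
    (hg : ContDiff ℝ (⊤ : ℕ∞) g) (hs : HasCompactSupport g) :
    ∃ C, 0 ≤ C ∧ ∀ z h, ‖g (z + h) - g z‖ ≤ C * ‖h‖ := by
  obtain ⟨C, hC⟩ := (hg.continuous_fderiv (by simp)).bounded_above_of_compact_support (hs.fderiv ℝ)
  refine ⟨C, (norm_nonneg _).trans (hC 0), fun z h => ?_⟩
  have := convex_univ.norm_image_sub_le_of_norm_fderiv_le
    (fun x _ => (hg.differentiable (by simp)) x) (fun x _ => hC x) (Set.mem_univ z)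
    (Set.mem_univ (z + h))
  simpa using this

lemma diff_bound_of_fderiv {F : Type} [NormedAddCommGroup F] [NormedSpace ℝ F] {g : E3 → F}
    (hg : Differentiable ℝ g) {C : ℝ} (hC : ∀ z, ‖fderiv ℝ g z‖ ≤ C) (z h : E3) :
    ‖g (z + h) - g z‖ ≤ C * ‖h‖ := by
  have := convex_univ.norm_image_sub_le_of_norm_fderiv_le
    (fun x _ => hg x) (fun x _ => hC x) (Set.mem_univ z) (Set.mem_univ (z + h))
  simpa using this

lemma exists_second_diff_bound {F : Type} [NormedAddCommGroup F] [NormedSpace ℝ F] {g : E3 → F}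
    (hg : ContDiff ℝ (⊤ : ℕ∞) g) (hs : HasCompactSupport g) :
    ∃ C, 0 ≤ C ∧ ∀ z h k, ‖(g (z + k + h) - g (z + k)) - (g (z + h) - g z)‖ ≤ C * ‖h‖ * ‖k‖ := by
  obtain ⟨C, hC0, hC⟩ := exists_diff_bound (hg.fderiv_right (m := (⊤ : ℕ∞)) (by simp)) (hs.fderiv ℝ)
  have hd := hg.differentiable (by simp)
  refine ⟨C, hC0, fun z h k => diff_bound_of_fderiv (g := fun z => g (z + h) - g z)
    (by fun_prop) (fun z => ?_) z k⟩
  rw [fderiv_fun_sub (by fun_prop) (by fun_prop), fderiv_comp_add_right]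
  exact hC z h

lemma exists_third_diff_bound {F : Type} [NormedAddCommGroup F] [NormedSpace ℝ F] {g : E3 → F}
    (hg : ContDiff ℝ (⊤ : ℕ∞) g) (hs : HasCompactSupport g) :
    ∃ C, 0 ≤ C ∧ ∀ z h k l, ‖((g (z + l + k + h) - g (z + l + k)) - (g (z + l + h) - g (z + l)))
      - ((g (z + k + h) - g (z + k)) - (g (z + h) - g z))‖ ≤ C * ‖h‖ * ‖k‖ * ‖l‖ := by
  obtain ⟨C, hC0, hC⟩ := exists_second_diff_bound (hg.fderiv_right (m := (⊤ : ℕ∞)) (by simp))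
    (hs.fderiv ℝ)
  have hd := hg.differentiable (by simp)
  refine ⟨C, hC0, fun z h k l => diff_bound_of_fderiv
    (g := fun z => (g (z + k + h) - g (z + k)) - (g (z + h) - g z)) (by fun_prop) (fun z => ?_) z l⟩
  have e : ∀ w : E3, fderiv ℝ (fun z => g (z + k + w)) z = fderiv ℝ g (z + k + w) := fun w => by
    simp only [add_assoc]
    exact fderiv_comp_add_right (k + w)
  rw [fderiv_fun_sub (by fun_prop) (by fun_prop), fderiv_fun_sub (by fun_prop) (by fun_prop),
    fderiv_fun_sub (by fun_prop) (by fun_prop), fderiv_comp_add_right, fderiv_comp_add_right, e]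
  exact hC z h k

lemma bump_integrable {p : E3 → ℝ} (hp : Continuous p) {t : ℝ} (ht : 0 < t) (a : E3) :
    Integrable fun y => p y * bump (t⁻¹ • (y - a)) := by
  have hbc := contDiff_bump.continuous
  refine (by fun_prop : Continuous fun y => p y * bump (t⁻¹ • (y - a))).integrable_of_hasCompactSupport ?_
  refine hasCompactSupport_of_eq_zero (r := ‖a‖ + 2 * t) fun y hy => ?_
  have h1 : 2 * t < ‖y - a‖ := by linarith [norm_sub_norm_le y a]
  rw [bump_eq_zero, mul_zero]
  rw [norm_smul, norm_of_nonneg (by positivity), inv_mul_eq_div, le_div_iff₀ ht]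
  exact h1.le

lemma integral_mul_bump_le {p f : E3 → ℝ} (hp : Continuous p)
    (hi : Integrable f) (hpos : ∀ y, 0 ≤ f y) {A C t D : ℝ} (hA : 0 ≤ A)
    (h : ∀ x, p x ≤ f x + A * log (1 + ‖x‖) + C) (ht : 0 < t) (a : E3)
    (hD : ‖a‖ + 2 * t ≤ D) :
    ∫ y, p y * bump (t⁻¹ • (y - a)) ≤
      (∫ y, f y) + (A * log (1 + D) + C) * (t ^ 3 * ∫ z, bump z) := by
  have i1 := bump_integrable (p := fun _ => A * log (1 + D) + C) continuous_const ht a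
  have i2 : Integrable fun y => f y + (A * log (1 + D) + C) * bump (t⁻¹ • (y - a)) := hi.add i1
  calc _ ≤ ∫ y, (f y + (A * log (1 + D) + C) * bump (t⁻¹ • (y - a))) := by
        refine integral_mono (bump_integrable hp ht a) i2 fun y => ?_
        simp only
        have hb0 := bump_nonneg (t⁻¹ • (y - a))
        have hb1 := bump_le_one (t⁻¹ • (y - a))
        rcases le_or_gt 2 ‖t⁻¹ • (y - a)‖ with hz | hz
        · simp [bump_eq_zero hz, hpos y]
        · rw [norm_smul, norm_of_nonneg (by positivity), inv_mul_eq_div, div_lt_iff₀ ht] at hz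
          have hy : ‖y‖ ≤ D := by linarith [norm_le_norm_add_norm_sub' y a]
          have hl : log (1 + ‖y‖) ≤ log (1 + D) := log_le_log (by positivity) (by linarith)
          have h2 : p y ≤ f y + (A * log (1 + D) + C) := by
            have := h y
            have := mul_le_mul_of_nonneg_left hl hA
            linarith
          calc _ ≤ (f y + (A * log (1 + D) + C)) * bump (t⁻¹ • (y - a)) :=
                mul_le_mul_of_nonneg_right h2 hb0
            _ ≤ _ := by
              rw [add_mul]
              have := mul_le_mul_of_nonneg_left hb1 (hpos y)
              linarith
    _ = _ := by
      rw [integral_add hi i1, integral_const_mul, integral_dilate _ ht]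

/-- A function satisfying the mean value formula with an upper bound of logarithmic type
grows at most quadratically in the mean. -/
lemma setIntegral_abs_le {p f : E3 → ℝ} (hp : Continuous p) {c₁ : ℝ}
    (hmv : ∀ (a : E3) (t : ℝ), 0 < t → ∫ y, p y * bump (t⁻¹ • (y - a)) =
      t ^ 3 * ((∫ z, bump z) * p a + c₁ * t ^ 2))
    (hi : Integrable f) (hpos : ∀ y, 0 ≤ f y) {A C : ℝ} (hA : 0 ≤ A)
    (h : ∀ x, p x ≤ f x + A * log (1 + ‖x‖) + C) :
    ∃ K, 0 ≤ K ∧ ∀ t, 1 ≤ t → ∫ y in Metric.ball 0 t, |p y| ≤ K * t ^ 5 := by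
  set b := ∫ z : E3, bump z with hb
  have hb0 : 0 < b := integral_bump_pos
  have hf0 : 0 ≤ ∫ y, f y := integral_nonneg hpos
  refine ⟨2 * ((∫ y, f y) + (A * 2 + |C|) * b) + (b * |p 0| + |c₁|), by positivity, fun t ht => ?_⟩
  have ht0 : 0 < t := by linarith
  have hub := integral_mul_bump_le (p := fun y => max (p y) 0) (C := |C|) (by fun_prop) hi hpos hA
    (fun x => max_le ((h x).trans (by gcongr; exact le_abs_self C)) (by
      have := hpos x
      have := log_nonneg (by linarith [norm_nonneg x] : 1 ≤ 1 + ‖x‖)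
      positivity)) ht0 0 (D := 2 * t) (by simp)
  have hlog : log (1 + 2 * t) ≤ 2 * t := by
    have := log_le_sub_one_of_pos (by positivity : 0 < 1 + 2 * t)
    linarith
  have i0 := bump_integrable hp ht0 0
  have i1 := bump_integrable (p := fun y => max (p y) 0) (by fun_prop) ht0 0
  have i2 := bump_integrable (p := fun y => |p y|) (by fun_prop) ht0 0
  have e : ∫ y, |p y| * bump (t⁻¹ • (y - 0)) =
      2 * (∫ y, max (p y) 0 * bump (t⁻¹ • (y - 0))) - ∫ y, p y * bump (t⁻¹ • (y - 0)) := by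
    rw [← integral_const_mul, ← integral_sub (i1.const_mul 2) i0]
    refine integral_congr_ae (ae_of_all _ fun y => ?_)
    simp only
    rcases le_total 0 (p y) with h0 | h0
    · rw [abs_of_nonneg h0, max_eq_left h0]; ring
    · rw [abs_of_nonpos h0, max_eq_right h0]; ring
  have hle : ∫ y in Metric.ball 0 t, |p y| ≤ ∫ y, |p y| * bump (t⁻¹ • (y - 0)) := by
    rw [← integral_indicator measurableSet_ball]
    refine integral_mono_of_nonneg (ae_of_all _ fun y => ?_) i2 (ae_of_all _ fun y => ?_)
    · exact Set.indicator_nonneg (fun _ _ => abs_nonneg _) y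
    · by_cases hy : y ∈ Metric.ball 0 t
      · simp only [Set.indicator_of_mem hy]
        rw [bump_eq_one, mul_one]
        rw [mem_ball_zero_iff] at hy
        rw [sub_zero, norm_smul, norm_of_nonneg (by positivity), inv_mul_eq_div, div_le_one ht0]
        exact hy.le
      · simp only [Set.indicator_of_notMem hy]
        exact mul_nonneg (abs_nonneg _) (bump_nonneg _)
  rw [e, hmv 0 t ht0] at hle
  have t35 : t ^ 3 ≤ t ^ 5 := pow_le_pow_right₀ ht (by norm_num)
  have t45 : t ^ 4 ≤ t ^ 5 := pow_le_pow_right₀ ht (by norm_num)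
  have t05 : 1 ≤ t ^ 5 := one_le_pow₀ ht
  have g1 : (A * log (1 + 2 * t) + |C|) * (t ^ 3 * b) ≤ (A * 2 + |C|) * b * t ^ 5 := by
    calc _ ≤ (A * (2 * t) + |C|) * (t ^ 3 * b) := by gcongr
      _ = A * 2 * b * t ^ 4 + |C| * b * t ^ 3 := by ring
      _ ≤ A * 2 * b * t ^ 5 + |C| * b * t ^ 5 := by gcongr
      _ = _ := by ring
  have g2 : -(t ^ 3 * (b * p 0 + c₁ * t ^ 2)) ≤ (b * |p 0| + |c₁|) * t ^ 5 := by
    calc _ = b * (-p 0) * t ^ 3 + (-c₁) * t ^ 5 := by ring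
      _ ≤ b * |p 0| * t ^ 5 + |c₁| * t ^ 5 := by
        have := neg_le_abs (p 0)
        have := neg_le_abs c₁
        gcongr
      _ = _ := by ring
  have g3 : (∫ y, f y) ≤ (∫ y, f y) * t ^ 5 := le_mul_of_one_le_right hf0 t05
  linarith

lemma third_diff_eq_zero {p : E3 → ℝ} (hp : Continuous p) {c₁ K : ℝ}
    (hmv : ∀ (a : E3) (t : ℝ), 0 < t → ∫ y, p y * bump (t⁻¹ • (y - a)) =
      t ^ 3 * ((∫ z, bump z) * p a + c₁ * t ^ 2))
    (hK : ∀ t, 1 ≤ t → ∫ y in Metric.ball 0 t, |p y| ≤ K * t ^ 5) (h k l : E3) :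
    p (h + k + l) - p (h + k) - p (h + l) - p (k + l) + p h + p k + p l - p 0 = 0 := by
  obtain ⟨C, hC0, hC⟩ := exists_third_diff_bound contDiff_bump hasCompactSupport_bump
  set b := ∫ z : E3, bump z with hb
  have hb0 : 0 < b := integral_bump_pos
  set X := p (h + k + l) - p (h + k) - p (h + l) - p (k + l) + p h + p k + p l - p 0 with hX
  have sub : ∀ {g₁ g₂ : E3 → ℝ} {v₁ v₂ : ℝ}, (Integrable g₁ ∧ ∫ y, g₁ y = v₁) →
      (Integrable g₂ ∧ ∫ y, g₂ y = v₂) →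
      Integrable (fun y => g₁ y - g₂ y) ∧ ∫ y, (g₁ y - g₂ y) = v₁ - v₂ := by
    rintro g₁ g₂ _ _ ⟨i₁, rfl⟩ ⟨i₂, rfl⟩
    exact ⟨i₁.sub i₂, integral_sub i₁ i₂⟩
  have main : ∀ t, 1 ≤ t → ‖h‖ + ‖k‖ + ‖l‖ ≤ t →
      b * |X| * t ≤ C * ‖h‖ * ‖k‖ * ‖l‖ * (K * 4 ^ 5) := by
    intro t ht hhk
    have ht0 : 0 < t := by linarith
    have nh := norm_nonneg h
    have nk := norm_nonneg k
    have nl := norm_nonneg l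
    have m := fun a => And.intro (bump_integrable hp ht0 a) (hmv a t ht0)
    have key := sub (sub (sub (m (h + k + l)) (m (k + l))) (sub (m (h + l)) (m l)))
      (sub (sub (m (h + k)) (m k)) (sub (m h) (m 0)))
    have e : ∫ y, _ = t ^ 3 * (b * X) := key.2.trans (by rw [hX]; ring)
    have hb : ∀ a : E3, ‖a‖ ≤ t → ∀ y : E3, y ∉ Metric.ball 0 (4 * t) → bump (t⁻¹ • (y - a)) = 0 := by
      intro a ha y hy
      rw [mem_ball_zero_iff, not_lt] at hy
      apply bump_eq_zero
      rw [norm_smul, norm_of_nonneg (by positivity), inv_mul_eq_div, le_div_iff₀ ht0]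
      linarith [norm_sub_norm_le y a]
    have hle : |t ^ 3 * (b * X)| ≤ ∫ y in Metric.ball 0 (4 * t),
        C * (t⁻¹ * ‖h‖) * (t⁻¹ * ‖k‖) * (t⁻¹ * ‖l‖) * |p y| := by
      rw [← e, ← Real.norm_eq_abs, ← integral_indicator measurableSet_ball]
      refine norm_integral_le_of_norm_le ?_ (ae_of_all _ fun y => ?_)
      · rw [integrable_indicator_iff measurableSet_ball]
        exact ((continuous_const.mul hp.abs).continuousOn.integrableOn_compact
          (isCompact_closedBall 0 (4 * t))).mono_set Metric.ball_subset_closedBall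
      · by_cases hy : y ∈ Metric.ball 0 (4 * t)
        · rw [Set.indicator_of_mem hy]
          have hn : ∀ w : E3, ‖-(t⁻¹ • w)‖ = t⁻¹ * ‖w‖ := fun w => by
            rw [norm_neg, norm_smul, norm_of_nonneg (by positivity)]
          have b3 := hC (t⁻¹ • y) (-(t⁻¹ • h)) (-(t⁻¹ • k)) (-(t⁻¹ • l))
          rw [hn, hn, hn] at b3
          refine le_trans (le_of_eq ?_) (mul_le_mul_of_nonneg_right b3 (abs_nonneg (p y)))
          rw [← Real.norm_eq_abs (p y), ← norm_mul]
          rw [show t⁻¹ • y + -(t⁻¹ • l) + -(t⁻¹ • k) + -(t⁻¹ • h) = t⁻¹ • (y - (h + k + l)) by module,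
            show t⁻¹ • y + -(t⁻¹ • l) + -(t⁻¹ • k) = t⁻¹ • (y - (k + l)) by module,
            show t⁻¹ • y + -(t⁻¹ • l) + -(t⁻¹ • h) = t⁻¹ • (y - (h + l)) by module,
            show t⁻¹ • y + -(t⁻¹ • k) + -(t⁻¹ • h) = t⁻¹ • (y - (h + k)) by module,
            show t⁻¹ • y + -(t⁻¹ • l) = t⁻¹ • (y - l) by module,
            show t⁻¹ • y + -(t⁻¹ • k) = t⁻¹ • (y - k) by module,
            show t⁻¹ • y + -(t⁻¹ • h) = t⁻¹ • (y - h) by module,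
            show t⁻¹ • y = t⁻¹ • (y - 0) by module]
          congr 1
          ring
        · rw [Set.indicator_of_notMem hy, hb, hb, hb, hb, hb, hb, hb, hb]
          · simp
          all_goals first
            | exact hy
            | linarith
            | linarith [norm_add_le h k, norm_add_le h l, norm_add_le k l]
            | exact norm_add₃_le.trans hhk
            | simpa using ht0.le
    rw [integral_const_mul, abs_mul, abs_mul, abs_of_pos hb0, abs_of_pos (pow_pos ht0 3)] at hle
    have h2 := hle.trans (mul_le_mul_of_nonneg_left (hK (4 * t) (by linarith)) (by positivity))
    have h3 : C * (t⁻¹ * ‖h‖) * (t⁻¹ * ‖k‖) * (t⁻¹ * ‖l‖) * (K * (4 * t) ^ 5) =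
        t ^ 2 * (C * ‖h‖ * ‖k‖ * ‖l‖ * (K * 4 ^ 5)) := by
      field_simp
    rw [h3] at h2
    refine le_of_mul_le_mul_left (le_trans (le_of_eq ?_) h2) (pow_pos ht0 2)
    ring
  by_contra hne
  have hpos : 0 < b * |X| := mul_pos hb0 (abs_pos.2 hne)
  set D := C * ‖h‖ * ‖k‖ * ‖l‖ * (K * 4 ^ 5)
  have hn : 0 ≤ ‖h‖ + ‖k‖ + ‖l‖ := by positivity
  have hq : 0 ≤ |D| / (b * |X|) := by positivity
  have h1 := main (1 + (‖h‖ + ‖k‖ + ‖l‖) + |D| / (b * |X|)) (by linarith) (by linarith)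
  rw [mul_add, mul_div_cancel₀ _ hpos.ne'] at h1
  have h2 : 0 < b * |X| * (1 + (‖h‖ + ‖k‖ + ‖l‖)) := by positivity
  linarith [le_abs_self D]

/-- A continuous function with vanishing third differences is a quadratic polynomial. -/
lemma exists_quadratic_of_third_diff {p : E3 → ℝ} (hp : Continuous p)
    (h3 : ∀ h k l : E3,
      p (h + k + l) - p (h + k) - p (h + l) - p (k + l) + p h + p k + p l - p 0 = 0) :
    ∃ (l : E3) (T : E3 →ₗ[ℝ] E3), T.IsSymmetric ∧
      ∀ x, p x = p 0 + inner ℝ l x + inner ℝ (T x) x := by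
  set b : E3 → E3 → ℝ := fun h k => (p (h + k) - p h - p k + p 0) / 2 with hb
  have hsymm : ∀ h k, b h k = b k h := fun h k => by simp only [hb]; rw [add_comm h k]; ring
  have hadd : ∀ h k l, b (h + k) l = b h l + b k l := fun h k l => by
    have := h3 h k l
    simp only [hb]
    linarith
  have hcont : ∀ k, Continuous fun h => b h k := fun k => by simp only [hb]; fun_prop
  have hsmul : ∀ (c : ℝ) h k, b (c • h) k = c * b h k := fun c h k => by
    exact (AddMonoidHom.toRealLinearMap (AddMonoidHom.mk' (fun h => b h k)
      (fun h h' => hadd h h' k)) (hcont k)).map_smul c h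
  let B : E3 →ₗ[ℝ] E3 →ₗ[ℝ] ℝ := LinearMap.mk₂ ℝ b hadd hsmul
    (fun h k l => by rw [hsymm, hadd, hsymm k, hsymm l])
    (fun c h k => by rw [hsymm, hsmul, hsymm k, smul_eq_mul])
  let ℓ : E3 →L[ℝ] ℝ := AddMonoidHom.toRealLinearMap (AddMonoidHom.mk'
    (fun h => p h - p 0 - b h h) (fun h k => by
      rw [hadd, hsymm h (h + k), hsymm k (h + k), hadd, hadd, hsymm k h]
      have : 2 * b h k = p (h + k) - p h - p k + p 0 := by simp only [hb]; ring
      linarith)) (by simp only [hb, AddMonoidHom.mk'_apply]; fun_prop)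
  have hℓ : ∀ h, ℓ h = p h - p 0 - b h h := fun h => rfl
  let T : E3 →ₗ[ℝ] E3 :=
    { toFun := fun x => (InnerProductSpace.toDual ℝ E3).symm (LinearMap.toContinuousLinearMap (B x))
      map_add' := fun x y => by simp
      map_smul' := fun c x => by simp }
  have hT : ∀ x y, inner ℝ (T x) y = b x y := fun x y => by
    show inner ℝ ((InnerProductSpace.toDual ℝ E3).symm (LinearMap.toContinuousLinearMap (B x))) y = _
    rw [InnerProductSpace.toDual_symm_apply]
    rfl
  refine ⟨(InnerProductSpace.toDual ℝ E3).symm ℓ, T, fun x y => ?_, fun x => ?_⟩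
  · rw [hT, real_inner_comm, hT, hsymm]
  · rw [InnerProductSpace.toDual_symm_apply, hT, hℓ]
    ring

lemma nonpos_of_sq_le {a K C : ℝ} (hK : 0 ≤ K) (hC : 0 ≤ C)
    (h : ∀ s, 1 ≤ s → a * s ^ 2 ≤ K * s + C) : a ≤ 0 := by
  by_contra! ha
  have hq : 0 ≤ (K + C) / a := by positivity
  have h1 := h (1 + (K + C) / a) (by linarith)
  have h2 : a * (1 + (K + C) / a) = a + (K + C) := by field_simp
  nlinarith

/-- A quadratic polynomial of at most logarithmic growth is bounded above, and is constant if its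
quadratic part vanishes. -/
lemma quadratic_bounded_above {p : E3 → ℝ} {c : ℝ} {l : E3} {T : E3 →ₗ[ℝ] E3}
    (hT : T.IsSymmetric) (hp : ∀ x, p x = c + inner ℝ l x + inner ℝ (T x) x) {A C : ℝ}
    (hA : 0 ≤ A) (h : ∀ x, p x ≤ A * log (3 + ‖x‖) + C) :
    (∃ M, ∀ x, p x ≤ M) ∧ ((∀ x, inner ℝ (T x) x = 0) → l = 0) := by
  have line : ∀ z : E3, ∃ K D : ℝ, 0 ≤ K ∧ 0 ≤ D ∧ ∀ s : ℝ, 1 ≤ s →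
      inner ℝ l z * s ^ 2 + inner ℝ (T z) z * s ^ 4 ≤ K * s + D := by
    intro z
    refine ⟨2 * A * √‖z‖, 4 * A + |C| + |c|, by positivity, by positivity, fun s hs => ?_⟩
    have hs0 : 0 ≤ s := by linarith
    have h1 := h (s ^ 2 • z)
    rw [hp, map_smul, inner_smul_right, inner_smul_left, inner_smul_right, norm_smul,
      norm_of_nonneg (by positivity)] at h1
    simp only [conj_trivial] at h1
    have h2 : log (3 + s ^ 2 * ‖z‖) ≤ 2 * (2 + s * √‖z‖) := by
      have e : log (3 + s ^ 2 * ‖z‖) ≤ log ((2 + s * √‖z‖) ^ 2) := by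
        refine log_le_log (by positivity) ?_
        have : √‖z‖ ^ 2 = ‖z‖ := sq_sqrt (norm_nonneg z)
        have : 0 ≤ s * √‖z‖ := by positivity
        nlinarith
      rw [log_pow] at e
      have := log_le_sub_one_of_pos (by positivity : 0 < 2 + s * √‖z‖)
      push_cast at e
      linarith
    have h4 := mul_le_mul_of_nonneg_left h2 hA
    have := le_abs_self C
    have := neg_abs_le c
    nlinarith
  have hnonpos : ∀ z, inner ℝ (T z) z ≤ 0 := by
    intro z
    obtain ⟨K, D, hK, hD, h1⟩ := line z
    obtain ⟨K', D', hK', hD', h2⟩ := line (-z)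
    by_contra! hpos
    refine hpos.not_ge (nonpos_of_sq_le (K := K + K') (C := D + D') (by positivity)
      (by positivity) fun s hs => ?_)
    have e1 := h1 s hs
    have e2 := h2 s hs
    rw [map_neg, inner_neg_right, inner_neg_neg] at e2
    have e3 : s ^ 2 ≤ s ^ 4 := pow_le_pow_right₀ hs (by norm_num)
    have e4 : 0 ≤ s ^ 4 := by positivity
    nlinarith [mul_le_mul_of_nonneg_left e3 hpos.le]
  have hle : ∀ z, inner ℝ (T z) z = 0 → inner ℝ l z ≤ 0 := by
    intro z hz
    obtain ⟨K, D, hK, hD, h1⟩ := line z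
    refine nonpos_of_sq_le hK hD fun s hs => ?_
    simpa [hz] using h1 s hs
  have hzero : ∀ z, inner ℝ (T z) z = 0 → inner ℝ l z = 0 := by
    intro z hz
    refine le_antisymm (hle z hz) ?_
    have := hle (-z) (by simpa using hz)
    rw [inner_neg_right] at this
    linarith
  refine ⟨?_, fun hz => inner_self_eq_zero.1 (hzero l (hz l))⟩
  have hmem : l ∈ LinearMap.range T := by
    rw [← Submodule.orthogonal_orthogonal (LinearMap.range T), hT.orthogonal_range,
      Submodule.mem_orthogonal]
    intro z hz
    rw [real_inner_comm]
    exact hzero z (by rw [LinearMap.mem_ker.1 hz, inner_zero_left])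
  obtain ⟨w, rfl⟩ := hmem
  refine ⟨c - inner ℝ (T w) w / 4, fun x => ?_⟩
  have h1 := hnonpos (x + (1 / 2 : ℝ) • w)
  rw [map_add, map_smul, inner_add_left, inner_add_right, inner_add_right, inner_smul_left,
    inner_smul_left, inner_smul_right, inner_smul_right, show inner ℝ (T x) w = inner ℝ (T w) x by
      rw [hT, real_inner_comm]] at h1
  simp only [conj_trivial] at h1
  rw [hp]
  linarith

/-- The polynomial with given quadratic form. -/
lemma exists_mvPolynomial {p : E3 → ℝ} {c : ℝ} {l : E3} {T : E3 →ₗ[ℝ] E3}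
    (hp : ∀ x, p x = c + inner ℝ l x + inner ℝ (T x) x)
    (hl : (∀ x, inner ℝ (T x) x = 0) → l = 0) :
    ∃ P : MvPolynomial (Fin 3) ℝ, (P.totalDegree = 0 ∨ P.totalDegree = 2) ∧
      ∀ x : E3, p x = MvPolynomial.eval (fun i => x i) P := by
  by_cases h0 : ∀ x, inner ℝ (T x) x = 0
  · refine ⟨MvPolynomial.C c, Or.inl (MvPolynomial.totalDegree_C c), fun x => ?_⟩
    rw [hp, h0, hl h0]
    simp
  set e : Fin 3 → E3 := fun i => EuclideanSpace.single i 1 with he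
  set L : MvPolynomial (Fin 3) ℝ := ∑ i, MvPolynomial.C (l i) * MvPolynomial.X i with hL
  set Q : MvPolynomial (Fin 3) ℝ :=
    ∑ i, ∑ j, MvPolynomial.C (T (e i) j) * (MvPolynomial.X i * MvPolynomial.X j) with hQ
  have eL : ∀ x : E3, MvPolynomial.eval (fun i => x i) L = inner ℝ l x := fun x => by
    simp [hL, PiLp.inner_apply, mul_comm]
  have eQ : ∀ x : E3, MvPolynomial.eval (fun i => x i) Q = inner ℝ (T x) x := fun x => by
    have hx : x = ∑ i, x i • e i := by
      ext j
      simp [he, Finset.sum_apply, Pi.single_apply]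
    have hTx : ∀ j, T x j = ∑ i, x i * T (e i) j := fun j => by
      conv_lhs => rw [hx]
      simp [map_sum]
    simp only [hQ, map_sum, map_mul, MvPolynomial.eval_C, MvPolynomial.eval_X, PiLp.inner_apply,
      hTx]
    rw [Finset.sum_comm]
    refine Finset.sum_congr rfl fun j _ => ?_
    simp only [RCLike.inner_apply, conj_trivial, Finset.mul_sum]
    exact Finset.sum_congr rfl fun i _ => by ring
  have hLh : L.IsHomogeneous 1 := MvPolynomial.IsHomogeneous.sum _ _ _ fun i _ => by
    simpa using (MvPolynomial.isHomogeneous_C (Fin 3) (l i)).mul (MvPolynomial.isHomogeneous_X ℝ i)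
  have hQh : Q.IsHomogeneous 2 := MvPolynomial.IsHomogeneous.sum _ _ _ fun i _ =>
    MvPolynomial.IsHomogeneous.sum _ _ _ fun j _ => by
      simpa using (MvPolynomial.isHomogeneous_C (Fin 3) (T (e i) j)).mul
        ((MvPolynomial.isHomogeneous_X ℝ i).mul (MvPolynomial.isHomogeneous_X ℝ j))
  refine ⟨MvPolynomial.C c + L + Q, Or.inr (le_antisymm ?_ ?_), fun x => ?_⟩
  · refine (MvPolynomial.totalDegree_add _ _).trans (max_le ?_ hQh.totalDegree_le)
    refine (MvPolynomial.totalDegree_add _ _).trans (max_le ?_ (hLh.totalDegree_le.trans one_le_two))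
    simp
  · by_contra! hlt
    have h1 := MvPolynomial.homogeneousComponent_eq_zero 2 _ hlt
    rw [map_add, map_add, MvPolynomial.homogeneousComponent_of_mem hQh,
      MvPolynomial.homogeneousComponent_of_mem hLh,
      MvPolynomial.homogeneousComponent_of_mem (MvPolynomial.isHomogeneous_C (Fin 3) c)] at h1
    have h2 : Q = 0 := by simpa using h1
    exact h0 fun x => by rw [← eQ, h2, map_zero]
  · rw [map_add, map_add, MvPolynomial.eval_C, eL, eQ, hp]

lemma le_exp_three_mul (t : ℝ) : t ≤ exp (3 * t) := by
  rcases le_total 0 t with h | h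
  · linarith [add_one_le_exp (3 * t)]
  · linarith [exp_pos (3 * t)]

lemma IsSolution.continuous_exp {u : E3 → ℝ} (hu : IsSolution u) :
    Continuous fun x => exp (3 * u x) := by
  have := hu.1.continuous
  fun_prop

lemma solV_eq (u : E3 → ℝ) (x : E3) :
    solV u x = (1 / π ^ 2) * logPot (fun y => exp (3 * u y)) x := rfl

/-- The difference `u - v` is a quadratic polynomial which is bounded from above. -/
lemma IsSolution.exists_quadratic {u : E3 → ℝ} (hu : IsSolution u) :
    ∃ (c : ℝ) (l : E3) (T : E3 →ₗ[ℝ] E3),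
      (∀ x, u x - solV u x = c + inner ℝ l x + inner ℝ (T x) x) ∧
      (∃ M, ∀ x, u x - solV u x ≤ M) ∧ ((∀ x, inner ℝ (T x) x = 0) → l = 0) := by
  have hc := hu.continuous_exp
  have hi := hu.2.2.1
  have hpos : ∀ y, 0 ≤ exp (3 * u y) := fun y => (exp_pos _).le
  set f : E3 → ℝ := fun y => exp (3 * u y) with hf
  set p : E3 → ℝ := fun x => u x - (1 / π ^ 2) * logPot f x with hpdef
  have hp : Continuous p := hu.1.continuous.sub (continuous_const.mul (continuous_logPot hc hi))
  obtain ⟨c, hcc⟩ := eq_riesz_add_const (w := fun x => -lap u x) (f := f) (continuous_lap hu.1).neg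
    (by simpa only [abs_neg] using hu.2.1.2) hc hi hu.2.2.2
  obtain ⟨c₁, hmv⟩ := mean_value hp fun χ hχ hs => integral_sub_logPot_mul_lap hu.1 hc hi hcc hχ hs
  set A := (1 / π ^ 2) * ∫ y, f y with hA
  set D := (1 / π ^ 2) * ∫ y, log (1 + ‖y‖⁻¹) * f y with hD
  have hf0 : 0 ≤ ∫ y, f y := integral_nonneg hpos
  have hA0 : 0 ≤ A := by positivity
  have hub : ∀ x, p x ≤ f x + A * log (1 + ‖x‖) + D := fun x => by
    have h1 := mul_le_mul_of_nonneg_left (logPot_ge hc hi hpos x) (by positivity : 0 ≤ 1 / π ^ 2)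
    have h2 : u x ≤ f x := le_exp_three_mul (u x)
    simp only [hpdef, hA, hD]
    linarith
  obtain ⟨K, -, hK⟩ := setIntegral_abs_le hp hmv hi hpos hA0 hub
  obtain ⟨l, T, hT, hq⟩ := exists_quadratic_of_third_diff hp (third_diff_eq_zero hp hmv hK)
  set b := ∫ z : E3, bump z with hb
  have hb0 : 0 < b := integral_bump_pos
  have hlog : ∀ x, p x ≤ A * log (3 + ‖x‖) + (((∫ y, f y) - c₁) / b + D) := fun x => by
    have h1 := integral_mul_bump_le hp hi hpos hA0 hub one_pos x le_rfl
    rw [hmv x 1 one_pos] at h1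
    have h2 : p x = ((∫ y, f y) - c₁) / b + (A * log (1 + (‖x‖ + 2 * 1)) + D) -
      (((∫ y, f y) + (A * log (1 + (‖x‖ + 2 * 1)) + D) * (1 ^ 3 * b)) -
        1 ^ 3 * (b * p x + c₁ * 1 ^ 2)) / b := by
      field_simp
      ring
    have h3 := div_nonneg (sub_nonneg.2 h1) hb0.le
    rw [show 1 + (‖x‖ + 2 * 1) = 3 + ‖x‖ by ring] at h2 h3
    linarith
  obtain ⟨hM, hl⟩ := quadratic_bounded_above hT hq hA0 hlog
  exact ⟨p 0, l, T, hq, hM, hl⟩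

lemma IsSolution.integral_pos {u : E3 → ℝ} (hu : IsSolution u) : 0 < ∫ y, exp (3 * u y) :=
  integral_exp_pos hu.2.2.1

lemma exists_tail_lt {f : E3 → ℝ} (hi : Integrable f) {ε : ℝ} (hε : 0 < ε) :
    ∃ R : ℝ, 1 ≤ R ∧ ∫ y in (Metric.ball 0 R)ᶜ, f y < ε := by
  have hanti : Antitone fun n : ℕ => (Metric.ball (0:E3) n)ᶜ := fun m n h =>
    Set.compl_subset_compl.2 (Metric.ball_subset_ball (by exact_mod_cast h))
  have hl := tendsto_setIntegral_of_antitone (μ := volume) (f := f)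
    (fun n : ℕ => measurableSet_ball.compl) hanti ⟨0, hi.integrableOn⟩
  have he : ⋂ n : ℕ, (Metric.ball (0:E3) n)ᶜ = ∅ := by
    rw [← Set.compl_iUnion, Metric.iUnion_ball_nat, Set.compl_univ]
  rw [he, setIntegral_empty] at hl
  obtain ⟨n, hn, hn1⟩ := ((hl.eventually (gt_mem_nhds hε)).and (eventually_ge_atTop 1)).exists
  exact ⟨n, by exact_mod_cast hn1, hn⟩

lemma log_one_add_le {t : ℝ} (ht : 1 ≤ t) : log (1 + t) ≤ log 2 + log t := by
  rw [← log_mul (by norm_num) (by linarith)]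
  exact log_le_log (by linarith) (by linarith)

/-- Blow-up argument: a density controlled by the exponential of its own logarithmic potential
is bounded. -/
lemma bounded_of_le_exp_logPot {f : E3 → ℝ} (hc : Continuous f) (hi : Integrable f)
    (hpos : ∀ y, 0 < f y) {C a : ℝ} (hC : 0 ≤ C) (ha : 0 < a)
    (h : ∀ x, f x ≤ C * exp (a * logPot f x)) : ∃ M, 0 ≤ M ∧ ∀ y, |f y| ≤ M := by
  have hpos' : ∀ y, 0 ≤ f y := fun y => (hpos y).le
  set m := ∫ y, f y with hm
  have hm0 : 0 < m := by
    rw [hm, integral_pos_iff_support_of_nonneg hpos' hi]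
    rw [show Function.support f = Set.univ from Set.eq_univ_of_forall fun y => (hpos y).ne']
    simp
  obtain ⟨R, hR, hτ⟩ := exists_tail_lt hi (lt_min (by positivity : 0 < m / 4) (by positivity : 0 < 1 / a))
  set τ := ∫ y in (Metric.ball 0 R)ᶜ, f y with hτdef
  have hτ0 : 0 ≤ τ := integral_nonneg hpos'
  have hτ1 : τ ≤ m / 4 := (hτ.trans_le (min_le_left _ _)).le
  have hτ2 : a * τ ≤ 1 := by
    have := (hτ.trans_le (min_le_right _ _)).le
    rwa [le_div_iff₀ ha, mul_comm] at this
  set κ := ∫ z in Metric.ball (0 : E3) 1, ‖z‖⁻¹ with hκ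
  set C₁ := C * exp (a * (m * log (2 * R) + m * log 2)) with hC₁
  have hC₁0 : 0 ≤ C₁ := by positivity
  have far : ∀ x : E3, 2 * R ≤ ‖x‖ → ∀ r N : ℝ, 0 < r → r ≤ 1 →
      (∀ y ∈ Metric.ball x r, f y ≤ N) → f x ≤ C₁ * exp (a * (N * (r ^ 2 * κ))) * r⁻¹ := by
    intro x hx r N hr hr1 hN
    have hx1 : 1 ≤ ‖x‖ := by linarith
    have h1 := logPot_le hc hi hpos' hR hx
    have h2 := logSing_le hc hi hpos' hr hr1 hN
    have h3 : ∫ y in Metric.ball x 1, f y ≤ τ := by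
      refine setIntegral_mono_set hi.integrableOn (ae_of_all _ hpos') (LE.le.eventuallyLE ?_)
      intro y hy hy'
      rw [mem_ball_zero_iff] at hy'
      rw [mem_ball_iff_norm'] at hy
      linarith [norm_sub_norm_le x y]
    have hlr : 0 ≤ -log r := by linarith [log_nonpos hr.le hr1]
    have h4 := mul_le_mul_of_nonneg_left h3 hlr
    have h5 := log_one_add_le hx1
    have h6 : 0 ≤ log ‖x‖ := log_nonneg hx1
    have l2 : 0 ≤ log 2 := log_nonneg (by norm_num)
    have h7 : 2 * log (1 + ‖x‖) * τ ≤ m * log 2 + m * log ‖x‖ := by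
      have : 0 ≤ log (1 + ‖x‖) := log_nonneg (by linarith)
      calc 2 * log (1 + ‖x‖) * τ ≤ 2 * (log 2 + log ‖x‖) * (m / 4) := by gcongr
        _ ≤ _ := by nlinarith [mul_nonneg hm0.le l2, mul_nonneg hm0.le h6]
    have h8 : a * logPot f x ≤ a * (m * log (2 * R) + m * log 2) + a * (N * (r ^ 2 * κ)) + -log r := by
      have : logPot f x ≤ m * log (2 * R) + m * log 2 + N * (r ^ 2 * κ) + -log r * τ := by linarith
      have := mul_le_mul_of_nonneg_left this ha.le
      have := mul_le_mul_of_nonneg_right hτ2 hlr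
      linarith
    calc f x ≤ C * exp (a * logPot f x) := h x
      _ ≤ C * exp (a * (m * log (2 * R) + m * log 2) + a * (N * (r ^ 2 * κ)) + -log r) := by gcongr
      _ = _ := by
        rw [exp_add, exp_add, exp_neg, exp_log hr, hC₁]
        ring
  set C₂ := C₁ * exp (a * (4 * κ)) with hC₂
  have bound : ∀ x₀ : E3, 2 * R + 1 ≤ ‖x₀‖ → f x₀ ≤ max (C₂ ^ 2) 4 := by
    intro x₀ hx₀
    obtain ⟨x₁, hx₁, hmax⟩ := (isCompact_closedBall x₀ 1).exists_isMaxOn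
      ⟨x₀, Metric.mem_closedBall_self zero_le_one⟩
      (by fun_prop : Continuous fun x => (1 - ‖x - x₀‖) ^ 2 * f x).continuousOn
    rw [mem_closedBall_iff_norm] at hx₁
    set d := 1 - ‖x₁ - x₀‖ with hd
    set M := f x₁ with hM
    have hM0 : 0 < M := hpos x₁
    have hgx₀ : f x₀ ≤ d ^ 2 * M := by
      simpa using hmax (Metric.mem_closedBall_self zero_le_one)
    have hd0 : 0 < d := by
      rcases (by linarith : 0 ≤ d).eq_or_lt with h0 | h0
      · rw [← h0] at hgx₀
        linarith [hpos x₀]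
      · exact h0
    have hd1 : d ≤ 1 := by linarith [norm_nonneg (x₁ - x₀)]
    have hs0 : 0 < √M := sqrt_pos.2 hM0
    have hs2 : √M ^ 2 = M := sq_sqrt hM0.le
    rcases le_or_gt (√M)⁻¹ (d / 2) with hr | hr
    · refine le_max_of_le_left ?_
      have hb : ∀ y ∈ Metric.ball x₁ (√M)⁻¹, f y ≤ 4 * M := by
        intro y hy
        rw [mem_ball_iff_norm] at hy
        have h1 : d / 2 ≤ 1 - ‖y - x₀‖ := by
          linarith [norm_sub_le_norm_sub_add_norm_sub y x₁ x₀]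
        have h2 : (1 - ‖y - x₀‖) ^ 2 * f y ≤ d ^ 2 * M :=
          hmax (mem_closedBall_iff_norm.2 (by linarith))
        have h3 : (d / 2) ^ 2 * f y ≤ (1 - ‖y - x₀‖) ^ 2 * f y :=
          mul_le_mul_of_nonneg_right (pow_le_pow_left₀ (by positivity) h1 2) (hpos' y)
        refine le_of_mul_le_mul_left (a := (d / 2) ^ 2) ?_ (by positivity)
        linarith
      have h1 := far x₁ (by linarith [norm_sub_norm_le x₀ x₁, norm_sub_rev x₀ x₁]) (√M)⁻¹
        (4 * M) (by positivity) (by linarith) hb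
      rw [inv_inv, inv_pow, hs2, show 4 * M * (M⁻¹ * κ) = 4 * κ by field_simp] at h1
      have h2 : √M ≤ C₂ := by
        refine le_of_mul_le_mul_right (a := √M) ?_ hs0
        rw [← sq, hs2]
        exact h1
      have h3 : M ≤ C₂ ^ 2 := by
        rw [← hs2]
        gcongr
      refine hgx₀.trans (le_trans ?_ h3)
      exact mul_le_of_le_one_left hM0.le (pow_le_one₀ hd0.le hd1)
    · refine le_max_of_le_right (hgx₀.trans ?_)
      rw [lt_inv_comm₀ (by positivity) hs0] at hr
      have h1 : d * √M ≤ 2 := by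
        have := mul_le_mul_of_nonneg_left hr.le hd0.le
        rwa [show d * (d / 2)⁻¹ = 2 by field_simp] at this
      calc d ^ 2 * M = (d * √M) ^ 2 := by rw [mul_pow, hs2]
        _ ≤ 2 ^ 2 := by gcongr
        _ = 4 := by norm_num
  obtain ⟨M, hM0, hM⟩ := exists_bound_ball hc 0 (2 * R + 1)
  refine ⟨max M (max (C₂ ^ 2) 4), le_max_of_le_left hM0, fun y => ?_⟩
  rcases lt_or_ge ‖y‖ (2 * R + 1) with hy | hy
  · exact le_max_of_le_left (hM y (mem_ball_zero_iff.2 hy))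
  · rw [abs_of_pos (hpos y)]
    exact le_max_of_le_right (bound y hy)

/-- Logarithmic asymptotics of the potential of a bounded density. -/
lemma logPot_isLittleO {f : E3 → ℝ} (hc : Continuous f) (hi : Integrable f) (hpos : ∀ y, 0 ≤ f y)
    {M : ℝ} (hM : ∀ y, |f y| ≤ M) :
    (fun x => logPot f x + (∫ y, f y) * log ‖x‖) =o[Bornology.cobounded E3] fun x => log ‖x‖ := by
  set m := ∫ y, f y with hm
  have hm0 : 0 ≤ m := integral_nonneg hpos
  set κ := ∫ z in Metric.ball (0 : E3) 1, ‖z‖⁻¹ with hκ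
  set I := ∫ y, log (1 + ‖y‖⁻¹) * f y with hI
  have hlog : Tendsto (fun x : E3 => log ‖x‖) (Bornology.cobounded E3) atTop :=
    tendsto_log_atTop.comp tendsto_norm_cobounded_atTop
  rw [Asymptotics.isLittleO_iff]
  intro ε hε
  obtain ⟨R, hR, hτ⟩ := exists_tail_lt hi (by positivity : 0 < ε / 4)
  set τ := ∫ y in (Metric.ball 0 R)ᶜ, f y with hτdef
  have hτ0 : 0 ≤ τ := integral_nonneg hpos
  have l2 : 0 ≤ log 2 := log_nonneg (by norm_num)
  filter_upwards [tendsto_norm_cobounded_atTop.eventually_ge_atTop (2 * R),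
    hlog.eventually_ge_atTop ((m * log 2 + |I|) / ε),
    hlog.eventually_ge_atTop ((m * log (2 * R) + ε / 2 * log 2 + |M * κ|) / (ε / 2))] with x hx h1 h2
  have hx1 : 1 ≤ ‖x‖ := by linarith
  have h0 : 0 ≤ log ‖x‖ := log_nonneg hx1
  have h5 := log_one_add_le hx1
  rw [div_le_iff₀ (by positivity)] at h1 h2
  rw [norm_of_nonneg h0, Real.norm_eq_abs, abs_le]
  constructor
  · have h3 := logPot_ge hc hi hpos x
    have := mul_le_mul_of_nonneg_left h5 hm0
    have := le_abs_self I
    rw [← hm, ← hI] at h3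
    linarith
  · have h3 := logPot_le hc hi hpos hR hx
    have h4 := logSing_le hc hi hpos one_pos le_rfl (x := x) (fun y _ => (le_abs_self _).trans (hM y))
    rw [log_one, one_pow, one_mul, neg_zero, zero_mul, add_zero, ← hκ] at h4
    have h6 : 2 * log (1 + ‖x‖) * τ ≤ 2 * (log 2 + log ‖x‖) * (ε / 4) := by
      have : 0 ≤ log (1 + ‖x‖) := log_nonneg (by linarith)
      gcongr
    have := le_abs_self (M * κ)
    linarith

lemma eventually_cobounded_nhds {P : E3 → Prop} (h : ∀ᶠ x in Bornology.cobounded E3, P x) :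
    ∀ᶠ x in Bornology.cobounded E3, ∀ᶠ y in 𝓝 x, P y := by
  rw [← comap_norm_atTop, eventually_comap, eventually_atTop] at h
  obtain ⟨R, hR⟩ := h
  filter_upwards [tendsto_norm_cobounded_atTop.eventually_gt_atTop R] with x hx
  filter_upwards [continuous_norm.continuousAt.eventually (lt_mem_nhds hx)] with y hy
  exact hR _ hy.le y rfl

/-- Decay of the gradient from a first difference estimate. -/
lemma tendsto_fderiv_of_diff_le {g ρ : E3 → ℝ} (hg : Differentiable ℝ g)
    (hρ : Tendsto ρ (Bornology.cobounded E3) (𝓝 0))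
    (h : ∀ x y, |g x - g y| ≤ ‖x - y‖ * (ρ x + ρ y)) :
    Tendsto (fun x => ‖fderiv ℝ g x‖) (Bornology.cobounded E3) (𝓝 0) := by
  refine tendsto_order.2 ⟨fun a ha => Eventually.of_forall fun x => ha.trans_le (norm_nonneg _),
    fun ε hε => ?_⟩
  filter_upwards [eventually_cobounded_nhds (hρ.eventually (gt_mem_nhds (by positivity : 0 < ε / 4)))]
    with x hx
  refine lt_of_le_of_lt ((hg x).hasFDerivAt.le_of_lip' (C := ε / 2) (by positivity) ?_) (by linarith)
  filter_upwards [hx] with y hy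
  rw [Real.norm_eq_abs, mul_comm]
  exact (h y x).trans (mul_le_mul_of_nonneg_left (by linarith [hx.self_of_nhds]) (norm_nonneg _))

lemma tendsto_second_diff {g : E3 → ℝ} (hg : ContDiff ℝ 2 g) (x h : E3) :
    Tendsto (fun t : ℝ => (g (x + t • h) + g (x - t • h) - 2 * g x) / t ^ 2) (𝓝[>] 0)
      (𝓝 (fderiv ℝ (fderiv ℝ g) x h h)) := by
  have hg1 : Differentiable ℝ g := hg.differentiable two_ne_zero
  have hg2 : Differentiable ℝ (fderiv ℝ g) :=
    (hg.fderiv_right (m := 1) (by norm_num)).differentiable one_ne_zero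
  have lp : ∀ t : ℝ, HasDerivAt (fun t : ℝ => x + t • h) h t := fun t => by
    simpa using ((hasDerivAt_id t).smul_const h).const_add x
  have lm : ∀ t : ℝ, HasDerivAt (fun t : ℝ => x - t • h) (-h) t := fun t => by
    simpa using ((hasDerivAt_id t).smul_const h).const_sub x
  have hφ : ∀ t : ℝ, HasDerivAt (fun t : ℝ => g (x + t • h) + g (x - t • h) - 2 * g x)
      (fderiv ℝ g (x + t • h) h - fderiv ℝ g (x - t • h) h) t := fun t => by
    refine ((((hg1 _).hasFDerivAt.comp_hasDerivAt t (lp t)).add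
      ((hg1 _).hasFDerivAt.comp_hasDerivAt t (lm t))).sub_const (2 * g x)).congr_deriv ?_
    rw [map_neg]
    ring
  have hD : HasDerivAt (fun t : ℝ => fderiv ℝ g (x + t • h) h - fderiv ℝ g (x - t • h) h)
      (2 * fderiv ℝ (fderiv ℝ g) x h h) 0 := by
    have e1 := ((hg2 _).hasFDerivAt.comp_hasDerivAt (0:ℝ) (lp 0)).clm_apply (hasDerivAt_const 0 h)
    have e2 := ((hg2 _).hasFDerivAt.comp_hasDerivAt (0:ℝ) (lm 0)).clm_apply (hasDerivAt_const 0 h)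
    refine (e1.fun_sub e2).congr_deriv ?_
    simp
    ring
  refine HasDerivAt.lhopital_zero_nhdsGT (Eventually.of_forall hφ)
    (Eventually.of_forall fun t => hasDerivAt_pow 2 t) ?_ ?_ ?_ ?_
  · filter_upwards [self_mem_nhdsWithin] with t ht
    have : 0 < t := ht
    positivity
  · have := (hφ 0).continuousAt.tendsto.mono_left (nhdsWithin_le_nhds (s := Set.Ioi 0))
    rwa [show g (x + (0:ℝ) • h) + g (x - (0:ℝ) • h) - 2 * g x = 0 by
      rw [zero_smul, add_zero, sub_zero]; ring] at this
  · have := ((hasDerivAt_pow 2 (0:ℝ)).continuousAt.tendsto.mono_left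
      (nhdsWithin_le_nhds (s := Set.Ioi 0)))
    simpa using this
  · have := hD.tendsto_slope_zero_right.const_mul (1 / 2)
    rw [show (1 / 2 : ℝ) * (2 * fderiv ℝ (fderiv ℝ g) x h h) = fderiv ℝ (fderiv ℝ g) x h h by ring] at this
    refine this.congr' ?_
    filter_upwards [self_mem_nhdsWithin] with t ht
    have ht0 : t ≠ 0 := ne_of_gt ht
    simp
    field_simp

lemma norm_iteratedFDeriv_two_le {g : E3 → ℝ} (hg : ContDiff ℝ 2 g) {x : E3} {C : ℝ} (hC : 0 ≤ C)
    (h : ∀ z, |fderiv ℝ (fderiv ℝ g) x z z| ≤ C * ‖z‖ ^ 2) : ‖iteratedFDeriv ℝ 2 g x‖ ≤ C := by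
  have hsymm : IsSymmSndFDerivAt ℝ g x := hg.contDiffAt.isSymmSndFDerivAt (by simp)
  set B := fderiv ℝ (fderiv ℝ g) x with hB
  refine ContinuousMultilinearMap.opNorm_le_bound hC fun m => ?_
  rw [iteratedFDeriv_two_apply, Fin.prod_univ_two, ← hB, Real.norm_eq_abs]
  generalize m 0 = y
  generalize m 1 = z
  by_cases hy : y = 0
  · simp [hy]
  by_cases hz : z = 0
  · simp [hz]
  have hy0 : 0 < ‖y‖ := norm_pos_iff.2 hy
  have hz0 : 0 < ‖z‖ := norm_pos_iff.2 hz
  have hs : B z y = B y z := hsymm z y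
  have h1 := h (‖z‖ • y + ‖y‖ • z)
  have h2 := h (‖z‖ • y - ‖y‖ • z)
  have hp := parallelogram_law_with_norm ℝ (‖z‖ • y) (‖y‖ • z)
  rw [norm_smul, norm_smul, norm_norm, norm_norm] at hp
  have e : 4 * (‖y‖ * ‖z‖) * B y z = B (‖z‖ • y + ‖y‖ • z) (‖z‖ • y + ‖y‖ • z) -
      B (‖z‖ • y - ‖y‖ • z) (‖z‖ • y - ‖y‖ • z) := by
    simp only [map_add, map_sub, map_smul, _root_.add_apply, _root_.sub_apply, _root_.smul_apply,
      smul_eq_mul, hs]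
    ring
  have h3 : |4 * (‖y‖ * ‖z‖) * B y z| ≤ 4 * (‖y‖ * ‖z‖) * (C * (‖y‖ * ‖z‖)) := by
    rw [e]
    refine (abs_sub _ _).trans ((add_le_add h1 h2).trans (le_of_eq ?_))
    rw [← mul_add, hp]
    ring
  rw [abs_mul, abs_of_pos (by positivity)] at h3
  exact le_of_mul_le_mul_left h3 (by positivity)

/-- Decay of the Hessian from a second difference estimate. -/
lemma tendsto_iteratedFDeriv_two_of_diff_le {g σ : E3 → ℝ} (hg : ContDiff ℝ 2 g)
    (hσ : Tendsto σ (Bornology.cobounded E3) (𝓝 0))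
    (h : ∀ x z, |g (x + z) + g (x - z) - 2 * g x| ≤ ‖z‖ ^ 2 * (σ x + σ (x + z) + σ (x - z))) :
    Tendsto (fun x => ‖iteratedFDeriv ℝ 2 g x‖) (Bornology.cobounded E3) (𝓝 0) := by
  refine tendsto_order.2 ⟨fun a ha => Eventually.of_forall fun x => ha.trans_le (norm_nonneg _),
    fun ε hε => ?_⟩
  filter_upwards [eventually_cobounded_nhds (hσ.eventually (gt_mem_nhds (by positivity : 0 < ε / 6)))]
    with x hx
  refine lt_of_le_of_lt (norm_iteratedFDeriv_two_le hg (C := ε / 2) (by positivity) fun z => ?_)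
    (by linarith)
  refine le_of_tendsto (tendsto_second_diff hg x z).abs ?_
  have cp : Tendsto (fun t : ℝ => x + t • z) (𝓝[>] 0) (𝓝 x) := by
    have : Continuous fun t : ℝ => x + t • z := by fun_prop
    simpa using (this.tendsto 0).mono_left (nhdsWithin_le_nhds (s := Set.Ioi 0))
  have cm : Tendsto (fun t : ℝ => x - t • z) (𝓝[>] 0) (𝓝 x) := by
    have : Continuous fun t : ℝ => x - t • z := by fun_prop
    simpa using (this.tendsto 0).mono_left (nhdsWithin_le_nhds (s := Set.Ioi 0))
  filter_upwards [cp.eventually hx, cm.eventually hx, self_mem_nhdsWithin] with t h1 h2 ht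
  have ht0 : 0 < t := ht
  rw [abs_div, abs_of_pos (pow_pos ht0 2), div_le_iff₀ (pow_pos ht0 2)]
  refine (h x (t • z)).trans ?_
  rw [norm_smul, norm_of_nonneg ht0.le]
  calc (t * ‖z‖) ^ 2 * (σ x + σ (x + t • z) + σ (x - t • z)) ≤ (t * ‖z‖) ^ 2 * (ε / 2) := by
        gcongr
        linarith [hx.self_of_nhds]
    _ = _ := by ring

/-- Theorem 2 (asymptotic behaviour): if `u` is a smooth solution of
`(−Δ)^{3/2}u = 2e^{3u}` with finite volume, then `p := u − v` is a polynomial of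
degree 0 or 2 bounded from above, `∇v → 0` and `D²v → 0` at infinity, and
`v(x) = −α log|x| + o(log|x|)` as `|x| → ∞`, with `α > 0`. -/
theorem asymptotics_of_solutions (u : E3 → ℝ) (hu : IsSolution u) :
    (∃ P : MvPolynomial (Fin 3) ℝ,
        (P.totalDegree = 0 ∨ P.totalDegree = 2) ∧
        (∀ x : E3, u x - solV u x = MvPolynomial.eval (fun i => x i) P) ∧
        BddAbove (Set.range fun x : E3 => u x - solV u x)) ∧
    Filter.Tendsto (fun x : E3 => ‖gradient (solV u) x‖)
      (Filter.comap (fun x : E3 => ‖x‖) Filter.atTop) (𝓝 0) ∧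
    Filter.Tendsto (fun x : E3 => ‖iteratedFDeriv ℝ 2 (solV u) x‖)
      (Filter.comap (fun x : E3 => ‖x‖) Filter.atTop) (𝓝 0) ∧
    (fun x : E3 => solV u x + solAlpha u * Real.log ‖x‖)
      =o[Filter.comap (fun x : E3 => ‖x‖) Filter.atTop] (fun x : E3 => Real.log ‖x‖) ∧
    0 < solAlpha u := by
  have hc := hu.continuous_exp
  have hi := hu.2.2.1
  have hpos : ∀ y, 0 < exp (3 * u y) := fun y => exp_pos _
  have hπ : 0 < 1 / π ^ 2 := by positivity
  obtain ⟨c, l, T, hq, ⟨M, hM⟩, hl⟩ := hu.exists_quadratic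
  have hlogV : ∀ x, solV u x = (1 / π ^ 2) * logPot (fun y => exp (3 * u y)) x := solV_eq u
  set f : E3 → ℝ := fun y => exp (3 * u y) with hf
  have hsmooth : ContDiff ℝ 2 (solV u) := by
    have e : solV u = fun x => u x - (c + inner ℝ l x + inner ℝ (LinearMap.toContinuousLinearMap T x) x) :=
      funext fun x => by
        have := hq x
        rw [LinearMap.coe_toContinuousLinearMap']
        linarith
    rw [e]
    have hu2 : ContDiff ℝ 2 u := contDiff_infty.1 hu.1 2
    exact hu2.sub ((contDiff_const.add (contDiff_const.inner ℝ contDiff_id)).add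
      ((LinearMap.toContinuousLinearMap T).contDiff.inner ℝ contDiff_id))
  have hexp : ∀ x, f x ≤ exp (3 * M) * exp (3 * (1 / π ^ 2) * logPot f x) := fun x => by
    rw [← exp_add]
    refine exp_le_exp.2 ?_
    have h1 := hM x
    rw [hlogV] at h1
    linarith
  obtain ⟨N, hN0, hN⟩ := bounded_of_le_exp_logPot hc hi hpos (exp_pos _).le (by positivity) hexp
  rw [comap_norm_atTop]
  refine ⟨?_, ?_, ?_, ?_, ?_⟩
  · obtain ⟨P, hP, hPe⟩ := exists_mvPolynomial hq hl
    exact ⟨P, hP, hPe, M, by rintro _ ⟨x, rfl⟩; exact hM x⟩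
  · have h1 : Tendsto (fun x => (1 / π ^ 2) * ∫ y, (‖x - y‖ ^ 1)⁻¹ * |f y|)
        (Bornology.cobounded E3) (𝓝 0) := by
      simpa only [mul_zero] using (tendsto_riesz hc hi hN one_ne_zero one_le_two).const_mul (1 / π ^ 2)
    simp only [pow_one] at h1
    simp only [gradient, LinearIsometryEquiv.norm_map]
    refine tendsto_fderiv_of_diff_le (hsmooth.differentiable two_ne_zero) h1 fun x y => ?_
    rw [hlogV, hlogV, ← mul_sub, abs_mul, abs_of_pos hπ]
    refine (mul_le_mul_of_nonneg_left (abs_logPot_sub_le hc hi x y) hπ.le).trans (le_of_eq ?_)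
    ring
  · have h1 : Tendsto (fun x => (1 / π ^ 2) * ∫ y, (‖x - y‖ ^ 2)⁻¹ * |f y|)
        (Bornology.cobounded E3) (𝓝 0) := by
      simpa only [mul_zero] using (tendsto_riesz hc hi hN two_ne_zero le_rfl).const_mul (1 / π ^ 2)
    refine tendsto_iteratedFDeriv_two_of_diff_le hsmooth h1 fun x z => ?_
    rw [hlogV, hlogV, hlogV, show ∀ a b d : ℝ, 1 / π ^ 2 * a + 1 / π ^ 2 * b - 2 * (1 / π ^ 2 * d) =
      1 / π ^ 2 * (a + b - 2 * d) from fun a b d => by ring, abs_mul, abs_of_pos hπ]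
    refine (mul_le_mul_of_nonneg_left (abs_logPot_second_diff_le hc hi x z) hπ.le).trans (le_of_eq ?_)
    ring
  · refine ((logPot_isLittleO hc hi (fun y => (hpos y).le) hN).const_mul_left (1 / π ^ 2)).congr_left
      fun x => ?_
    rw [hlogV, solAlpha]
    ring
  · exact mul_pos hπ hu.integral_pos
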